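/- arXiv:0901.3182 — 7 statements merged into one kernel-verified Lean document; each statement's English description precedes it below -/
import Mathlib

section
/- Let G be a finite non-abelian 2-group such that the center Z(G) is not cyclic and the quotient Q = G/Z(G) is powerful, i.e., the derived subgroup Q' is contained in Q^4, the subgroup of Q generated by all fourth powers. Then G has a noninner automorphism of order 2 that fixes the Frattini subgroup Φ(G) elementwise. -/
open Subgroup

/-- The subgroup generated by the `n`-th powers. -/
def powerSubgroup (G : Type*) [Group G] (n : ℕ) : Subgroup G :=
  closure {x : G | ∃ y : G, y ^ n = x}

section PowerSubgroup

variable {G H : Type*} [Group G] [Group H]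

theorem pow_mem_powerSubgroup (n : ℕ) (x : G) : x ^ n ∈ powerSubgroup G n :=
  subset_closure ⟨x, rfl⟩

theorem powerSubgroup_le {n : ℕ} {K : Subgroup G} (h : ∀ x : G, x ^ n ∈ K) :
    powerSubgroup G n ≤ K :=
  (closure_le K).2 fun _ ⟨y, hy⟩ => hy ▸ h y

theorem map_powerSubgroup (f : G →* H) (hf : Function.Surjective f) (n : ℕ) :
    (powerSubgroup G n).map f = powerSubgroup H n := by
  apply le_antisymm
  · rw [map_le_iff_le_comap]
    exact powerSubgroup_le fun x => by
      rw [mem_comap, map_pow]; exact pow_mem_powerSubgroup n _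
  · refine powerSubgroup_le fun y => ?_
    obtain ⟨x, rfl⟩ := hf y
    exact ⟨x ^ n, pow_mem_powerSubgroup n x, map_pow f x n⟩

instance powerSubgroup_characteristic (n : ℕ) : (powerSubgroup G n).Characteristic :=
  characteristic_iff_map_eq.2 fun φ => map_powerSubgroup φ.toMonoidHom φ.surjective n

theorem commutator_le_powerSubgroup_of_surjective (f : G →* H) (hf : Function.Surjective f)
    {n : ℕ} (h : commutator G ≤ powerSubgroup G n) :
    commutator H ≤ powerSubgroup H n := by
  have hmap : (commutator G).map f = commutator H := by
    rw [map_commutator_eq, MonoidHom.range_eq_top.2 hf, commutator_def]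
  rw [← map_powerSubgroup f hf, ← hmap]
  exact map_mono h

end PowerSubgroup

section Powerful

open scoped commutatorElement

theorem commutatorElement_mul_left_of_mem_center {G : Type*} [Group G] {a b x : G}
    (h : ⁅b, x⁆ ∈ center G) : ⁅a * b, x⁆ = ⁅a, x⁆ * ⁅b, x⁆ := by
  have h1 : ⁅a * b, x⁆ = a * ⁅b, x⁆ * a⁻¹ * ⁅a, x⁆ := by
    simp only [commutatorElement_def]; group
  rw [h1, mem_center_iff.1 h a, mul_inv_cancel_right, ← mem_center_iff.1 h]

theorem commutatorElement_sq_left_of_mem_center {G : Type*} [Group G] {a x : G}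
    (h : ⁅a, x⁆ ∈ center G) : ⁅a ^ 2, x⁆ = ⁅a, x⁆ ^ 2 := by
  rw [sq, commutatorElement_mul_left_of_mem_center h, sq]

theorem sq_mem_center_of_commutator_sq_mem_center {G : Type*} [Group G]
    (hpow : commutator G ≤ powerSubgroup G 4)
    (h4 : ∀ n ∈ powerSubgroup G 2, n ^ 4 = 1)
    (hc : ∀ n ∈ powerSubgroup G 2, ∀ g : G, ⁅n, g⁆ ∈ center G) (x : G) :
    x ^ 2 ∈ center G := by
  set N := powerSubgroup G 2
  have hNc : ∀ n ∈ N, ∀ g : G, ⁅n, g⁆ ∈ N := fun n hn g => by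
    rw [commutatorElement_def, mul_assoc, mul_assoc]
    refine N.mul_mem hn ?_
    rw [← mul_assoc]
    exact (inferInstance : N.Normal).conj_mem _ (N.inv_mem hn) g
  have hsq : ∀ y : G, y ^ 2 ∈ N := pow_mem_powerSubgroup 2
  have hcomm : ∀ n ∈ N, ∀ m ∈ N, Commute (n ^ 2) (m ^ 2) := fun n hn m hm => by
    have h1 : ⁅n ^ 2, m ^ 2⁆ = ⁅n, m ^ 2⁆ ^ 2 :=
      commutatorElement_sq_left_of_mem_center (hc n hn _)
    have h2 : ⁅m ^ 2, n⁆ = ⁅m, n⁆ ^ 2 :=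
      commutatorElement_sq_left_of_mem_center (hc m hm _)
    rw [← commutatorElement_eq_one_iff_commute, h1, ← commutatorElement_inv, h2, inv_pow,
      ← pow_mul, h4 _ (hNc m hm n), inv_one]
  have hP4comm : ∀ c ∈ powerSubgroup G 4, ∀ y : G, Commute c (y ^ 4) := fun c hc' y => by
    have : powerSubgroup G 4 ≤ centralizer {y ^ 4} := powerSubgroup_le fun u => by
      rw [mem_centralizer_singleton_iff]
      have := hcomm _ (hsq u) _ (hsq y)
      rw [← pow_mul, ← pow_mul] at this
      exact this.eq
    exact mem_centralizer_singleton_iff.1 (this hc')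
  have hP4sq : ∀ c ∈ powerSubgroup G 4, c ^ 2 = 1 := fun c hc' => by
    induction hc' using closure_induction with
    | mem x hx =>
      obtain ⟨y, rfl⟩ := hx
      have := h4 _ (hsq y)
      rw [← pow_mul] at this ⊢
      exact this
    | one => exact one_pow 2
    | mul a b ha hb iha ihb =>
      have hab : Commute a b := by
        have : powerSubgroup G 4 ≤ centralizer {a} := powerSubgroup_le fun u => by
          rw [mem_centralizer_singleton_iff]
          exact (hP4comm a ha u).symm.eq
        exact (mem_centralizer_singleton_iff.1 (this hb)).symm
      rw [hab.mul_pow, iha, ihb, one_mul]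
    | inv a _ iha => rw [inv_pow, iha, inv_one]
  have hP4N : powerSubgroup G 4 ≤ N := powerSubgroup_le fun u => by
    have := N.pow_mem (hsq u) 2
    rwa [← pow_mul] at this
  have hsqcomm : ∀ y g : G, ⁅y ^ 2, g⁆ = ⁅y, ⁅y, g⁆⁆ := fun y g => by
    have h1 : ⁅y ^ 2, g⁆ = ⁅y, ⁅y, g⁆⁆ * ⁅y, g⁆ ^ 2 := by
      simp [commutatorElement_def, sq, mul_assoc]
    have h2 : ⁅y, g⁆ ∈ commutator G := commutator_mem_commutator (mem_top y) (mem_top g)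
    rw [h1, hP4sq _ (hpow h2), mul_one]
  have hfour : ∀ y g : G, ⁅y ^ 4, g⁆ = ⁅y ^ 2, g⁆ ^ 2 := fun y g => by
    rw [← commutatorElement_sq_left_of_mem_center (hc _ (hsq y) g), ← pow_mul]
  have key : ∀ k : ℕ, (∀ y g : G, ⁅y ^ 4, g⁆ ^ k = 1) → ∀ y g : G, ⁅y ^ 2, g⁆ ^ k = 1 := by
    intro k hk
    have hP4 : ∀ c ∈ powerSubgroup G 4, ∀ g : G, ⁅c, g⁆ ^ k = 1 := fun c hc' g => by
      induction hc' using closure_induction with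
      | mem x hx => obtain ⟨y, rfl⟩ := hx; exact hk y g
      | one => rw [commutatorElement_one_left, one_pow]
      | mul a b ha hb iha ihb =>
        have hbz := hc b (hP4N hb) g
        rw [commutatorElement_mul_left_of_mem_center hbz,
          Commute.mul_pow (mem_center_iff.1 hbz _), iha, ihb, one_mul]
      | inv a ha iha =>
        have haz := hc a (hP4N ha) g
        have h1 := commutatorElement_mul_left_of_mem_center (a := a⁻¹) haz
        rw [inv_mul_cancel, commutatorElement_one_left] at h1
        rw [eq_inv_of_mul_eq_one_left h1.symm, inv_pow, iha, inv_one]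
    intro y g
    have h2 : ⁅y, g⁆ ∈ commutator G := commutator_mem_commutator (mem_top y) (mem_top g)
    rw [hsqcomm, ← commutatorElement_inv, inv_pow, hP4 _ (hpow h2), inv_one]
  have h2 : ∀ y g : G, ⁅y ^ 2, g⁆ ^ 2 = 1 := key 2 fun y g => by
    rw [hfour, ← pow_mul]
    exact h4 _ (hNc _ (hsq y) g)
  have h1 : ∀ y g : G, ⁅y ^ 2, g⁆ ^ 1 = 1 := key 1 fun y g => by
    rw [hfour, h2, one_pow]
  rw [mem_center_iff]
  intro g
  have := h1 x g
  rw [pow_one, commutatorElement_eq_one_iff_mul_comm] at this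
  exact this.symm

theorem sq_mem_center_of_powerful {G : Type*} [Group G] [Group.IsNilpotent G]
    (hpow : commutator G ≤ powerSubgroup G 4)
    (h4 : ∀ n ∈ powerSubgroup G 2, n ^ 4 = 1) (x : G) : x ^ 2 ∈ center G := by
  revert x hpow h4
  refine Group.nilpotent_center_quotient_ind
    (P := fun G _ _ => commutator G ≤ powerSubgroup G 4 →
      (∀ n ∈ powerSubgroup G 2, n ^ 4 = 1) → ∀ x : G, x ^ 2 ∈ center G) G ?_ ?_
  · intro G _ _ _ _ x
    rw [Subsingleton.elim (x ^ 2) 1]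
    exact one_mem _
  · intro G _ _ ih hpow h4
    have hsurj := QuotientGroup.mk'_surjective (center G)
    have hquot := ih (commutator_le_powerSubgroup_of_surjective _ hsurj hpow) fun n hn => by
      rw [← map_powerSubgroup _ hsurj] at hn
      obtain ⟨m, hm, rfl⟩ := hn
      rw [← map_pow, h4 m hm, map_one]
    refine sq_mem_center_of_commutator_sq_mem_center hpow h4 fun n hn g => ?_
    have hn' : (QuotientGroup.mk' (center G)) n ∈ center (G ⧸ center G) :=
      powerSubgroup_le hquot (map_powerSubgroup _ hsurj 2 ▸ mem_map_of_mem _ hn)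
    rw [← QuotientGroup.ker_mk' (center G), MonoidHom.mem_ker, map_commutatorElement,
      commutatorElement_eq_one_iff_mul_comm]
    exact (mem_center_iff.1 hn' _).symm

theorem commutator_powerSubgroup_two_le {G : Type*} [Group G] [Group.IsNilpotent G]
    (hpow : commutator G ≤ powerSubgroup G 4) :
    commutator (powerSubgroup G 2) ≤ powerSubgroup (powerSubgroup G 2) 4 := by
  set N := powerSubgroup G 2
  let K : Subgroup G := (powerSubgroup N 4).map N.subtype
  have hK : K.Normal := inferInstance
  have hsurj := QuotientGroup.mk'_surjective K
  have hquot := sq_mem_center_of_powerful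
    (commutator_le_powerSubgroup_of_surjective _ hsurj hpow) fun n hn => by
      rw [← map_powerSubgroup _ hsurj] at hn
      obtain ⟨m, hm, rfl⟩ := hn
      rw [← map_pow, ← MonoidHom.mem_ker, QuotientGroup.ker_mk']
      exact ⟨⟨m, hm⟩ ^ 4, pow_mem_powerSubgroup 4 _, rfl⟩
  rw [commutator_def, commutator_le]
  intro a _ b _
  have ha : (QuotientGroup.mk' K) a ∈ center (G ⧸ K) :=
    powerSubgroup_le hquot (map_powerSubgroup _ hsurj 2 ▸ mem_map_of_mem _ a.2)
  have hab : ⁅(a : G), (b : G)⁆ ∈ K := by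
    rw [← QuotientGroup.ker_mk' K, MonoidHom.mem_ker, map_commutatorElement,
      commutatorElement_eq_one_iff_mul_comm]
    exact (mem_center_iff.1 ha _).symm
  obtain ⟨c, hc, hcab⟩ := hab
  exact (Subtype.ext hcab : c = ⁅a, b⁆) ▸ hc

end Powerful

section Characters

variable {G : Type*} [Group G]

theorem IsPGroup.exists_character_ne_one [Finite G] [Nontrivial G] (h : IsPGroup 2 G) :
    ∃ χ : G →* ℤˣ, χ ≠ 1 := by
  classical
  obtain ⟨n, hn⟩ := IsPGroup.iff_card.1 h
  have hn0 : n ≠ 0 := by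
    rintro rfl
    exact (Finite.one_lt_card (α := G)).ne' (by simpa using hn)
  obtain ⟨m, rfl⟩ := Nat.exists_eq_succ_of_ne_zero hn0
  obtain ⟨K, hK⟩ := Sylow.exists_subgroup_card_pow_prime 2 (n := m)
    (hn ▸ pow_dvd_pow 2 m.le_succ)
  have hi : K.index = 2 := by
    have := K.card_mul_index
    rw [hn, hK, Nat.succ_eq_add_one, pow_succ] at this
    exact Nat.eq_of_mul_eq_mul_left (by positivity) this
  refine ⟨MonoidHom.mk' (fun x => if x ∈ K then 1 else -1) fun a b => ?_, fun hχ => ?_⟩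
  · have := mul_mem_iff_of_index_two hi (a := a) (b := b)
    by_cases ha : a ∈ K <;> by_cases hb : b ∈ K <;> simp [ha, hb, this]
  · have htop : K = ⊤ := eq_top_iff.2 fun x _ => by
      by_contra hx
      have := DFunLike.congr_fun hχ x
      simp [hx] at this
    rw [htop, index_top] at hi
    omega

theorem character_eq_one_of_mem_frattini (χ : G →* ℤˣ) {x : G} (hx : x ∈ frattini G) :
    χ x = 1 := by
  by_cases h : χ.ker = ⊤
  · exact MonoidHom.mem_ker.1 (h ▸ mem_top x)
  refine MonoidHom.mem_ker.1 (frattini_le_coatom ⟨h, fun K hK => ?_⟩ hx)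
  obtain ⟨hle, k, hk, hk'⟩ := SetLike.lt_iff_le_and_exists.1 hK
  have hk1 : χ k = -1 := (Int.units_eq_one_or _).resolve_left hk'
  refine eq_top_iff.2 fun g _ => ?_
  rcases Int.units_eq_one_or (χ g) with hg | hg
  · exact hle hg
  · have : g * k ∈ K := hle (by rw [MonoidHom.mem_ker, map_mul, hg, hk1]; decide)
    exact (K.mul_mem_cancel_right hk).1 this

theorem index_powerSubgroup_two_le_card_characters [Finite G] :
    (powerSubgroup G 2).index ≤ Nat.card (G →* ℤˣ) := by
  set N := powerSubgroup G 2
  have hsq : ∀ q : G ⧸ N, q ^ 2 = 1 := fun q => by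
    obtain ⟨x, rfl⟩ := QuotientGroup.mk_surjective q
    rw [← QuotientGroup.mk_pow, QuotientGroup.eq_one_iff]
    exact pow_mem_powerSubgroup 2 x
  let : CommGroup (G ⧸ N) :=
    { (inferInstance : Group (G ⧸ N)) with
      mul_comm := fun a b => by
        have hinv : ∀ q : G ⧸ N, q⁻¹ = q := fun q =>
          inv_eq_of_mul_eq_one_left (by rw [← sq, hsq])
        rw [← hinv (a * b), mul_inv_rev, hinv, hinv] }
  have : HasEnoughRootsOfUnity ℤ 2 := ⟨⟨-1, IsPrimitiveRoot.neg_one 0 (by decide)⟩, inferInstance⟩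
  have : HasEnoughRootsOfUnity ℤ (Monoid.exponent (G ⧸ N)) :=
    HasEnoughRootsOfUnity.of_dvd ℤ (Monoid.exponent_dvd_of_forall_pow_eq_one hsq)
  have : Finite (G →* ℤˣ) := DFunLike.finite _
  rw [index_eq_card, ← CommGroup.card_monoidHom_of_hasEnoughRootsOfUnity (G ⧸ N) ℤ]
  refine Nat.card_le_card_of_injective (fun χ => χ.comp (QuotientGroup.mk' N)) fun χ ψ h => ?_
  exact (MonoidHom.cancel_right (QuotientGroup.mk'_surjective N)).1 h

theorem card_characters_le_of_surjective {H : Type*} [Group H] [Finite G] (f : G →* H)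
    (hf : Function.Surjective f) : Nat.card (H →* ℤˣ) ≤ Nat.card (G →* ℤˣ) := by
  have : Finite (G →* ℤˣ) := DFunLike.finite _
  exact Nat.card_le_card_of_injective (fun χ => χ.comp f) fun χ ψ h =>
    (MonoidHom.cancel_right hf).1 h

theorem IsPGroup.powerSubgroup_two_ne_top [Finite G] [Nontrivial G] (h : IsPGroup 2 G) :
    powerSubgroup G 2 ≠ ⊤ := by
  obtain ⟨χ, hχ⟩ := h.exists_character_ne_one
  intro htop
  refine hχ (MonoidHom.ext fun x => ?_)
  have : powerSubgroup G 2 ≤ χ.ker := powerSubgroup_le fun y => by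
    rw [MonoidHom.mem_ker, map_pow, Int.units_sq]
  exact this (htop ▸ mem_top x)

end Characters

/-- In a powerful finite `2`-group, an elementary abelian subgroup has at most as many elements
as the quotient by the subgroup generated by squares. -/
theorem IsPGroup.card_le_index_powerSubgroup_two {G : Type*} [Group G] [Finite G]
    (hG : IsPGroup 2 G) (hpow : commutator G ≤ powerSubgroup G 4)
    (E : Subgroup G) (hE : ∀ e ∈ E, e ^ 2 = 1) :
    Nat.card E ≤ (powerSubgroup G 2).index := by
  induction hn : Nat.card G using Nat.strong_induction_on generalizing G with
  | _ n ih =>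
  subst hn
  rcases subsingleton_or_nontrivial G with hs | hs
  · exact (Finite.card_le_one_iff_subsingleton.2 inferInstance).trans
      (Nat.one_le_iff_ne_zero.2 index_ne_zero_of_finite)
  have : Fact (Nat.Prime 2) := ⟨Nat.prime_two⟩
  have := hG.isNilpotent
  have hne := hG.powerSubgroup_two_ne_top
  have hN := commutator_powerSubgroup_two_le hpow
  set N := powerSubgroup G 2
  have hlt : Nat.card N < Nat.card G :=
    lt_of_le_of_ne (card_le_card_group N) fun h => hne (N.eq_top_of_card_eq h)
  have hrec := ih _ hlt (hG.to_subgroup N) hN (E.subgroupOf N)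
    (fun e he => Subtype.ext (hE _ he)) rfl
  let K : Subgroup G := (powerSubgroup N 2).map N.subtype
  have hK : K.Normal := inferInstance
  have h4K : powerSubgroup G 4 ≤ K := powerSubgroup_le fun x =>
    ⟨⟨x ^ 2, pow_mem_powerSubgroup 2 x⟩ ^ 2, pow_mem_powerSubgroup 2 _, by
      simp [← pow_mul]⟩
  have hcomm : ∀ a b : G ⧸ K, a * b = b * a := fun a b => by
    obtain ⟨x, rfl⟩ := QuotientGroup.mk'_surjective K a
    obtain ⟨y, rfl⟩ := QuotientGroup.mk'_surjective K b
    rw [← commutatorElement_eq_one_iff_mul_comm, ← map_commutatorElement, ← MonoidHom.mem_ker,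
      QuotientGroup.ker_mk']
    exact h4K (hpow (commutator_mem_commutator (mem_top x) (mem_top y)))
  let π : G →* G ⧸ K := MonoidHom.mk' (fun x => (QuotientGroup.mk' K x) ^ 2) fun a b => by
    rw [map_mul]
    exact Commute.mul_pow (hcomm _ _) 2
  have hEker : E ≤ π.ker := fun e he => by
    change (QuotientGroup.mk' K e) ^ 2 = 1
    rw [← map_pow, hE e he, map_one]
  have hNker : N ≤ π.ker := fun e he => by
    change (QuotientGroup.mk' K e) ^ 2 = 1
    rw [← map_pow, ← MonoidHom.mem_ker, QuotientGroup.ker_mk']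
    exact ⟨⟨e, he⟩ ^ 2, pow_mem_powerSubgroup 2 _, rfl⟩
  have hrange : N.map (QuotientGroup.mk' K) ≤ π.range := by
    rw [map_le_iff_le_comap]
    exact powerSubgroup_le fun x => ⟨x, rfl⟩
  have hNK : (powerSubgroup N 2).index ≤ π.ker.index := by
    rw [index_ker]
    calc (powerSubgroup N 2).index = K.relIndex N := by
          rw [relIndex, subgroupOf, comap_map_eq_self_of_injective N.subtype_injective]
      _ = Nat.card (N.map (QuotientGroup.mk' K)) := by
          rw [← relIndex_ker, QuotientGroup.ker_mk']
      _ ≤ _ := card_le_of_le hrange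
  calc Nat.card E = Nat.card (E.subgroupOf N) * N.relIndex E := by
        rw [← card_map_of_injective N.subtype_injective, subgroupOf_map_subtype, inf_comm,
          ← subgroupOf_map_subtype, card_map_of_injective E.subtype_injective, relIndex,
          card_mul_index]
    _ ≤ π.ker.index * N.relIndex π.ker :=
        Nat.mul_le_mul (hrec.trans hNK) (relIndex_le_of_le_right hEker index_ne_zero_of_finite)
    _ = N.index := by rw [mul_comm, relIndex_mul_index hNker]

section Twist

variable {G : Type*} [Group G]

/-- The automorphism `x ↦ x * f x` attached to a homomorphism `f` into the center such that
`f x` is killed by squaring and by `f`. -/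
def centralTwist (f : G →* G) (hc : ∀ x, f x ∈ center G) (h2 : ∀ x, f x * f x = 1)
    (hf : ∀ x, f (f x) = 1) : MulAut G where
  toFun x := x * f x
  invFun x := x * f x
  left_inv x := by simp [hf, mul_assoc, h2]
  right_inv x := by simp [hf, mul_assoc, h2]
  map_mul' x y := by
    rw [map_mul, mul_assoc x, mul_assoc x, ← mul_assoc y, mem_center_iff.1 (hc x), mul_assoc]

theorem orderOf_centralTwist (f : G →* G) (hc : ∀ x, f x ∈ center G) (h2 : ∀ x, f x * f x = 1)
    (hf : ∀ x, f (f x) = 1) {x : G} (hx : f x ≠ 1) : orderOf (centralTwist f hc h2 hf) = 2 := by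
  have : Fact (Nat.Prime 2) := ⟨Nat.prime_two⟩
  refine orderOf_eq_prime ?_ fun h => ?_
  · ext y
    rw [sq]
    exact (centralTwist f hc h2 hf).left_inv y
  · exact hx (mul_eq_left.1 (DFunLike.congr_fun h x))

/-- The homomorphism from `ℤˣ` sending `-1` to the involution `z`. -/
def involutionHom (z : G) (hz : z * z = 1) : ℤˣ →* G :=
  MonoidHom.mk' (fun u => if u = 1 then 1 else z) fun u v => by
    rcases Int.units_eq_one_or u with rfl | rfl <;>
    rcases Int.units_eq_one_or v with rfl | rfl <;> simp [hz]

theorem involutionHom_apply (z : G) (hz : z * z = 1) (u : ℤˣ) :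
    involutionHom z hz u = if u = 1 then 1 else z := rfl

theorem involutionHom_mem (z : G) (hz : z * z = 1) {K : Subgroup G} (h : z ∈ K) (u : ℤˣ) :
    involutionHom z hz u ∈ K := by
  rw [involutionHom_apply]
  split_ifs
  exacts [K.one_mem, h]

end Twist

/-- A finite commutative `2`-group with at most one involution is cyclic. -/
theorem IsPGroup.isCyclic_of_involution_unique {A : Type*} [CommGroup A] [Finite A]
    (hA : IsPGroup 2 A) (h : ∀ z w : A, z ^ 2 = 1 → w ^ 2 = 1 → z ≠ 1 → w ≠ 1 → z = w) :
    IsCyclic A := by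
  classical
  have := Fintype.ofFinite A
  have htwo : Nat.card (powMonoidHom 2 : A →* A).ker ≤ 2 := by
    refine (Nat.card_le_card_of_injective (β := Bool) (fun a => decide (a.1 = 1))
      fun ⟨a, ha⟩ ⟨b, hb⟩ hab => ?_).trans_eq (by simp)
    have hab' : a = 1 ↔ b = 1 := by simpa using hab
    rw [Subtype.mk.injEq]
    by_cases ha1 : a = 1
    · rw [ha1, hab'.1 ha1]
    · exact h a b ha hb ha1 (hab'.not.1 ha1)
  have hker : ∀ k : ℕ, Nat.card (powMonoidHom (2 ^ k) : A →* A).ker ≤ 2 ^ k := by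
    intro k
    induction k with
    | zero =>
      rw [pow_zero, Finite.card_le_one_iff_subsingleton]
      refine ⟨fun a b => Subtype.ext ?_⟩
      have ha := a.2
      have hb := b.2
      rw [MonoidHom.mem_ker, powMonoidHom_apply, pow_one] at ha hb
      rw [ha, hb]
    | succ k ih =>
      set f := (powMonoidHom 2 : A →* A)
      set S := (powMonoidHom (2 ^ k) : A →* A).ker
      have hS : (powMonoidHom (2 ^ (k + 1)) : A →* A).ker = S.comap f := by
        ext a
        simp [S, f, MonoidHom.mem_ker, pow_succ', pow_mul]
      rw [hS, ← relIndex_bot_left, ← relIndex_mul_relIndex ⊥ f.ker _ bot_le (f.ker_le_comap S),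
        relIndex_bot_left, relIndex_ker, pow_succ']
      exact Nat.mul_le_mul htwo ((card_le_of_le (map_comap_le f S)).trans ih)
  refine isCyclic_of_card_pow_eq_one_le fun n hn => ?_
  obtain ⟨k, m, hm, rfl⟩ := Nat.exists_eq_two_pow_mul_odd hn.ne'
  refine le_trans ?_ ((hker k).trans (Nat.le_mul_of_pos_right _ hm.pos))
  have hle : ∀ a ∈ ({a | a ^ (2 ^ k * m) = 1} : Finset A),
      a ∈ (powMonoidHom (2 ^ k) : A →* A).ker := by
    intro a ha
    rw [Finset.mem_filter] at ha
    rw [MonoidHom.mem_ker, powMonoidHom_apply,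
      ← orderOf_dvd_iff_pow_eq_one]
    obtain ⟨j, hj⟩ := IsPGroup.iff_orderOf.1 hA a
    have hdvd := orderOf_dvd_of_pow_eq_one ha.2
    rw [hj] at hdvd ⊢
    exact (Nat.Coprime.pow_left j hm.coprime_two_left).dvd_of_dvd_mul_right hdvd
  rw [← Nat.card_eq_finsetCard]
  exact Nat.card_le_card_of_injective (fun a => ⟨a.1, hle a.1 a.2⟩) fun a b hab =>
    Subtype.ext (Subtype.mk.inj hab)

theorem exists_two_central_involutions {G : Type*} [Group G] [Finite G] (hG : IsPGroup 2 G)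
    (hZ : ¬ IsCyclic (center G)) :
    ∃ z ∈ center G, ∃ w ∈ center G, z * z = 1 ∧ w * w = 1 ∧ z ≠ 1 ∧ w ≠ 1 ∧ z ≠ w := by
  by_contra! hcon
  let _ : CommGroup (center G) :=
    { (inferInstance : Group (center G)) with
      mul_comm := fun a b => Subtype.ext (mem_center_iff.1 b.2 a) }
  refine hZ (IsPGroup.isCyclic_of_involution_unique (A := center G) (hG.to_subgroup _) fun z w hz hw hz1 hw1 => ?_)
  refine Subtype.ext (hcon z z.2 w w.2 ?_ ?_ ?_ ?_)
  · exact_mod_cast (sq z).symm.trans hz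
  · exact_mod_cast (sq w).symm.trans hw
  · exact_mod_cast hz1
  · exact_mod_cast hw1

/-- A central involution moved by some character of order two gives rise to a noninner
automorphism of order two. -/
theorem exists_noninner_of_character_ne_one {G : Type*} [Group G] [Finite G] (h2G : IsPGroup 2 G)
    (hna : ¬ ∀ a b : G, a * b = b * a) {z : G} (hz : z ∈ center G) (hzz : z * z = 1)
    {χ : G →* ℤˣ} (hχ : χ z ≠ 1) :
    ∃ α : MulAut G, orderOf α = 2 ∧ (∀ x ∈ frattini G, α x = x) ∧
      ¬ ∃ h : G, ∀ x : G, α x = h⁻¹ * x * h := by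
  have hz1 : z ≠ 1 := fun h => hχ (h ▸ map_one χ)
  have hZc : zpowers z ≤ center G := zpowers_le.2 hz
  have hnorm : (zpowers z).Normal := ⟨fun n hn g => by
    rwa [mem_center_iff.1 (hZc hn) g, mul_inv_cancel_right]⟩
  have hnt : Nontrivial (G ⧸ zpowers z) := by
    rw [QuotientGroup.nontrivial_iff]
    intro htop
    exact hna fun a b => (mem_center_iff.1 (hZc (htop ▸ mem_top b)) a)
  obtain ⟨ψ, hψ⟩ := (h2G.to_quotient (zpowers z)).exists_character_ne_one
  obtain ⟨q, hq⟩ := DFunLike.ne_iff.1 hψ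
  obtain ⟨y, rfl⟩ := QuotientGroup.mk'_surjective _ q
  let φ : G →* ℤˣ := ψ.comp (QuotientGroup.mk' (zpowers z))
  have hφz : φ z = 1 := by
    change ψ (QuotientGroup.mk' (zpowers z) z) = 1
    rw [QuotientGroup.mk'_apply, (QuotientGroup.eq_one_iff z).2 (mem_zpowers z), map_one]
  let f : G →* G := (involutionHom z hzz).comp φ
  have hfy : f y = z := if_neg hq
  have hf : ∀ x, f (f x) = 1 := fun x => by
    have hx : f x ∈ φ.ker := involutionHom_mem z hzz (MonoidHom.mem_ker.2 hφz) _
    change involutionHom z hzz (φ (f x)) = 1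
    rw [MonoidHom.mem_ker.1 hx, map_one]
  have hf2 : ∀ x, f x * f x = 1 := fun x => by
    change involutionHom z hzz _ * involutionHom z hzz _ = 1
    rw [← map_mul, Int.units_mul_self, map_one]
  refine ⟨centralTwist f (fun x => involutionHom_mem z hzz hz _) hf2 hf,
    orderOf_centralTwist f _ hf2 hf (x := y) (hfy ▸ hz1), fun x hx => ?_, ?_⟩
  · change x * involutionHom z hzz (φ x) = x
    rw [character_eq_one_of_mem_frattini φ hx, map_one, mul_one]
  · rintro ⟨h, hh⟩
    have h1 : y * z = h⁻¹ * y * h := (congrArg (y * ·) hfy).symm.trans (hh y)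
    have h2 := congrArg χ h1
    rw [map_mul, map_mul, map_mul, map_inv, mul_right_comm, inv_mul_cancel, one_mul] at h2
    exact hχ (mul_eq_left.1 h2)

/-- The elements of the center killed by squaring. -/
def centralInvolutions (G : Type*) [Group G] : Subgroup G where
  carrier := {x | x ∈ center G ∧ x ^ 2 = 1}
  one_mem' := ⟨one_mem _, one_pow 2⟩
  mul_mem' := fun {a b} ha hb => ⟨mul_mem ha.1 hb.1, by
    rw [Commute.mul_pow (mem_center_iff.1 hb.1 a), ha.2, hb.2, one_mul]⟩
  inv_mem' := fun {a} ha => ⟨inv_mem ha.1, by rw [inv_pow, ha.2, inv_one]⟩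

theorem mk_mem_centralInvolutions {G : Type*} [Group G] {f : G →* G} (hc : ∀ x, f x ∈ center G)
    (h2 : ∀ x, f x * f x = 1) {h : G}
    (hh : ∀ x, x * f x = h⁻¹ * x * h) :
    (QuotientGroup.mk' (center G) h) ∈ centralInvolutions (G ⧸ center G) := by
  have hmul : ∀ x, x * h = h * x * f x := fun x => by
    rw [mul_assoc h, hh]; group
  constructor
  · rw [mem_center_iff]
    intro q
    obtain ⟨x, rfl⟩ := QuotientGroup.mk'_surjective _ q
    have hx : QuotientGroup.mk' (center G) (f x) = 1 := (QuotientGroup.eq_one_iff _).2 (hc x)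
    rw [← map_mul, hmul, map_mul, hx, mul_one, map_mul]
  · rw [← map_pow]
    refine (QuotientGroup.eq_one_iff _).2 (mem_center_iff.2 fun x => ?_)
    calc x * h ^ 2 = x * h * h := by rw [sq, mul_assoc]
      _ = h * x * (f x * h) := by rw [hmul x, mul_assoc _ (f x)]
      _ = h * (x * h) * f x := by rw [← mem_center_iff.1 (hc x) h]; simp only [mul_assoc]
      _ = h * h * x * (f x * f x) := by rw [hmul x]; simp only [mul_assoc]
      _ = h ^ 2 * x := by rw [h2, mul_one, sq]

/-- Let `G` be a finite non-abelian `2`-group with non-cyclic center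
such that `G/Z(G)` is powerful (its derived subgroup lies in the subgroup
generated by fourth powers). Then `G` has a noninner automorphism of order `2`
fixing `Φ(G)` elementwise. -/
theorem stmt7 (G : Type*) [Group G] [Finite G]
    (h2G : IsPGroup 2 G) (hna : ¬ ∀ a b : G, a * b = b * a)
    (hZ : ¬ IsCyclic (Subgroup.center G))
    (hpow : commutator (G ⧸ Subgroup.center G) ≤
      Subgroup.closure {x : G ⧸ Subgroup.center G | ∃ y : G ⧸ Subgroup.center G, y ^ 4 = x}) :
    ∃ α : MulAut G, orderOf α = 2 ∧ (∀ x ∈ frattini G, α x = x) ∧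
      ¬ ∃ h : G, ∀ x : G, α x = h⁻¹ * x * h := by
  obtain ⟨z, hz, w, hw, hzz, hww, hz1, hw1, hzw⟩ := exists_two_central_involutions h2G hZ
  by_cases hmove : ∃ χ : G →* ℤˣ, χ z ≠ 1 ∨ χ w ≠ 1
  · obtain ⟨χ, hχ | hχ⟩ := hmove
    · exact exists_noninner_of_character_ne_one h2G hna hz hzz hχ
    · exact exists_noninner_of_character_ne_one h2G hna hw hww hχ
  push Not at hmove
  have : Finite (G →* ℤˣ) := DFunLike.finite _
  let s := involutionHom z hzz
  let t := involutionHom w hww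
  have hs : ∀ u, s u ∈ center G := involutionHom_mem z hzz hz
  have ht : ∀ u, t u ∈ center G := involutionHom_mem w hww hw
  let st : ℤˣ × ℤˣ →* G := s.noncommCoprod t fun u v => mem_center_iff.1 (ht v) (s u)
  have hst : ∀ p, st p ∈ center G := fun p => mul_mem (hs _) (ht _)
  have hst_inj : Function.Injective st := by
    refine (injective_iff_map_eq_one st).2 fun ⟨u, v⟩ huv => ?_
    change (if u = 1 then 1 else z) * (if v = 1 then 1 else w) = 1 at huv
    have hzw' : z * w ≠ 1 := fun h => hzw (mul_right_cancel (h.trans hww.symm))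
    by_cases hu : u = 1 <;> by_cases hv : v = 1 <;> simp_all
  have hker : ∀ (χ : G →* ℤˣ) p, χ (st p) = 1 := fun χ p =>
    MonoidHom.mem_ker.1 (mul_mem
      (involutionHom_mem z hzz (K := χ.ker) (MonoidHom.mem_ker.2 (hmove χ).1) _)
      (involutionHom_mem w hww (K := χ.ker) (MonoidHom.mem_ker.2 (hmove χ).2) _))
  let F : (G →* ℤˣ) × (G →* ℤˣ) → G →* G := fun c => st.comp (c.1.prod c.2)
  have hFc : ∀ c x, F c x ∈ center G := fun c x => hst _
  have hF2 : ∀ c x, F c x * F c x = 1 := fun c x => by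
    change st _ * st _ = 1
    rw [← map_mul, Prod.mul_def, Int.units_mul_self, Int.units_mul_self]
    exact map_one st
  have hFF : ∀ c x, F c (F c x) = 1 := fun c x => by
    change st (c.1 (st _), c.2 (st _)) = 1
    rw [hker, hker]
    exact map_one st
  by_contra hcon
  have hinner : ∀ c, ∃ h : G, ∀ x, x * F c x = h⁻¹ * x * h := by
    intro c
    by_cases hc : F c = 1
    · exact ⟨1, fun x => by simp [hc]⟩
    by_contra hno
    obtain ⟨x, hx⟩ := DFunLike.ne_iff.1 hc
    refine hcon ⟨centralTwist (F c) (hFc c) (hF2 c) (hFF c),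
      orderOf_centralTwist (F c) _ _ _ hx, fun y hy => ?_, hno⟩
    change y * st (c.1 y, c.2 y) = y
    rw [character_eq_one_of_mem_frattini _ hy, character_eq_one_of_mem_frattini _ hy]
    exact (congrArg (y * ·) (map_one st)).trans (mul_one y)
  choose h hh using hinner
  let e : (G →* ℤˣ) × (G →* ℤˣ) → centralInvolutions (G ⧸ center G) := fun c =>
    ⟨_, mk_mem_centralInvolutions (hFc c) (hF2 c) (hh c)⟩
  have he : Function.Injective e := by
    intro c d hcd
    have hcd' : (h c)⁻¹ * h d ∈ center G := QuotientGroup.eq.1 (congrArg Subtype.val hcd)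
    have hF : ∀ x, F c x = F d x := fun x => by
      refine mul_left_cancel (a := x) ?_
      rw [hh, hh]
      have := mem_center_iff.1 hcd' ((h c)⁻¹ * x * h c)
      calc (h c)⁻¹ * x * h c
          = ((h c)⁻¹ * h d)⁻¹ * (((h c)⁻¹ * h d) * ((h c)⁻¹ * x * h c)) := by
            rw [inv_mul_cancel_left]
        _ = ((h c)⁻¹ * h d)⁻¹ * (((h c)⁻¹ * x * h c) * ((h c)⁻¹ * h d)) := by rw [this]
        _ = (h d)⁻¹ * x * h d := by group
    have hx : ∀ x, (c.1 x, c.2 x) = (d.1 x, d.2 x) := fun x => hst_inj (hF x)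
    exact Prod.ext (MonoidHom.ext fun x => congrArg Prod.fst (hx x))
      (MonoidHom.ext fun x => congrArg Prod.snd (hx x))
  have hcard := Nat.card_le_card_of_injective e he
  rw [Nat.card_prod] at hcard
  have hbound := (h2G.to_quotient (center G)).card_le_index_powerSubgroup_two hpow
    (centralInvolutions _) fun q hq => hq.2
  have hchar := index_powerSubgroup_two_le_card_characters.trans
    (card_characters_le_of_surjective _ (QuotientGroup.mk'_surjective (center G)))
  have hnt : Nontrivial G := ⟨z, 1, hz1⟩
  obtain ⟨χ, hχ⟩ := h2G.exists_character_ne_one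
  have hlt : 1 < Nat.card (G →* ℤˣ) := Finite.one_lt_card_iff_nontrivial.2 ⟨χ, 1, hχ⟩
  nlinarith
end

section
/- Let G be a finite non-abelian 2-group such that the quotient Q = G/Z(G) is powerful, i.e., the derived subgroup Q' is contained in Q^4, the subgroup of Q generated by all fourth powers. Then G has a noninner automorphism of order 2 that either fixes the Frattini subgroup Φ(G) elementwise, or fixes Ω₁(Z(G)) = {z ∈ Z(G) : z² = 1} elementwise. -/
open scoped commutatorElement

/-- The iterated squares series `Q ≥ Q² ≥ (Q²)² ≥ ⋯`. -/
def sqSeries (Q : Type*) [Group Q] : ℕ → Subgroup Q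
  | 0 => ⊤
  | i + 1 => Subgroup.closure {y | ∃ x ∈ sqSeries Q i, x ^ 2 = y}

section SqSeries

variable {Q : Type*} [Group Q]

theorem card_mul_relIndex {H K : Subgroup Q} (h : H ≤ K) :
    Nat.card H * H.relIndex K = Nat.card K := by
  rw [← Subgroup.relIndex_bot_left H, ← Subgroup.relIndex_bot_left K,
    Subgroup.relIndex_mul_relIndex _ _ _ bot_le h]

theorem sq_mem_sqSeries_succ {i : ℕ} {x : Q} (hx : x ∈ sqSeries Q i) :
    x ^ 2 ∈ sqSeries Q (i + 1) :=
  Subgroup.subset_closure ⟨x, hx, rfl⟩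

instance sqSeries_normal (i : ℕ) : (sqSeries Q i).Normal := by
  induction i with
  | zero => exact inferInstanceAs (⊤ : Subgroup Q).Normal
  | succ i ih =>
    refine ⟨fun n hn g => ?_⟩
    induction hn using Subgroup.closure_induction with
    | mem y hy =>
      obtain ⟨x, hx, rfl⟩ := hy
      rw [← conj_pow]
      exact sq_mem_sqSeries_succ (ih.conj_mem x hx g)
    | one => simp [one_mem]
    | mul a b _ _ ha hb => rw [← conj_mul]; exact mul_mem ha hb
    | inv a _ ha => rw [← conj_inv]; exact inv_mem ha

theorem sqSeries_succ_le (i : ℕ) : sqSeries Q (i + 1) ≤ sqSeries Q i := by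
  refine (Subgroup.closure_le _).2 ?_
  rintro _ ⟨x, hx, rfl⟩
  exact pow_mem hx 2

theorem commutatorElement_mem_of_mem_closure {R : Subgroup Q} [R.Normal] {S : Set Q}
    (hS : ∀ s ∈ S, ∀ q : Q, ⁅s, q⁆ ∈ R) {x : Q} (hx : x ∈ Subgroup.closure S) (q : Q) :
    ⁅x, q⁆ ∈ R := by
  induction hx using Subgroup.closure_induction generalizing q with
  | mem y hy => exact hS y hy q
  | one => simp [one_mem]
  | mul a b _ _ ha hb =>
    have h : ⁅a * b, q⁆ = a * ⁅b, q⁆ * a⁻¹ * ⁅a, q⁆ := by simp only [commutatorElement_def]; group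
    rw [h]
    exact mul_mem (Subgroup.Normal.conj_mem ‹_› _ (hb q) a) (ha q)
  | inv a _ ha =>
    have h : ⁅a⁻¹, q⁆ = a⁻¹ * ⁅a, q⁆⁻¹ * a⁻¹⁻¹ := by simp only [commutatorElement_def]; group
    rw [h]
    exact Subgroup.Normal.conj_mem ‹_› _ (inv_mem (ha q)) _

theorem sq_commutatorElement (x q : Q) : ⁅x ^ 2, q⁆ = ⁅x, ⁅x, q⁆⁆ * ⁅x, q⁆ ^ 2 := by
  simp only [commutatorElement_def, pow_two]; group

theorem le_of_le_sup_commutator [Group.IsNilpotent Q] {N K : Subgroup Q} [K.Normal]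
    (h : N ≤ K ⊔ ⁅N, (⊤ : Subgroup Q)⁆) : N ≤ K := by
  have key : ∀ n, N ≤ K ⊔ (⊤ : Subgroup Q).lowerCentralSeries n := by
    intro n
    induction n with
    | zero => simp
    | succ n ih =>
      refine h.trans (sup_le le_sup_left ?_)
      rw [Subgroup.commutator_le]
      intro a ha b _
      obtain ⟨k, hk, l, hl, rfl⟩ := Subgroup.mem_sup_of_normal_left.1 (ih ha)
      have e : ⁅k * l, b⁆ = k * ⁅l, b⁆ * k⁻¹ * ⁅k, b⁆ := by
        simp only [commutatorElement_def]; group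
      rw [e]
      have hkR := Subgroup.mem_sup_left (T := (⊤ : Subgroup Q).lowerCentralSeries (n + 1)) hk
      have hlR : ⁅l, b⁆ ∈ K ⊔ (⊤ : Subgroup Q).lowerCentralSeries (n + 1) :=
        Subgroup.mem_sup_right (Subgroup.commutator_mem_commutator hl (Subgroup.mem_top b))
      have hkb : ⁅k, b⁆ ∈ K := by
        rw [commutatorElement_def, mul_assoc k, mul_assoc k]
        exact mul_mem hk (Subgroup.Normal.conj_mem ‹_› _ (inv_mem hk) b)
      exact mul_mem (mul_mem (mul_mem hkR hlR) (inv_mem hkR)) (Subgroup.mem_sup_left hkb)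
  obtain ⟨n, hn⟩ := Subgroup.nilpotent_iff_lowerCentralSeries.1 ‹Group.IsNilpotent Q›
  simpa [hn] using key n

theorem commutatorElement_mem_sqSeries [Group.IsNilpotent Q]
    (hQ : commutator Q ≤ sqSeries Q 2) (i : ℕ) :
    ∀ x ∈ sqSeries Q i, ∀ q : Q, ⁅x, q⁆ ∈ sqSeries Q (i + 2) := by
  induction i with
  | zero =>
    intro x _ q
    exact hQ (Subgroup.commutator_mem_commutator (Subgroup.mem_top x) (Subgroup.mem_top q))
  | succ i ih =>
    set N := ⁅sqSeries Q (i + 1), (⊤ : Subgroup Q)⁆ with hN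
    have hNmem : ∀ y ∈ sqSeries Q (i + 1), ∀ q : Q, ⁅y, q⁆ ∈ N := fun y hy q =>
      Subgroup.commutator_mem_commutator hy (Subgroup.mem_top q)
    have h1 : ∀ c ∈ sqSeries Q (i + 2), ∀ q : Q,
        ⁅c, q⁆ ∈ sqSeries Q (i + 3) ⊔ ⁅N, (⊤ : Subgroup Q)⁆ := by
      refine fun c hc q => commutatorElement_mem_of_mem_closure ?_ hc q
      rintro _ ⟨y, hy, rfl⟩ q
      rw [sq_commutatorElement, ← commutatorElement_inv ⁅y, q⁆ y]
      exact mul_mem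
        (inv_mem (Subgroup.mem_sup_right
          (Subgroup.commutator_mem_commutator (hNmem y hy q) (Subgroup.mem_top y))))
        (Subgroup.mem_sup_left (sq_mem_sqSeries_succ (ih y (sqSeries_succ_le i hy) q)))
    have h2 : ∀ x ∈ sqSeries Q (i + 1), ∀ q : Q,
        ⁅x, q⁆ ∈ sqSeries Q (i + 3) ⊔ ⁅N, (⊤ : Subgroup Q)⁆ := by
      refine fun c hc q => commutatorElement_mem_of_mem_closure ?_ hc q
      rintro _ ⟨y, hy, rfl⟩ q
      rw [sq_commutatorElement, ← commutatorElement_inv ⁅y, q⁆ y]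
      exact mul_mem (inv_mem (h1 _ (ih y hy q) y))
        (Subgroup.mem_sup_left (sq_mem_sqSeries_succ (ih y hy q)))
    have h3 : N ≤ sqSeries Q (i + 3) :=
      le_of_le_sup_commutator (Subgroup.commutator_le.2 fun x hx q _ => h2 x hx q)
    exact fun x hx q => h3 (hNmem x hx q)

theorem commute_mk_of_mem_sqSeries [Group.IsNilpotent Q]
    (hQ : commutator Q ≤ sqSeries Q 2) {i : ℕ} {x : Q} (hx : x ∈ sqSeries Q i) (q : Q) :
    Commute (x : Q ⧸ sqSeries Q (i + 2)) (q : Q ⧸ sqSeries Q (i + 2)) := by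
  rw [← commutatorElement_eq_one_iff_commute]
  exact (QuotientGroup.eq_one_iff _).2 (commutatorElement_mem_sqSeries hQ i x hx q)

/-- Squaring, as a homomorphism from a term of the series of squares to a quotient. -/
def sqHom [Group.IsNilpotent Q] (hQ : commutator Q ≤ sqSeries Q 2) (i : ℕ) :
    sqSeries Q i →* Q ⧸ sqSeries Q (i + 2) where
  toFun x := (x : Q ⧸ sqSeries Q (i + 2)) ^ 2
  map_one' := by simp
  map_mul' x y := by
    push_cast
    exact (commute_mk_of_mem_sqSeries hQ x.2 y).mul_pow 2

theorem sqHom_range [Group.IsNilpotent Q] (hQ : commutator Q ≤ sqSeries Q 2) (i : ℕ) :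
    (sqHom hQ i).range =
      (sqSeries Q (i + 1)).map (QuotientGroup.mk' (sqSeries Q (i + 2))) := by
  apply le_antisymm
  · rintro _ ⟨x, rfl⟩
    exact ⟨x ^ 2, sq_mem_sqSeries_succ x.2, rfl⟩
  · rw [Subgroup.map_le_iff_le_comap]
    refine (Subgroup.closure_le _).2 ?_
    rintro _ ⟨x, hx, rfl⟩
    exact ⟨⟨x, hx⟩, rfl⟩

theorem exists_sq_eq_mk [Group.IsNilpotent Q] (hQ : commutator Q ≤ sqSeries Q 2) {i : ℕ} {x : Q}
    (hx : x ∈ sqSeries Q (i + 1)) :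
    ∃ y ∈ sqSeries Q i, ((y ^ 2 : Q) : Q ⧸ sqSeries Q (i + 2)) = x := by
  have h : (x : Q ⧸ sqSeries Q (i + 2)) ∈ (sqHom hQ i).range := by
    rw [sqHom_range]
    exact ⟨x, hx, rfl⟩
  obtain ⟨y, hy⟩ := h
  exact ⟨y, y.2, hy⟩

theorem exists_index_two_of_ne_top [Finite Q] (h2 : IsPGroup 2 Q) {H : Subgroup Q} (hH : H ≠ ⊤) :
    ∃ L : Subgroup Q, H ≤ L ∧ L.index = 2 := by
  obtain ⟨n, hn⟩ := IsPGroup.iff_card.1 h2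
  obtain ⟨m, hm⟩ := IsPGroup.iff_card.1 (h2.to_subgroup H)
  have hlt : Nat.card H < Nat.card Q := by
    refine lt_of_le_of_ne (Subgroup.card_le_card_group H) fun h => hH ?_
    exact Subgroup.eq_top_of_card_eq H h
  have hmn : m < n := by
    rw [hn, hm] at hlt
    exact (Nat.pow_lt_pow_iff_right (by norm_num)).1 hlt
  obtain ⟨k, rfl⟩ : ∃ k, n = k + 1 := ⟨n - 1, by omega⟩
  obtain ⟨L, hL, hle⟩ := Sylow.exists_subgroup_card_pow_prime_le 2
    (hn ▸ pow_dvd_pow 2 (Nat.le_succ k)) H hm (by omega)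
  refine ⟨L, hle, ?_⟩
  have := L.card_mul_index
  rw [hn, hL, pow_succ] at this
  exact Nat.eq_of_mul_eq_mul_left (by positivity) this

theorem exists_sqSeries_eq_bot [Finite Q] (h2 : IsPGroup 2 Q) : ∃ n, sqSeries Q n = ⊥ := by
  have key : ∀ i, sqSeries Q i ≠ ⊥ → sqSeries Q (i + 1) < sqSeries Q i := by
    intro i hi
    obtain ⟨L, -, hL⟩ := exists_index_two_of_ne_top (h2.to_subgroup (sqSeries Q i)) (H := ⊥)
      (by
        rw [ne_eq, eq_comm, Subgroup.eq_bot_iff_card, Subgroup.card_top,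
          ← Subgroup.eq_bot_iff_card]
        exact hi)
    have hle : sqSeries Q (i + 1) ≤ L.map (sqSeries Q i).subtype := by
      refine (Subgroup.closure_le _).2 ?_
      rintro _ ⟨x, hx, rfl⟩
      exact ⟨⟨x, hx⟩ ^ 2, Subgroup.sq_mem_of_index_two hL _, rfl⟩
    refine lt_of_le_of_ne (sqSeries_succ_le i) fun h => ?_
    have hL' : L = ⊤ := by
      rw [eq_top_iff]
      intro x _
      obtain ⟨y, hy, hyx⟩ := hle (h.symm ▸ x.2 : (x : Q) ∈ sqSeries Q (i + 1))
      rwa [← Subtype.ext hyx]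
    simp [hL'] at hL
  by_contra! hne
  have : StrictAnti (sqSeries Q) := strictAnti_nat_of_succ_lt fun i => key i (hne i)
  exact not_injective_infinite_finite _ this.injective

/-- A square root modulo `sqSeries Q 2` lifts to a genuine one. -/
theorem exists_mul_sq_eq [Finite Q] (h2 : IsPGroup 2 Q) (hQ : commutator Q ≤ sqSeries Q 2)
    {x y : Q} (hxy : ((y ^ 2 : Q) : Q ⧸ sqSeries Q 2) = x) :
    ∃ k ∈ sqSeries Q 1, (y * k) ^ 2 = x := by
  have := h2.isNilpotent
  have key : ∀ n, ∃ k ∈ sqSeries Q 1, (((y * k) ^ 2 : Q) : Q ⧸ sqSeries Q (n + 2)) = x := by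
    intro n
    induction n with
    | zero => exact ⟨1, one_mem _, by simpa using hxy⟩
    | succ n ih =>
      obtain ⟨k, hk, hkx⟩ := ih
      obtain ⟨l, hl, hlx⟩ := exists_sq_eq_mk hQ (QuotientGroup.eq.1 hkx)
      refine ⟨k * l, mul_mem hk ?_, ?_⟩
      · exact antitone_nat_of_succ_le sqSeries_succ_le (Nat.le_add_left 1 n) hl
      · rw [← mul_assoc]
        have hc := (commute_mk_of_mem_sqSeries hQ hl (y * k)).symm
        rw [QuotientGroup.mk_pow, QuotientGroup.mk_mul, hc.mul_pow, ← QuotientGroup.mk_pow _ l,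
          hlx]
        simp
  obtain ⟨n, hn⟩ := exists_sqSeries_eq_bot h2
  obtain ⟨k, hk, hkx⟩ := key n
  refine ⟨k, hk, ?_⟩
  have h := antitone_nat_of_succ_le sqSeries_succ_le (Nat.le_add_right n 2) (QuotientGroup.eq.1 hkx)
  rw [hn, Subgroup.mem_bot] at h
  exact (inv_mul_eq_one.1 h)

theorem card_mul_card_sqSeries_one_le [Finite Q] (h2 : IsPGroup 2 Q)
    (hQ : commutator Q ≤ sqSeries Q 2) (E : Subgroup Q) (hE : ∀ x ∈ E, x ^ 2 = 1) :
    Nat.card E * Nat.card (sqSeries Q 1) ≤ Nat.card Q := by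
  have := h2.isNilpotent
  obtain ⟨n, hn⟩ := exists_sqSeries_eq_bot h2
  have key : ∀ k i, n ≤ i + k → Nat.card (E ⊓ sqSeries Q i : Subgroup Q) *
      Nat.card (sqSeries Q (i + 1)) ≤ Nat.card (sqSeries Q i) := by
    intro k
    induction k with
    | zero =>
      intro i hi
      have h1 : ∀ j, n ≤ j → sqSeries Q j = ⊥ := fun j hj =>
        le_bot_iff.1 (hn ▸ antitone_nat_of_succ_le sqSeries_succ_le hj)
      simp [h1 i hi, h1 (i + 1) (by omega)]
    | succ k ih =>
      intro i hi
      have ih := ih (i + 1) (by omega)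
      set A := E ⊓ sqSeries Q i with hA
      set B := sqSeries Q (i + 1) with hB
      have hrange : Nat.card (sqHom hQ i).range * Nat.card (sqSeries Q (i + 2)) = Nat.card B := by
        rw [sqHom_range, ← Subgroup.relIndex_ker, QuotientGroup.ker_mk', mul_comm,
          card_mul_relIndex (sqSeries_succ_le (i + 1))]
      have hker : Nat.card (sqHom hQ i).range * Nat.card (sqHom hQ i).ker =
          Nat.card (sqSeries Q i) := by
        rw [← Subgroup.index_ker, mul_comm, Subgroup.card_mul_index]
      have hle : A ⊔ B ≤ (sqHom hQ i).ker.map (sqSeries Q i).subtype := by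
        refine sup_le ?_ ?_
        · rintro x ⟨hxE, hx⟩
          refine ⟨⟨x, hx⟩, ?_, rfl⟩
          exact (QuotientGroup.eq_one_iff _).2 (hE x hxE ▸ one_mem _ : x ^ 2 ∈ _)
        · intro x hx
          exact ⟨⟨x, sqSeries_succ_le i hx⟩,
            (QuotientGroup.eq_one_iff _).2 (sq_mem_sqSeries_succ hx), rfl⟩
      have hcard : Nat.card (A ⊔ B : Subgroup Q) ≤ Nat.card (sqHom hQ i).ker := by
        refine (Subgroup.card_le_of_le hle).trans ?_
        exact (Subgroup.card_map_of_injective (Subgroup.subtype_injective _)).le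
      have hAB : Nat.card (A ⊔ B : Subgroup Q) * Nat.card (A ⊓ B : Subgroup Q) =
          Nat.card A * Nat.card B := by
        rw [← card_mul_relIndex (le_sup_right : B ≤ A ⊔ B), Subgroup.relIndex_sup_right,
          ← card_mul_relIndex (inf_le_left : A ⊓ B ≤ A), Subgroup.inf_relIndex_left]
        ring
      have hinf : A ⊓ B = E ⊓ B := by
        rw [hA, inf_assoc, inf_eq_right.2 (sqSeries_succ_le i)]
      rw [hinf] at hAB
      have hpos : 0 < Nat.card (sqSeries Q (i + 2)) := Nat.card_pos
      have h1 : Nat.card (E ⊓ B : Subgroup Q) ≤ Nat.card (sqHom hQ i).range := by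
        rw [← hrange] at ih
        exact Nat.le_of_mul_le_mul_right ih hpos
      calc Nat.card A * Nat.card B
          = Nat.card (E ⊓ B : Subgroup Q) * Nat.card (A ⊔ B : Subgroup Q) := by rw [← hAB, mul_comm]
        _ ≤ Nat.card (sqHom hQ i).range * Nat.card (sqHom hQ i).ker := Nat.mul_le_mul h1 hcard
        _ = _ := hker
  have := key n 0 (by omega)
  simpa [sqSeries] using this

end SqSeries

section Involution

variable {G : Type*} [Group G]

/-- An automorphism of order dividing `2` sending `m` to `m * F m` on a subgroup `M` of index `2`
and `g` to `g * w`, where `w` is central in `M` and `F` is a homomorphism from `M` to `{1, z}`. -/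
theorem exists_involution {M : Subgroup G} (hM : M.index = 2) {g w z : G} {F : G → G}
    (hg : g ∉ M) (hw : w ∈ M) (hwM : ∀ m ∈ M, Commute m w) (hgw : g⁻¹ * w * g = w * z)
    (hz : z ∈ Subgroup.center G) (hz2 : z ^ 2 = 1) (hF : ∀ m ∈ M, F m = 1 ∨ F m = z)
    (hFmul : ∀ m ∈ M, ∀ n ∈ M, F (m * n) = F m * F n)
    (hFconj : ∀ m ∈ M, F (g⁻¹ * m * g) = F m) (hFg : F (g ^ 2) = w ^ 2 * z)
    (hFw : F w = w ^ 2) (hFz : F z = 1) :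
    ∃ α : MulAut G, α g = g * w ∧ ∀ x, α (α x) = x := by
  classical
  have hMn := Subgroup.normal_of_index_eq_two hM
  have hzM : z ∈ M := by
    have := (mul_mem (inv_mem hw) (hMn.conj_mem w hw g⁻¹))
    rw [inv_inv, hgw] at this
    simpa using this
  have hF1 : F 1 = 1 := by simpa using hFmul 1 (one_mem M) 1 (one_mem M)
  have hcomm : ∀ x, z * x = x * z := fun x => (Subgroup.mem_center_iff.1 hz x).symm
  have hFM : ∀ m ∈ M, F m ∈ M := fun m hm => by
    rcases hF m hm with h | h <;> simp [h, hzM, one_mem]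
  have hFF : ∀ m ∈ M, F (F m) = 1 := fun m hm => by
    rcases hF m hm with h | h <;> simp [h, hF1, hFz]
  have hFsq : ∀ m ∈ M, F m * F m = 1 := fun m hm => by
    rcases hF m hm with h | h <;> simp [h, ← pow_two, hz2]
  have hFcomm : ∀ m ∈ M, ∀ x, F m * x = x * F m := fun m hm x => by
    rcases hF m hm with h | h <;> simp [h, hcomm]
  have hgM : ∀ x, x ∉ M → g⁻¹ * x ∈ M := fun x hx => by
    rw [Subgroup.mul_mem_iff_of_index_two hM]
    simp [hg, hx]
  have hgM' : ∀ m ∈ M, g * m ∉ M := fun m hm h => hg (by simpa using mul_mem h (inv_mem hm))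
  have hconjM : ∀ m ∈ M, g⁻¹ * m * g ∈ M := fun m hm => by simpa using hMn.conj_mem m hm g⁻¹
  let φ : G → G := fun x => if x ∈ M then x * F x else x * w * F (g⁻¹ * x)
  have hφ1 : ∀ m ∈ M, φ m = m * F m := fun m hm => if_pos hm
  have hφ2 : ∀ m ∈ M, φ (g * m) = g * m * w * F m := fun m hm => by
    simp only [φ, if_neg (hgM' m hm), inv_mul_cancel_left]
  have hmul : ∀ x y, φ (x * y) = φ x * φ y := by
    intro x y
    by_cases hx : x ∈ M <;> by_cases hy : y ∈ M
    · rw [hφ1 _ (mul_mem hx hy), hφ1 _ hx, hφ1 _ hy, hFmul x hx y hy, mul_assoc x (F x),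
        ← mul_assoc (F x), hFcomm x hx y]
      group
    · obtain ⟨m, hm, rfl⟩ : ∃ m ∈ M, y = g * m := ⟨_, hgM y hy, by simp⟩
      have e : x * (g * m) = g * (g⁻¹ * x * g * m) := by group
      rw [e, hφ2 _ (mul_mem (hconjM x hx) hm), hFmul _ (hconjM x hx) m hm, hFconj x hx,
        hφ1 x hx, hφ2 m hm, mul_assoc x (F x), hFcomm x hx, hFcomm x hx]
      group
    · obtain ⟨m, hm, rfl⟩ : ∃ m ∈ M, x = g * m := ⟨_, hgM x hx, by simp⟩
      rw [mul_assoc g m y, hφ2 _ (mul_mem hm hy), hFmul m hm y hy, hφ1 y hy, hφ2 m hm]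
      simp only [mul_assoc]
      rw [← mul_assoc (F m) y, hFcomm m hm y, ← mul_assoc y w, (hwM y hy).eq]
      simp only [mul_assoc]
    · obtain ⟨m, hm, rfl⟩ : ∃ m ∈ M, x = g * m := ⟨_, hgM x hx, by simp⟩
      obtain ⟨n, hn, rfl⟩ : ∃ n ∈ M, y = g * n := ⟨_, hgM y hy, by simp⟩
      have hg2 : g ^ 2 ∈ M := Subgroup.sq_mem_of_index_two hM g
      have e : g * m * (g * n) = g ^ 2 * ((g⁻¹ * m * g) * n) := by group
      have hmn := mul_mem (hconjM m hm) hn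
      have hwg : w * g = g * w * z := by rw [mul_assoc, ← hgw]; group
      rw [e, hφ1 _ (mul_mem hg2 hmn), hFmul _ hg2 _ hmn, hFmul _ (hconjM m hm) n hn,
        hFconj m hm, hFg, hφ2 m hm, hφ2 n hn]
      calc g ^ 2 * (g⁻¹ * m * g * n) * (w ^ 2 * z * (F m * F n))
          = g * m * g * (n * w) * w * z * F m * F n := by
            simp only [pow_two, mul_assoc, mul_inv_cancel_left]
        _ = g * m * g * w * (n * (w * z)) * F m * F n := by rw [(hwM n hn).eq]; group
        _ = g * m * (g * w * z) * n * w * F m * F n := by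
            rw [← hcomm w, ← mul_assoc n z, ← hcomm n]; group
        _ = g * m * (w * g * n * w) * F m * F n := by rw [← hwg]; group
        _ = g * m * w * F m * (g * n * w * F n) := by
            rw [mul_assoc (g * m * w) (F m), ← mul_assoc (F m), hFcomm m hm (g * n * w)]
            group
  have hinv : ∀ x, φ (φ x) = x := by
    intro x
    by_cases hx : x ∈ M
    · rw [hφ1 x hx, hφ1 _ (mul_mem hx (hFM x hx)), hFmul x hx _ (hFM x hx), hFF x hx, mul_one,
        mul_assoc, hFsq x hx, mul_one]
    · obtain ⟨m, hm, rfl⟩ : ∃ m ∈ M, x = g * m := ⟨_, hgM x hx, by simp⟩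
      have hmw := mul_mem hm hw
      rw [hφ2 m hm, mul_assoc g m w, mul_assoc g, hφ2 _ (mul_mem hmw (hFM m hm)),
        hFmul _ hmw _ (hFM m hm), hFmul m hm w hw, hFF m hm, hFw, mul_one]
      have hw4 : w ^ 2 * w ^ 2 = 1 := by rw [← hFw]; exact hFsq w hw
      calc g * (m * w * F m) * w * (F m * w ^ 2)
          = g * m * w * (F m * (w * F m)) * w ^ 2 := by group
        _ = g * m * (w ^ 2 * w ^ 2) := by
            rw [hFcomm m hm, mul_assoc w, hFsq m hm]; group
        _ = g * m := by rw [hw4, mul_one]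
  refine ⟨MulEquiv.mk' ⟨φ, φ, hinv, hinv⟩ hmul, ?_, hinv⟩
  change φ g = g * w
  simpa [hF1] using hφ2 1 (one_mem M)

end Involution

section Characters

variable {Q : Type*} [Group Q]

theorem exists_index_two_of_notMem [Finite Q] {B : Subgroup Q} (hB : ∀ x, x ^ 2 ∈ B) {a : Q}
    (ha : a ∉ B) : ∃ L : Subgroup Q, B ≤ L ∧ L.index = 2 ∧ a ∉ L := by
  obtain ⟨L, hBL, hL⟩ := Finite.exists_le_maximal (p := fun L : Subgroup Q => B ≤ L ∧ a ∉ L)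
    ⟨le_rfl, ha⟩
  have hsq : ∀ x, x ^ 2 ∈ L := fun x => hBL (hB x)
  have hLn : L.Normal := by
    refine ⟨fun n hn g => ?_⟩
    have e : g * n * g⁻¹ = (g * n) ^ 2 * n⁻¹ * (g ^ 2)⁻¹ := by simp only [pow_two]; group
    rw [e]
    exact mul_mem (mul_mem (hsq _) (inv_mem hn)) (inv_mem (hsq _))
  refine ⟨L, hBL, Subgroup.index_eq_two_iff.2 ⟨a, fun b => ?_⟩, hL.prop.2⟩
  by_cases hb : b ∈ L
  · refine Or.inr ⟨hb, fun h => hL.prop.2 ?_⟩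
    simpa using mul_mem (inv_mem hb) h
  · refine Or.inl ⟨?_, hb⟩
    have hmem : a ∈ L ⊔ Subgroup.zpowers b := by
      by_contra h
      have hle := hL.le_of_ge ⟨hBL.trans le_sup_left, h⟩ le_sup_left
      exact hb (hle (Subgroup.mem_sup_right (Subgroup.mem_zpowers b)))
    obtain ⟨l, hl, _, ⟨k, rfl⟩, hlk⟩ := Subgroup.mem_sup_of_normal_left.1 hmem
    have heven : ∀ j : ℤ, b ^ (2 * j) ∈ L := fun j => by
      rw [zpow_mul]; exact zpow_mem (by exact_mod_cast hsq b) j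
    obtain ⟨j, hj | hj⟩ := Int.even_or_odd' k
    · exact absurd (hlk ▸ mul_mem hl (hj ▸ heven j)) hL.prop.2
    · have e : b * a = (b * l) ^ 2 * l⁻¹ * b ^ (2 * j) := by
        rw [← hlk, hj]
        simp only [pow_two, zpow_add, zpow_one, (Commute.zpow_self b (2 * j)).eq]
        group
      rw [e]
      exact mul_mem (mul_mem (hsq _) (inv_mem hl)) (heven j)

theorem exists_character_of_index_two {L : Subgroup Q} (hL : L.index = 2) :
    ∃ χ : Q →* ℤˣ, ∀ x, χ x = 1 ↔ x ∈ L := by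
  classical
  refine ⟨⟨⟨fun x => if x ∈ L then 1 else -1, by simp [one_mem]⟩, fun x y => ?_⟩, fun x => ?_⟩
  · have := Subgroup.mul_mem_iff_of_index_two hL (a := x) (b := y)
    by_cases hx : x ∈ L <;> by_cases hy : y ∈ L <;> simp [hx, hy] at this ⊢ <;> simp [this]
  · by_cases hx : x ∈ L <;> simp [hx]

instance hasEnoughRootsOfUnity_int_two : HasEnoughRootsOfUnity ℤ 2 where
  prim := ⟨-1, IsPrimitiveRoot.neg_one 0 (by norm_num)⟩
  cyc := inferInstance

theorem card_quotient_sqSeries_one_le [Finite Q] :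
    Nat.card (Q ⧸ sqSeries Q 1) ≤ Nat.card (Q →* ℤˣ) := by
  have hsq : ∀ q : Q ⧸ sqSeries Q 1, q ^ 2 = 1 := by
    intro q
    induction q using QuotientGroup.induction_on with
    | H x => exact (QuotientGroup.eq_one_iff _).2 (sq_mem_sqSeries_succ (Subgroup.mem_top x))
  let _ : CommGroup (Q ⧸ sqSeries Q 1) :=
    { (inferInstance : Group (Q ⧸ sqSeries Q 1)) with
      mul_comm := fun a b => by
        have h := hsq (a * b)
        have ha := hsq a
        have hb := hsq b
        rw [pow_two] at h ha hb
        rw [← inv_eq_of_mul_eq_one_right h, mul_inv_rev, inv_eq_of_mul_eq_one_right ha,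
          inv_eq_of_mul_eq_one_right hb] }
  have : HasEnoughRootsOfUnity ℤ (Monoid.exponent (Q ⧸ sqSeries Q 1)) :=
    HasEnoughRootsOfUnity.of_dvd ℤ (Monoid.exponent_dvd_of_forall_pow_eq_one hsq)
  rw [← CommGroup.card_monoidHom_of_hasEnoughRootsOfUnity (Q ⧸ sqSeries Q 1) ℤ]
  have : Finite (Q →* ℤˣ) := Finite.of_injective _ DFunLike.coe_injective
  refine Nat.card_le_card_of_injective
    (fun χ : (Q ⧸ sqSeries Q 1) →* ℤˣ => χ.comp (QuotientGroup.mk' (sqSeries Q 1))) ?_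
  intro χ ψ h
  exact MonoidHom.ext fun q => QuotientGroup.induction_on q fun x => DFunLike.congr_fun h x

end Characters

section InvolutionsInner

open Subgroup

variable {G : Type*} [Group G]

/-- Every automorphism of order dividing `2` which fixes `Ω₁(Z(G))` elementwise is inner. -/
def InvolutionsInner (G : Type*) [Group G] : Prop :=
  ∀ α : MulAut G, (∀ x, α (α x) = x) → (∀ z ∈ center G, z ^ 2 = 1 → α z = z) →
    ∃ h : G, ∀ x : G, α x = h⁻¹ * x * h

/-- The elements `h` whose commutators `[x, h]` all lie in `{1, z}`. -/
def twist (z : G) (hz : z ∈ center G) (hz2 : z ^ 2 = 1) : Subgroup G where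
  carrier := {h | ∀ x, h⁻¹ * x * h = x ∨ h⁻¹ * x * h = x * z}
  one_mem' x := by simp
  mul_mem' {h k} hh hk x := by
    have e : (h * k)⁻¹ * x * (h * k) = k⁻¹ * (h⁻¹ * x * h) * k := by group
    have hzk : z * k = k * z := (mem_center_iff.1 hz k).symm
    rw [e]
    rcases hh x with h1 | h1 <;> rcases hk x with h2 | h2 <;> rw [h1]
    · exact Or.inl h2
    · exact Or.inr h2
    · right; rw [mul_assoc, mul_assoc, hzk, ← mul_assoc, ← mul_assoc, h2]
    · left; rw [mul_assoc, mul_assoc, hzk, ← mul_assoc, ← mul_assoc, h2, mul_assoc, ← pow_two, hz2,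
        mul_one]
  inv_mem' {h} hh x := by
    have hzh : h * z = z * h := mem_center_iff.1 hz h
    rcases hh (h * x * h⁻¹) with h1 | h1
    · left
      have : x = h * x * h⁻¹ := by simpa [mul_assoc] using h1
      rw [inv_inv, ← this]
    · right
      have e : x = h * x * h⁻¹ * z := by simpa [mul_assoc] using h1
      rw [inv_inv]
      nth_rw 2 [e]
      rw [mul_assoc _ z, ← pow_two, hz2, mul_one]

variable {z : G} {hz : z ∈ center G} {hz2 : z ^ 2 = 1}

theorem center_le_twist : center G ≤ twist z hz hz2 := fun c hc x => by
  left
  rw [mul_assoc, mem_center_iff.1 hc x, inv_mul_cancel_left]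

theorem conj_eq_mul_symm (hz2 : z ^ 2 = 1) {h x : G}
    (hx : h⁻¹ * x * h = x * z) : x⁻¹ * h * x = h * z := by
  have e : h * x * z = x * h := by rw [mul_assoc, ← hx]; group
  calc x⁻¹ * h * x = x⁻¹ * (h * x * (z * z)) := by rw [← pow_two, hz2]; group
    _ = x⁻¹ * (h * x * z * z) := by rw [mul_assoc _ z]
    _ = h * z := by rw [e]; group

theorem sq_mem_center_of_mem_twist {h : G} (hh : h ∈ twist z hz hz2) : h ^ 2 ∈ center G := by
  rw [mem_center_iff]
  intro x
  have hzh : z * h = h * z := (mem_center_iff.1 hz h).symm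
  have e : (h ^ 2)⁻¹ * x * h ^ 2 = h⁻¹ * (h⁻¹ * x * h) * h := by simp only [pow_two]; group
  have key : (h ^ 2)⁻¹ * x * h ^ 2 = x := by
    rw [e]
    rcases hh x with h1 | h1
    · rw [h1, h1]
    · rw [h1, mul_assoc, mul_assoc, hzh, ← mul_assoc, ← mul_assoc, h1, mul_assoc, ← pow_two, hz2,
        mul_one]
  rw [mul_assoc, inv_mul_eq_iff_eq_mul] at key
  exact key

theorem mk_sq_eq_one_iff {h : G} : (h : G ⧸ center G) ^ 2 = 1 ↔ h ^ 2 ∈ center G :=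
  QuotientGroup.eq_one_iff (h ^ 2)

/-- The sign `-1` goes to `z`. -/
def signTo (z : G) (e : ℤˣ) : G := if e = 1 then 1 else z

theorem signTo_mul (hz2 : z ^ 2 = 1) (a b : ℤˣ) : signTo z (a * b) = signTo z a * signTo z b := by
  rcases Int.units_eq_one_or a with rfl | rfl <;> rcases Int.units_eq_one_or b with rfl | rfl <;>
    simp [signTo, ← pow_two, hz2]

theorem signTo_eq (z : G) (a : ℤˣ) : signTo z a = 1 ∨ signTo z a = z := by
  unfold signTo; split <;> simp

theorem signTo_mem_center (hz : z ∈ center G) (a : ℤˣ) : signTo z a ∈ center G := by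
  rcases signTo_eq z a with h | h <;> simp [h, hz, one_mem]

theorem exists_conj_eq_mul_signTo (hin : InvolutionsInner G) (hz : z ∈ center G)
    (hz2 : z ^ 2 = 1) (χ : G ⧸ center G →* ℤˣ) : ∃ h, ∀ x : G, h⁻¹ * x * h = x * signTo z (χ x) := by
  have hχ : ∀ c ∈ center G, χ (c : G ⧸ center G) = 1 := fun c hc => by
    rw [(QuotientGroup.eq_one_iff c).2 hc, map_one]
  let φ : G → G := fun x => x * signTo z (χ x)
  have hφ : ∀ x, φ (φ x) = x := fun x => by
    simp only [φ]
    rw [QuotientGroup.mk_mul, map_mul, hχ _ (signTo_mem_center hz _), mul_one, mul_assoc,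
      ← signTo_mul hz2, Int.units_mul_self]
    simp [signTo]
  have hmul : ∀ x y, φ (x * y) = φ x * φ y := fun x y => by
    simp only [φ]
    rw [QuotientGroup.mk_mul, map_mul, signTo_mul hz2, mul_assoc x (signTo z _),
      ← mul_assoc (signTo z _) y, ← mem_center_iff.1 (signTo_mem_center hz _) y]
    simp only [mul_assoc]
  obtain ⟨h, hh⟩ := hin (MulEquiv.mk' ⟨φ, φ, hφ, hφ⟩ hmul) hφ fun c hc _ => by
    change c * signTo z (χ c) = c
    rw [hχ c hc]
    simp [signTo]
  exact ⟨h, fun x => (hh x).symm⟩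

theorem mem_twist_of_conj_eq {χ : G ⧸ center G →* ℤˣ} {h : G}
    (hh : ∀ x : G, h⁻¹ * x * h = x * signTo z (χ x)) : h ∈ twist z hz hz2 := fun x => by
  rw [hh x]
  rcases signTo_eq z (χ x) with h | h <;> simp [h]

theorem mem_twist_of_sq_mem_center [Finite G] (h2 : IsPGroup 2 (G ⧸ center G))
    (hQ : commutator (G ⧸ center G) ≤ sqSeries (G ⧸ center G) 2) (hin : InvolutionsInner G)
    (hz1 : z ≠ 1) {h : G} (hh : h ^ 2 ∈ center G) : h ∈ twist z hz hz2 := by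
  set E := (twist z hz hz2).map (QuotientGroup.mk' (center G)) with hE
  have hcomm : ∀ e ∈ E, ∀ q, Commute e q := by
    rintro _ ⟨u, hu, rfl⟩ q
    induction q using QuotientGroup.induction_on with
    | H x =>
      change ((u * x : G) : G ⧸ center G) = ((x * u : G) : G ⧸ center G)
      rw [QuotientGroup.eq]
      rcases hu x with h1 | h1
      · have : x * u = u * x := by
          nth_rw 2 [← h1]
          group
        simp [this, one_mem]
      · have : x * u = u * x * z := by rw [mul_assoc u, ← h1]; group
        rw [this, mul_inv_rev, mul_assoc u]
        simpa [mul_assoc] using hz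
  have hEn : E.Normal := ⟨fun e he g => by rwa [← (hcomm e he g).eq, mul_inv_cancel_right]⟩
  have hEsq : ∀ e ∈ E, e ^ 2 = 1 := by
    rintro _ ⟨u, hu, rfl⟩
    exact mk_sq_eq_one_iff.2 (sq_mem_center_of_mem_twist hu)
  have hE'sq : ∀ e ∈ E ⊔ zpowers (h : G ⧸ center G), e ^ 2 = 1 := by
    intro e he
    obtain ⟨a, ha, _, ⟨k, rfl⟩, rfl⟩ := mem_sup_of_normal_left.1 he
    rw [(hcomm a ha _).mul_pow, hEsq a ha, one_mul]
    change ((h : G ⧸ center G) ^ k) ^ 2 = 1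
    rw [← zpow_natCast, ← zpow_mul, mul_comm, zpow_mul, zpow_natCast, mk_sq_eq_one_iff.2 hh,
      one_zpow]
  have h1 := card_mul_card_sqSeries_one_le h2 hQ _ hE'sq
  have h3 : Nat.card (G ⧸ center G →* ℤˣ) ≤ Nat.card E := by
    choose f hf using exists_conj_eq_mul_signTo hin hz hz2
    refine Nat.card_le_card_of_injective
      (fun χ => (⟨f χ, f χ, mem_twist_of_conj_eq (hf χ), rfl⟩ : E)) ?_
    intro χ ψ hχψ
    have hχψ : (f χ : G ⧸ center G) = f ψ := congrArg Subtype.val hχψ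
    obtain ⟨c, hc, hcψ⟩ : ∃ c ∈ center G, f ψ = f χ * c :=
      ⟨_, QuotientGroup.eq.1 hχψ, by group⟩
    refine MonoidHom.ext fun q => QuotientGroup.induction_on q fun x => ?_
    have e : x * signTo z (ψ x) = x * signTo z (χ x) := by
      rw [← hf χ x, ← hf ψ x, hcψ]
      have := mem_center_iff.1 hc ((f χ)⁻¹ * x * f χ)
      rw [mul_inv_rev, mul_assoc, mul_assoc, inv_mul_eq_iff_eq_mul, ← this]
      group
    have e := mul_left_cancel e
    rcases Int.units_eq_one_or (χ x) with h4 | h4 <;>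
      rcases Int.units_eq_one_or (ψ x) with h5 | h5 <;> rw [h4, h5] at e ⊢
    · simp [signTo, hz1] at e
    · simp [signTo, hz1.symm] at e
  have h4 := card_quotient_sqSeries_one_le (Q := G ⧸ center G)
  have hpos : 0 < Nat.card (sqSeries (G ⧸ center G) 1) := Nat.card_pos
  have h5 : Nat.card (E ⊔ zpowers (h : G ⧸ center G) : Subgroup _) ≤ Nat.card E := by
    refine le_trans ?_ (h4.trans h3)
    rw [card_eq_card_quotient_mul_card_subgroup (sqSeries (G ⧸ center G) 1)] at h1
    exact Nat.le_of_mul_le_mul_right h1 hpos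
  have h6 := eq_of_le_of_card_ge (le_sup_left : E ≤ E ⊔ zpowers (h : G ⧸ center G)) h5
  have h7 : (h : G ⧸ center G) ∈ E := by
    rw [h6]; exact mem_sup_right (mem_zpowers _)
  obtain ⟨u, hu, huh⟩ := h7
  have h8 := mul_mem hu (center_le_twist (hz := hz) (hz2 := hz2) (QuotientGroup.eq.1 huh))
  simpa using h8

theorem exists_mem_twist_of_index_two (hin : InvolutionsInner G) (z : G) (hz : z ∈ center G)
    (hz2 : z ^ 2 = 1) {L : Subgroup (G ⧸ center G)} (hL : L.index = 2) :
    ∃ h ∈ twist z hz hz2, ∀ x : G,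
      ((x : G ⧸ center G) ∈ L → h⁻¹ * x * h = x) ∧
      ((x : G ⧸ center G) ∉ L → h⁻¹ * x * h = x * z) := by
  obtain ⟨χ, hχ⟩ := exists_character_of_index_two hL
  obtain ⟨h, hh⟩ := exists_conj_eq_mul_signTo hin hz hz2 χ
  refine ⟨h, mem_twist_of_conj_eq hh, fun x => ⟨fun hx => ?_, fun hx => ?_⟩⟩
  · rw [hh x, signTo, if_pos ((hχ x).2 hx), mul_one]
  · rw [hh x, signTo, if_neg (mt (hχ x).1 hx)]

theorem commute_iff_conj_eq {h x : G} : Commute x h ↔ h⁻¹ * x * h = x := by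
  rw [mul_assoc, inv_mul_eq_iff_eq_mul]; rfl

theorem mem_center_of_forall_conj_eq {h : G} (hh : ∀ x, h⁻¹ * x * h = x) : h ∈ center G :=
  mem_center_iff.2 fun x => commute_iff_conj_eq.2 (hh x)

theorem eq_of_sq_eq_one_of_mem_center [Finite G] (h2 : IsPGroup 2 (G ⧸ center G))
    (hnt : (⊥ : Subgroup (G ⧸ center G)) ≠ ⊤)
    (hQ : commutator (G ⧸ center G) ≤ sqSeries (G ⧸ center G) 2) (hin : InvolutionsInner G)
    (hz : z ∈ center G) (hz2 : z ^ 2 = 1) (hz1 : z ≠ 1)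
    {y : G} (hy : y ∈ center G) (hy2 : y ^ 2 = 1) (hy1 : y ≠ 1) : y = z := by
  by_contra hyz
  obtain ⟨L, -, hL⟩ := exists_index_two_of_ne_top h2 hnt
  obtain ⟨h, hh, hhL⟩ := exists_mem_twist_of_index_two hin z hz hz2 hL
  have hh' := mem_twist_of_sq_mem_center (hz := hy) (hz2 := hy2) h2 hQ hin hy1
    (sq_mem_center_of_mem_twist hh)
  obtain ⟨q, hq⟩ : ∃ q, q ∉ L := by
    by_contra! hall
    rw [eq_top_iff' L |>.2 hall] at hL
    simp at hL
  obtain ⟨x, rfl⟩ := QuotientGroup.mk_surjective q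
  have h1 := (hhL x).2 hq
  rcases hh' x with h3 | h3
  · rw [h3] at h1
    exact hz1 (left_eq_mul.1 h1)
  · rw [h3] at h1
    exact hyz (mul_left_cancel h1)

theorem index_centralizer_of_mem_twist {w : G} (hw : w ∈ twist z hz hz2) (hwc : w ∉ center G) :
    (centralizer {w}).index = 2 := by
  obtain ⟨g, hg⟩ : ∃ g, ¬ w⁻¹ * g * w = g := by
    by_contra! hall
    exact hwc (mem_center_of_forall_conj_eq hall)
  have hmem : ∀ x, x ∈ centralizer {w} ↔ w⁻¹ * x * w = x := fun x => by
    rw [mem_centralizer_singleton_iff, ← commute_iff_conj_eq]; exact Iff.rfl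
  have hz1 : z ≠ 1 := by
    rintro rfl
    exact hg (by simpa using hw g)
  have hg' := (hw g).resolve_left hg
  refine index_eq_two_iff.2 ⟨g, fun b => ?_⟩
  rw [hmem, hmem]
  have e : w⁻¹ * (b * g) * w = w⁻¹ * b * w * (w⁻¹ * g * w) := by group
  rw [e, hg']
  rcases hw b with hb | hb
  · refine Or.inr ⟨hb, ?_⟩
    rw [hb, ← mul_assoc]
    exact fun h => hz1 (mul_eq_left.1 h)
  · refine Or.inl ⟨?_, ?_⟩
    · rw [hb, mul_assoc b z, ← mul_assoc z g, ← mem_center_iff.1 hz g, mul_assoc g z z, ← pow_two,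
        hz2, mul_one]
    · rw [hb]
      exact fun h => hz1 (mul_eq_left.1 h)

theorem commute_of_mem_sqSeries_one {a b : G} (ha : a ∈ twist z hz hz2)
    (hb : (b : G ⧸ center G) ∈ sqSeries (G ⧸ center G) 1) : Commute b a := by
  by_cases hac : a ∈ center G
  · exact mem_center_iff.1 hac b
  have hM := index_centralizer_of_mem_twist ha hac
  have hle : sqSeries (G ⧸ center G) 1 ≤ (centralizer {a}).map (QuotientGroup.mk' (center G)) := by
    refine (closure_le _).2 ?_
    rintro _ ⟨q, -, rfl⟩
    obtain ⟨x, rfl⟩ := QuotientGroup.mk_surjective q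
    exact ⟨x ^ 2, sq_mem_of_index_two hM x, rfl⟩
  obtain ⟨m, hm, hmb⟩ := hle hb
  have h1 := mul_mem hm (center_le_centralizer {a} (QuotientGroup.eq.1 hmb))
  rw [mul_inv_cancel_left] at h1
  exact mem_centralizer_singleton_iff.1 h1

/-- The automorphism of `exists_involution` attached to a noncentral `w` is not inner. -/
theorem false_of_sign_function [Finite G] (h2 : IsPGroup 2 (G ⧸ center G))
    (hnt : (⊥ : Subgroup (G ⧸ center G)) ≠ ⊤)
    (hQ : commutator (G ⧸ center G) ≤ sqSeries (G ⧸ center G) 2) (hin : InvolutionsInner G)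
    (hz1 : z ≠ 1) {w g : G} (hw : w ∈ twist z hz hz2) (hwc : w ∉ center G)
    (hg : g ∉ centralizer {w}) (F : G → G)
    (hF : ∀ m ∈ centralizer {w}, F m = 1 ∨ F m = z)
    (hFmul : ∀ m ∈ centralizer {w}, ∀ n ∈ centralizer {w}, F (m * n) = F m * F n)
    (hFconj : ∀ m ∈ centralizer {w}, F (g⁻¹ * m * g) = F m) (hFg : F (g ^ 2) = w ^ 2 * z)
    (hFw : F w = w ^ 2) (hFz : F z = 1) : False := by
  have hgw : w⁻¹ * g * w = g * z :=
    (hw g).resolve_left fun h => hg (mem_centralizer_singleton_iff.2 (commute_iff_conj_eq.2 h))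
  obtain ⟨α, hαg, hα⟩ := exists_involution (index_centralizer_of_mem_twist hw hwc) hg
    (mem_centralizer_singleton_iff.2 rfl)
    (fun m hm => mem_centralizer_singleton_iff.1 hm) (conj_eq_mul_symm hz2 hgw) hz hz2
    hF hFmul hFconj hFg hFw hFz
  have hαz : ∀ c ∈ center G, c ^ 2 = 1 → α c = c := by
    intro c hc hc2
    by_cases hc1 : c = 1
    · rw [hc1, map_one]
    have huniq : ∀ y ∈ center G, y ^ 2 = 1 → y ≠ 1 → y = z := fun y hy hy2 hy1 =>
      eq_of_sq_eq_one_of_mem_center h2 hnt hQ hin hz hz2 hz1 hy hy2 hy1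
    rw [huniq c hc hc2 hc1]
    refine huniq _ ?_ (by rw [← map_pow, hz2, map_one]) (by simpa using hz1)
    rw [mem_center_iff]
    intro x
    rw [← hα x, ← map_mul, ← map_mul, mem_center_iff.1 hz]
  obtain ⟨h, hh⟩ := hin α hα hαz
  have hh2 : h ^ 2 ∈ center G := by
    refine mem_center_of_forall_conj_eq fun x => ?_
    have := hα x
    rw [hh, hh] at this
    have e : (h ^ 2)⁻¹ * x * h ^ 2 = h⁻¹ * (h⁻¹ * x * h) * h := by simp only [pow_two]; group
    rw [e, this]
  have hwz : w ∈ center G := by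
    rcases mem_twist_of_sq_mem_center (hz := hz) (hz2 := hz2) h2 hQ hin hz1 hh2 g with h3 | h3 <;>
      rw [← hh g, hαg] at h3
    · rw [mul_eq_left.1 h3]; exact one_mem _
    · rw [mul_left_cancel h3]; exact hz
  exact hwc hwz

/-- A finite abelian group with a unique involution has at most two classes modulo squares. -/
theorem exists_sq_eq_or {A : Type*} [CommGroup A] [Finite A] {z : A} (hz2 : z ^ 2 = 1)
    (hz1 : z ≠ 1) (huniq : ∀ y : A, y ^ 2 = 1 → y ≠ 1 → y = z) (a b : A) :
    ∃ t : A, t ^ 2 = a ∨ t ^ 2 = b ∨ t ^ 2 = a * b := by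
  have hker : Nat.card (powMonoidHom 2 : A →* A).ker = 2 := by
    rw [Nat.card_eq_two_iff]
    refine ⟨1, ⟨z, hz2⟩, fun h => hz1 (congrArg Subtype.val h).symm, ?_⟩
    refine Set.eq_univ_of_forall ?_
    rintro ⟨y, hy2⟩
    by_cases hy1 : y = 1
    · left; exact Subtype.ext hy1
    · right; exact Subtype.ext (huniq y hy2 hy1)
  have hidx : (powMonoidHom 2 : A →* A).range.index = 2 := by
    have h1 := card_mul_index (powMonoidHom 2 : A →* A).ker
    have h3 := card_mul_index (powMonoidHom 2 : A →* A).range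
    rw [index_ker, hker] at h1
    rw [← h1, mul_comm] at h3
    exact Nat.eq_of_mul_eq_mul_right Nat.card_pos h3
  have hab := mul_mem_iff_of_index_two hidx (a := a) (b := b)
  by_cases h1 : a ∈ (powMonoidHom 2 : A →* A).range
  · obtain ⟨t, h⟩ := h1
    exact ⟨t, Or.inl h⟩
  by_cases h3 : b ∈ (powMonoidHom 2 : A →* A).range
  · obtain ⟨t, h⟩ := h3
    exact ⟨t, Or.inr (Or.inl h)⟩
  · obtain ⟨t, h⟩ := hab.2 (iff_of_false h1 h3)
    exact ⟨t, Or.inr (Or.inr h)⟩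

open scoped IsMulCommutative in
theorem exists_mem_center_sq_eq_or [Finite G] (h2 : IsPGroup 2 (G ⧸ center G))
    (hnt : (⊥ : Subgroup (G ⧸ center G)) ≠ ⊤)
    (hQ : commutator (G ⧸ center G) ≤ sqSeries (G ⧸ center G) 2) (hin : InvolutionsInner G)
    (hz : z ∈ center G) (hz2 : z ^ 2 = 1) (hz1 : z ≠ 1) {a b : G} (ha : a ∈ center G)
    (hb : b ∈ center G) : ∃ t ∈ center G, t ^ 2 = a ∨ t ^ 2 = b ∨ t ^ 2 = a * b := by
  obtain ⟨t, ht⟩ := exists_sq_eq_or (A := center G) (z := ⟨z, hz⟩) (Subtype.ext hz2)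
    (fun h => hz1 (congrArg Subtype.val h))
    (fun y hy2 hy1 => Subtype.ext (eq_of_sq_eq_one_of_mem_center h2 hnt hQ hin hz hz2 hz1 y.2
      (congrArg Subtype.val hy2) fun h => hy1 (Subtype.ext h))) ⟨a, ha⟩ ⟨b, hb⟩
  exact ⟨t, t.2, ht.imp (congrArg Subtype.val) (Or.imp (congrArg Subtype.val)
    (congrArg Subtype.val))⟩

theorem false_of_conj_eq_mul [Finite G] (h2 : IsPGroup 2 (G ⧸ center G))
    (hnt : (⊥ : Subgroup (G ⧸ center G)) ≠ ⊤)
    (hQ : commutator (G ⧸ center G) ≤ sqSeries (G ⧸ center G) 2) (hin : InvolutionsInner G)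
    (hz1 : z ≠ 1) {a b t : G} (ha : a ∈ twist z hz hz2) (hb : b ∈ twist z hz hz2)
    (hab : b⁻¹ * a * b = a * z) (ht : t ∈ center G) (hbt : b ^ 2 = a ^ 2 * t ^ 2) : False := by
  have hzc : ∀ x, x * z = z * x := mem_center_iff.1 hz
  have htc : ∀ x, x * t = t * x := mem_center_iff.1 ht
  have hba : b * a⁻¹ = a⁻¹ * b * z := by
    have : a * b = b * a * z := by rw [mul_assoc b, ← hab]; group
    rw [mul_inv_eq_iff_eq_mul, mul_assoc, ← hzc a, mul_assoc, ← mul_assoc b, ← this]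
    group
  set w := a⁻¹ * b * t⁻¹ with hw_def
  have hw2 : w ^ 2 = z := by
    have htc' : ∀ x, x * t⁻¹ = t⁻¹ * x := mem_center_iff.1 (inv_mem ht)
    calc w ^ 2 = a⁻¹ * b * (t⁻¹ * (a⁻¹ * b)) * t⁻¹ := by rw [pow_two, hw_def]; group
      _ = a⁻¹ * (b * a⁻¹) * b * (t ^ 2)⁻¹ := by rw [← htc']; simp only [pow_two]; group
      _ = a⁻¹ * a⁻¹ * b * (z * b) * (t ^ 2)⁻¹ := by rw [hba]; group
      _ = (a ^ 2)⁻¹ * b ^ 2 * (z * (t ^ 2)⁻¹) := by rw [← hzc]; simp only [pow_two]; group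
      _ = z := by rw [← hzc, hbt]; group
  have hwa : w⁻¹ * a * w = a * z := by
    rw [← hab, hw_def]
    calc _ = t * (b⁻¹ * a * b) * t⁻¹ := by group
      _ = _ := by rw [← htc, mul_inv_cancel_right]
  have hw : w ∈ twist z hz hz2 :=
    mul_mem (mul_mem (inv_mem ha) hb) (center_le_twist (inv_mem ht))
  have haw : ¬ w⁻¹ * a * w = a := fun h => hz1 (left_eq_mul.1 (h.symm.trans hwa))
  refine false_of_sign_function (hz := hz) (hz2 := hz2) h2 hnt hQ hin hz1 (w := w) (g := a) hw
    (fun h => haw ?_) (fun h => haw (commute_iff_conj_eq.1 (mem_centralizer_singleton_iff.1 h)))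
    (fun x => x⁻¹ * (a⁻¹ * x * a)) (fun m _ => ?_) (fun m _ n _ => ?_) (fun m _ => ?_) ?_ ?_ ?_
  · exact commute_iff_conj_eq.1 (mem_center_iff.1 h a)
  · rcases ha m with h | h <;> rw [h] <;> simp
  · have hc : m⁻¹ * (a⁻¹ * m * a) ∈ center G := by
      rcases ha m with h | h <;> rw [h] <;> simp [one_mem, hz]
    calc _ = n⁻¹ * (m⁻¹ * (a⁻¹ * m * a)) * (a⁻¹ * n * a) := by group
      _ = _ := by rw [mem_center_iff.1 hc, mul_assoc]
  · rcases ha m with h | h <;> rw [h]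
    · rw [h]
    · have : a⁻¹ * (m * z) * a = a⁻¹ * m * a * z := by
        rw [← mul_assoc, mul_assoc _ z, ← hzc, ← mul_assoc]
      rw [this, h]; group
  · rw [hw2, ← pow_two, hz2]; simp only [pow_two]; group
  · have := conj_eq_mul_symm hz2 hwa
    rw [this, hw2, inv_mul_cancel_left]
  · rw [mul_assoc, ← hzc a, inv_mul_cancel_left, inv_mul_cancel]

/-- Under the standing assumptions, the image of `twist` consists of products of squares. -/
theorem mk_mem_sqSeries_one_of_mem_twist [Finite G] (h2 : IsPGroup 2 (G ⧸ center G))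
    (hnt : (⊥ : Subgroup (G ⧸ center G)) ≠ ⊤)
    (hQ : commutator (G ⧸ center G) ≤ sqSeries (G ⧸ center G) 2) (hin : InvolutionsInner G)
    (hz1 : z ≠ 1) {u : G} (hu : u ∈ twist z hz hz2) :
    (u : G ⧸ center G) ∈ sqSeries (G ⧸ center G) 1 := by
  by_contra hu1
  obtain ⟨L, -, hL, huL⟩ := exists_index_two_of_notMem
    (fun x => sq_mem_sqSeries_succ (i := 0) (mem_top x)) hu1
  obtain ⟨v, hv, hvL⟩ := exists_mem_twist_of_index_two hin z hz hz2 hL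
  have huv := (hvL u).2 huL
  have hvu := conj_eq_mul_symm hz2 huv
  have hzc : ∀ x, x * z = z * x := mem_center_iff.1 hz
  have hu2 := sq_mem_center_of_mem_twist hu
  have hv2 := sq_mem_center_of_mem_twist hv
  have e : v * u = u * v * z := by rw [mul_assoc u, ← hvu]; group
  have huv2 : (u * v) ^ 2 = u ^ 2 * (v ^ 2 * z) := by
    calc (u * v) ^ 2 = u * (v * u) * v := by rw [pow_two]; group
      _ = u * u * v * (z * v) := by rw [e]; group
      _ = _ := by rw [← hzc]; simp only [pow_two]; group
  obtain ⟨t, ht, h | h | h⟩ := exists_mem_center_sq_eq_or h2 hnt hQ hin hz hz2 hz1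
    (mul_mem hv2 hz) (mul_mem hu2 hz)
  · refine false_of_conj_eq_mul (hz := hz) (hz2 := hz2) h2 hnt hQ hin hz1 hu (mul_mem hu hv) ?_ ht
      (h ▸ huv2)
    rw [← huv]; group
  · refine false_of_conj_eq_mul (hz := hz) (hz2 := hz2) h2 hnt hQ hin hz1 hv (mul_mem hu hv) ?_ ht
      ?_
    · calc _ = v⁻¹ * (u⁻¹ * v * u) * v := by group
        _ = v * z := by rw [hvu, inv_mul_cancel_left, hzc]
    · rw [h, huv2, ← mul_assoc, ← mul_assoc, mem_center_iff.1 hv2]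
  · refine false_of_conj_eq_mul (hz := hz) (hz2 := hz2) (t := t * (u ^ 2)⁻¹) h2 hnt hQ hin hz1 hu
      hv huv (mul_mem ht (inv_mem hu2)) ?_
    have hc : Commute t (u ^ 2)⁻¹ := mem_center_iff.1 (inv_mem hu2) t
    have h3 : t ^ 2 = u ^ 2 * v ^ 2 := by
      rw [h, mul_assoc, ← mul_assoc z, ← hzc, mul_assoc (u ^ 2), ← pow_two, hz2, mul_one,
        mem_center_iff.1 hu2]
    have h4 : v ^ 2 * u ^ 2 = u ^ 2 * v ^ 2 := mem_center_iff.1 hu2 _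
    rw [hc.mul_pow, h3, ← h4]
    calc v ^ 2 = u ^ 2 * v ^ 2 * (u ^ 2)⁻¹ := by rw [← h4]; group
      _ = _ := by group

theorem exists_involution_mem_twist [Finite G] (h2 : IsPGroup 2 (G ⧸ center G))
    (hcyc : ∀ x : G ⧸ center G, zpowers x ≠ ⊤)
    (hQ : commutator (G ⧸ center G) ≤ sqSeries (G ⧸ center G) 2) (hin : InvolutionsInner G)
    (hz : z ∈ center G) (hz2 : z ^ 2 = 1) (hz1 : z ≠ 1) :
    ∃ w ∈ twist z hz hz2, w ∉ center G ∧ w ^ 2 = 1 := by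
  have hnt : (⊥ : Subgroup (G ⧸ center G)) ≠ ⊤ := zpowers_one_eq_bot (G := G ⧸ center G) ▸ hcyc 1
  have hex : ∀ L : Subgroup (G ⧸ center G), L.index = 2 → ∃ x : G, (x : G ⧸ center G) ∉ L := by
    intro L hL
    by_contra! hall
    have : L = ⊤ := (eq_top_iff' L).2 fun q => QuotientGroup.induction_on q hall
    simp [this] at hL
  have hne : ∀ x h : G, h⁻¹ * x * h = x * z → h ∉ center G := fun x h hx hc =>
    hz1 (left_eq_mul.1 ((commute_iff_conj_eq.1 (mem_center_iff.1 hc x)).symm.trans hx))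
  obtain ⟨L, -, hL⟩ := exists_index_two_of_ne_top h2 hnt
  obtain ⟨x, hx⟩ := hex L hL
  obtain ⟨a, ha, haL⟩ := exists_mem_twist_of_index_two hin z hz hz2 hL
  obtain ⟨K, hxK, hK⟩ := exists_index_two_of_ne_top h2 (hcyc x)
  obtain ⟨y, hy⟩ := hex K hK
  obtain ⟨b, hb, hbK⟩ := exists_mem_twist_of_index_two hin z hz hz2 hK
  have hax := (haL x).2 hx
  have hbx := (hbK x).1 (hxK (mem_zpowers _))
  have habx : (b * a)⁻¹ * x * (b * a) = x * z := by
    rw [← hax]; nth_rw 2 [← hbx]; group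
  have hba : Commute a b := commute_of_mem_sqSeries_one hb
    (mk_mem_sqSeries_one_of_mem_twist h2 hnt hQ hin hz1 ha)
  have key : ∀ c ∈ twist z hz hz2, c ∉ center G → ∀ t ∈ center G, t ^ 2 = c ^ 2 →
      ∃ w ∈ twist z hz hz2, w ∉ center G ∧ w ^ 2 = 1 := by
    intro c hc hcc t ht h
    refine ⟨c * t⁻¹, mul_mem hc (center_le_twist (inv_mem ht)), fun hct => hcc ?_, ?_⟩
    · simpa using mul_mem hct ht
    · have hct : Commute c t⁻¹ := mem_center_iff.1 (inv_mem ht) c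
      rw [hct.mul_pow, ← h, inv_pow, mul_inv_cancel]
  obtain ⟨t, ht, h | h | h⟩ := exists_mem_center_sq_eq_or h2 hnt hQ hin hz hz2 hz1
    (sq_mem_center_of_mem_twist hb) (sq_mem_center_of_mem_twist ha)
  · exact key b hb (hne y b ((hbK y).2 hy)) t ht h
  · exact key a ha (hne x a hax) t ht h
  · exact key (b * a) (mul_mem hb ha) (hne x _ habx) t ht (by rw [h, hba.symm.mul_pow])

theorem false_of_involutionsInner [Finite G] (h2 : IsPGroup 2 (G ⧸ center G))
    (hcyc : ∀ x : G ⧸ center G, zpowers x ≠ ⊤)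
    (hQ : commutator (G ⧸ center G) ≤ sqSeries (G ⧸ center G) 2) (hin : InvolutionsInner G)
    (hz : z ∈ center G) (hz2 : z ^ 2 = 1) (hz1 : z ≠ 1) : False := by
  classical
  have hnt : (⊥ : Subgroup (G ⧸ center G)) ≠ ⊤ := zpowers_one_eq_bot (G := G ⧸ center G) ▸ hcyc 1
  have := h2.isNilpotent
  obtain ⟨w, hw, hwc, hw2⟩ := exists_involution_mem_twist h2 hcyc hQ hin hz hz2 hz1
  have htw : ∀ u ∈ twist z hz hz2, (u : G ⧸ center G) ∈ sqSeries (G ⧸ center G) 1 :=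
    fun u hu => mk_mem_sqSeries_one_of_mem_twist h2 hnt hQ hin hz1 hu
  have hcw : ∀ b : G, (b : G ⧸ center G) ∈ sqSeries (G ⧸ center G) 1 → b ∈ centralizer {w} :=
    fun b hb => mem_centralizer_singleton_iff.2 (commute_of_mem_sqSeries_one hw hb)
  have hM := index_centralizer_of_mem_twist hw hwc
  have hMn := normal_of_index_eq_two hM
  obtain ⟨g, hg⟩ : ∃ g, g ∉ centralizer {w} := by
    by_contra! hall
    rw [(eq_top_iff' _).2 hall] at hM
    simp at hM
  let π : G →* (G ⧸ center G) ⧸ sqSeries (G ⧸ center G) 2 :=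
    (QuotientGroup.mk' _).comp (QuotientGroup.mk' _)
  have hπ : ∀ x y, Commute (π x) (π y) := fun x y =>
    commute_mk_of_mem_sqSeries hQ (i := 0) (mem_top _) _
  -- the elements congruent modulo `π.ker` to the square of an element of the centralizer
  let B : Subgroup (centralizer {w}) :=
    { carrier := {m | ∃ n ∈ centralizer {w}, π m = π n ^ 2}
      one_mem' := ⟨1, one_mem _, by simp⟩
      mul_mem' := by
        rintro m m' ⟨n, hn, h⟩ ⟨n', hn', h'⟩
        refine ⟨n * n', mul_mem hn hn', ?_⟩
        rw [coe_mul, map_mul, map_mul, h, h', (hπ n n').mul_pow]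
      inv_mem' := by
        rintro m ⟨n, hn, h⟩
        refine ⟨n⁻¹, inv_mem hn, ?_⟩
        rw [coe_inv, map_inv, map_inv, h, inv_pow] }
  have hg2 : g ^ 2 ∈ centralizer {w} := sq_mem_of_index_two hM g
  have hgB : (⟨g ^ 2, hg2⟩ : centralizer {w}) ∉ B := by
    rintro ⟨n, hn, h⟩
    have h1 : π ((g * n⁻¹) ^ 2) = 1 := by
      have h : π g ^ 2 = π n ^ 2 := by rw [← map_pow]; exact h
      rw [map_pow, map_mul, (hπ _ _).mul_pow, h, map_inv, inv_pow, mul_inv_cancel]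
    obtain ⟨k, hk, hk2⟩ := exists_mul_sq_eq h2 hQ (x := 1) (y := (g * n⁻¹ : G)) h1
    obtain ⟨k, rfl⟩ := QuotientGroup.mk_surjective k
    have h3 : (g * n⁻¹ * k) ^ 2 ∈ center G := mk_sq_eq_one_iff.1 hk2
    have h4 := htw _ (mem_twist_of_sq_mem_center (hz := hz) (hz2 := hz2) h2 hQ hin hz1 h3)
    have h5 := mul_mem (hcw _ h4) (mul_mem (inv_mem (hcw k hk)) hn)
    refine hg ?_
    convert h5 using 1
    group
  obtain ⟨L, hBL, hL, hgL⟩ := exists_index_two_of_notMem (B := B)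
    (fun x => ⟨x, x.2, by rw [coe_pow, map_pow]⟩) hgB
  have hcB : ∀ m (hm : m ∈ centralizer {w}), π m = 1 → (⟨m, hm⟩ : centralizer {w}) ∈ L :=
    fun m hm h => hBL ⟨1, one_mem _, by rw [map_one, one_pow]; exact h⟩
  have hmem : ∀ m (hm : m ∈ centralizer {w}),
      m ∈ L.map (centralizer {w}).subtype ↔ (⟨m, hm⟩ : centralizer {w}) ∈ L := by
    intro m hm
    refine ⟨?_, fun h => ⟨_, h, rfl⟩⟩
    rintro ⟨m', h, rfl⟩
    exact h
  have hww : w ∈ centralizer {w} := mem_centralizer_singleton_iff.2 rfl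
  have hzM : z ∈ centralizer {w} := center_le_centralizer _ hz
  have hwL : (⟨w, hww⟩ : centralizer {w}) ∈ L := by
    obtain ⟨y, -, hy⟩ := exists_sq_eq_mk hQ (i := 0) (htw w hw)
    obtain ⟨k, -, hk⟩ := exists_mul_sq_eq h2 hQ hy
    obtain ⟨v, hv⟩ := QuotientGroup.mk_surjective (y * k)
    rw [← hv] at hk
    have hc : (v ^ 2)⁻¹ * w ∈ center G := QuotientGroup.eq.1 hk
    refine hBL ⟨v, mem_centralizer_singleton_iff.2 ?_, ?_⟩
    · have e : w = v ^ 2 * ((v ^ 2)⁻¹ * w) := by group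
      rw [e]
      exact ((Commute.refl v).pow_right 2).mul_right (mem_center_iff.1 hc v)
    · exact congrArg (QuotientGroup.mk' (sqSeries (G ⧸ center G) 2)) hk.symm
  refine false_of_sign_function (hz := hz) (hz2 := hz2) h2 hnt hQ hin hz1 hw hwc hg
    (fun x => if x ∈ L.map (centralizer {w}).subtype then 1 else z)
    (fun m _ => ?_) (fun m hm n hn => ?_) (fun m hm => ?_) ?_ ?_ ?_
  · split <;> simp
  · have h := mul_mem_iff_of_index_two hL (a := ⟨m, hm⟩) (b := ⟨n, hn⟩)
    rw [← hmem m hm, ← hmem n hn, MulMemClass.mk_mul_mk, ← hmem _ (mul_mem hm hn)] at h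
    by_cases h1 : m ∈ L.map (centralizer {w}).subtype <;>
      by_cases h3 : n ∈ L.map (centralizer {w}).subtype <;>
      simp only [h, h1, h3, if_true, if_false, iff_true, iff_false, not_true_eq_false,
        mul_one, one_mul, ← pow_two, hz2, one_pow]
  · have hgm : g⁻¹ * m * g ∈ centralizer {w} := by simpa using hMn.conj_mem m hm g⁻¹
    have h1 : m⁻¹ * (g⁻¹ * m * g) ∈ centralizer {w} := mul_mem (inv_mem hm) hgm
    have h3 := hcB _ h1 (by
      rw [map_mul, map_mul, map_mul, mul_assoc (π g⁻¹), (hπ m g).eq, map_inv, map_inv]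
      group)
    have h4 : (⟨g⁻¹ * m * g, hgm⟩ : centralizer {w}) = ⟨m, hm⟩ * ⟨_, h1⟩ := Subtype.ext (by
      simp)
    have h5 : g⁻¹ * m * g ∈ L.map (centralizer {w}).subtype ↔
        m ∈ L.map (centralizer {w}).subtype := by
      rw [hmem _ hgm, hmem _ hm, h4]
      exact L.mul_mem_cancel_right h3
    simp only [h5]
  · rw [if_neg (fun h => hgL ((hmem _ hg2).1 h)), hw2, one_mul]
  · rw [if_pos ((hmem _ hww).2 hwL), hw2]
  · have : π z = 1 := by
      change QuotientGroup.mk' _ (z : G ⧸ center G) = 1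
      rw [(QuotientGroup.eq_one_iff z).2 hz, map_one]
    rw [if_pos ((hmem _ hzM).2 (hcB z hzM this))]

end InvolutionsInner

/-- Let `G` be a finite non-abelian `2`-group with `G/Z(G)` powerful
(its derived subgroup lies in the subgroup generated by fourth powers). Then `G`
has a noninner automorphism of order `2` fixing either `Φ(G)` or `Ω₁(Z(G))`
elementwise. -/
theorem stmt8 (G : Type*) [Group G] [Finite G]
    (h2G : IsPGroup 2 G) (hna : ¬ ∀ a b : G, a * b = b * a)
    (hpow : commutator (G ⧸ Subgroup.center G) ≤
      Subgroup.closure {x : G ⧸ Subgroup.center G | ∃ y : G ⧸ Subgroup.center G, y ^ 4 = x}) :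
    ∃ α : MulAut G, orderOf α = 2 ∧
      ((∀ x ∈ frattini G, α x = x) ∨
        (∀ z ∈ Subgroup.center G, z ^ 2 = 1 → α z = z)) ∧
      ¬ ∃ h : G, ∀ x : G, α x = h⁻¹ * x * h := by
  by_contra hcon
  have hin : InvolutionsInner G := by
    intro α hα hfix
    by_contra hinn
    have hα1 : α ≠ 1 := by
      rintro rfl
      exact hinn ⟨1, by simp⟩
    exact hcon ⟨α, orderOf_eq_prime (MulEquiv.ext hα) hα1, Or.inr hfix, hinn⟩
  have hQ : commutator (G ⧸ Subgroup.center G) ≤ sqSeries (G ⧸ Subgroup.center G) 2 := by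
    refine hpow.trans ((Subgroup.closure_le _).2 ?_)
    rintro _ ⟨y, rfl⟩
    have : y ^ 4 = (y ^ 2) ^ 2 := by rw [← pow_mul]
    rw [this]
    exact sq_mem_sqSeries_succ (sq_mem_sqSeries_succ (i := 0) (Subgroup.mem_top y))
  have hcyc : ∀ x : G ⧸ Subgroup.center G, Subgroup.zpowers x ≠ ⊤ := by
    intro x hx
    have : IsCyclic (G ⧸ Subgroup.center G) :=
      isCyclic_iff_exists_zpowers_eq_top.2 ⟨x, hx⟩
    have := (QuotientGroup.mk' (Subgroup.center G)).isMulCommutative_of_isCyclic_of_ker_le_center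
      (by simp)
    exact hna fun a b => mul_comm' a b
  have : Nontrivial G := by
    by_contra h
    have := not_nontrivial_iff_subsingleton.1 h
    exact hna fun a b => Subsingleton.elim _ _
  have := h2G.center_nontrivial
  obtain ⟨c, hc⟩ := exists_ne (1 : Subgroup.center G)
  have hord : orderOf (c ^ (orderOf c / 2)) = 2 :=
    orderOf_pow_orderOf_div (orderOf_pos c).ne' ((h2G.to_subgroup _).dvd_orderOf hc)
  obtain ⟨hz2, hz1⟩ := orderOf_eq_prime_iff.1 hord
  exact false_of_involutionsInner (h2G.to_quotient _) hcyc hQ hin (c ^ (orderOf c / 2)).2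
    (congrArg Subtype.val hz2) fun h => hz1 (Subtype.ext h)
end

section
/- Let G be a finite nilpotent group of nilpotency class at most 2 that is generated by two elements. Then the center Z(G) can be generated by at most 3 elements, i.e., d(Z(G)) ≤ 3. More precisely, if G = ⟨a, b⟩ and k is the order of the commutator [a,b], then Z(G) = ⟨a^k, b^k, [a,b]⟩. -/
section TwoGenerator

variable {G : Type*} [Group G] {a b c : G}

/-- An element commuting with every member of a generating set is central. -/
theorem mem_center_of_closure_eq_top {s : Set G} (hs : Subgroup.closure s = ⊤) {g : G}
    (h : ∀ x ∈ s, x * g = g * x) : g ∈ Subgroup.center G := by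
  have hle : Subgroup.closure s ≤ Subgroup.centralizer {g} := by
    rw [Subgroup.closure_le]
    intro x hx
    rw [SetLike.mem_coe, Subgroup.mem_centralizer_singleton_iff]
    exact h x hx
  rw [Subgroup.mem_center_iff]
  intro x
  exact Subgroup.mem_centralizer_singleton_iff.mp (hle (hs ▸ Subgroup.mem_top x))

theorem zpow_mul_eq_mul_zpow_mul_zpow (hc : c ∈ Subgroup.center G) (h : a * b = b * a * c)
    (n : ℤ) : a ^ n * b = b * a ^ n * c ^ n := by
  have hconj : b⁻¹ * a * b = a * c := by rw [mul_assoc, h]; group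
  have hcomm : Commute a c := Subgroup.mem_center_iff.mp hc a
  have hn : (b⁻¹ * a * b) ^ n = b⁻¹ * a ^ n * b := by
    simpa using conj_zpow (a := b⁻¹) (b := a) (i := n)
  rw [hconj, hcomm.mul_zpow] at hn
  rw [mul_assoc b, hn]
  group

theorem zpow_commute_iff_orderOf_dvd (hc : c ∈ Subgroup.center G) (h : a * b = b * a * c)
    (n : ℤ) : b * a ^ n = a ^ n * b ↔ (orderOf c : ℤ) ∣ n := by
  rw [zpow_mul_eq_mul_zpow_mul_zpow hc h, left_eq_mul, orderOf_dvd_iff_zpow_eq_one]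

/-- Normal form in a group generated by two elements with central commutator. -/
theorem exists_zpow_mul_zpow_mul_zpow (hgen : Subgroup.closure {a, b} = ⊤)
    (hc : c ∈ Subgroup.center G) (h : a * b = b * a * c) (g : G) :
    ∃ i j l : ℤ, g = a ^ i * b ^ j * c ^ l := by
  have hcen (x : G) (n : ℤ) : x * c ^ n = c ^ n * x :=
    Subgroup.mem_center_iff.mp (zpow_mem hc n) x
  have key (i : ℤ) : b * a ^ i = a ^ i * b * c ^ (-i) := by
    rw [zpow_mul_eq_mul_zpow_mul_zpow hc h]; group
  have key' (i : ℤ) : b⁻¹ * a ^ i = a ^ i * b⁻¹ * c ^ i := by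
    rw [inv_mul_eq_iff_eq_mul, mul_assoc, ← mul_assoc, ← mul_assoc, key, mul_assoc (a ^ i * b),
      ← hcen]
    group
  have hg : g ∈ Subgroup.closure {a, b} := hgen ▸ Subgroup.mem_top g
  induction hg using Subgroup.closure_induction_left with
  | one => exact ⟨0, 0, 0, by simp⟩
  | mul_left x hx y _ ih =>
    obtain ⟨i, j, l, rfl⟩ := ih
    rcases hx with rfl | rfl
    · exact ⟨1 + i, j, l, by group⟩
    · refine ⟨i, 1 + j, -i + l, ?_⟩
      rw [← mul_assoc, ← mul_assoc, key, mul_assoc (a ^ i * x), ← hcen]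
      group
  | inv_mul_cancel x hx y _ ih =>
    obtain ⟨i, j, l, rfl⟩ := ih
    rcases hx with rfl | rfl
    · exact ⟨-1 + i, j, l, by group⟩
    · refine ⟨i, -1 + j, i + l, ?_⟩
      rw [← mul_assoc, ← mul_assoc, key', mul_assoc (a ^ i * x⁻¹), ← hcen]
      group

theorem center_eq_closure_of_closure_pair_eq_top (hgen : Subgroup.closure {a, b} = ⊤)
    (hc : c ∈ Subgroup.center G) (h : a * b = b * a * c) :
    Subgroup.center G = Subgroup.closure {a ^ orderOf c, b ^ orderOf c, c} := by
  have h' : b * a = a * b * c⁻¹ := by rw [h]; group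
  have ha (n : ℤ) : b * a ^ n = a ^ n * b ↔ (orderOf c : ℤ) ∣ n :=
    zpow_commute_iff_orderOf_dvd hc h n
  have hb (n : ℤ) : a * b ^ n = b ^ n * a ↔ (orderOf c : ℤ) ∣ n := by
    rw [zpow_commute_iff_orderOf_dvd (inv_mem hc) h' n, orderOf_inv]
  apply le_antisymm
  · intro z hz
    obtain ⟨i, j, l, rfl⟩ := exists_zpow_mul_zpow_mul_zpow hgen hc h z
    have hz' : a ^ i * b ^ j ∈ Subgroup.center G :=
      (Subgroup.mul_mem_cancel_right _ (zpow_mem hc l)).mp hz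
    rw [Subgroup.mem_center_iff] at hz'
    have hi : (orderOf c : ℤ) ∣ i := by
      rw [← ha]
      have := hz' b
      rw [mul_assoc (a ^ i), ← zpow_add_one, add_comm, zpow_one_add, ← mul_assoc,
        ← mul_assoc] at this
      exact mul_right_cancel this
    have hj : (orderOf c : ℤ) ∣ j := by
      rw [← hb]
      have := hz' a
      rw [← mul_assoc, ← zpow_one_add, add_comm, zpow_add_one, mul_assoc, mul_assoc] at this
      exact mul_left_cancel this
    obtain ⟨m, rfl⟩ := hi
    obtain ⟨n, rfl⟩ := hj
    rw [zpow_mul, zpow_mul, zpow_natCast, zpow_natCast]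
    refine mul_mem (mul_mem (zpow_mem ?_ _) (zpow_mem ?_ _)) (zpow_mem ?_ _) <;>
      exact Subgroup.subset_closure (by simp)
  · rw [Subgroup.closure_le]
    rintro x (rfl | rfl | rfl)
    · refine mem_center_of_closure_eq_top hgen ?_
      rintro y (rfl | rfl)
      · exact (pow_mul_comm' _ _).symm
      · simpa using (ha (orderOf c)).mpr dvd_rfl
    · refine mem_center_of_closure_eq_top hgen ?_
      rintro y (rfl | rfl)
      · simpa using (hb (orderOf c)).mpr dvd_rfl
      · exact (pow_mul_comm' _ _).symm
    · exact hc

end TwoGenerator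



/-- Let `G` be a finite nilpotent group of class at most 2 generated
by two elements `a, b`. Then `d(Z(G)) ≤ 3`; more precisely, with `k` the order of
the commutator `[a,b] = a⁻¹ * b⁻¹ * a * b`, we have
`Z(G) = ⟨a ^ k, b ^ k, [a,b]⟩`. -/
theorem stmt9 (G : Type*) [Group G] [Finite G]
    (hclass : commutator G ≤ Subgroup.center G)
    (a b : G) (hgen : Subgroup.closure {a, b} = ⊤) :
    Group.rank (Subgroup.center G) ≤ 3 ∧
      Subgroup.center G =
        Subgroup.closure {a ^ orderOf (a⁻¹ * b⁻¹ * a * b),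
          b ^ orderOf (a⁻¹ * b⁻¹ * a * b), a⁻¹ * b⁻¹ * a * b} := by
  have hc : a⁻¹ * b⁻¹ * a * b ∈ Subgroup.center G := by
    apply hclass
    have := Subgroup.commutator_mem_commutator (Subgroup.mem_top a⁻¹) (Subgroup.mem_top b⁻¹)
    simpa [commutatorElement_def, commutator_def] using this
  have hcenter := center_eq_closure_of_closure_pair_eq_top hgen hc (by group)
  refine ⟨?_, hcenter⟩
  classical
  let s : Finset G := {a ^ orderOf (a⁻¹ * b⁻¹ * a * b),
    b ^ orderOf (a⁻¹ * b⁻¹ * a * b), a⁻¹ * b⁻¹ * a * b}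
  have hs : Subgroup.center G = Subgroup.closure (s : Set G) := by
    simpa [s] using hcenter
  rw [Subgroup.rank_congr hs]
  exact (Subgroup.rank_closure_finset_le_card s).trans Finset.card_le_three
end

section
/- Let p be a prime and let G be a finite p-group of nilpotency class 3 such that G/Z(G) is generated by two elements and Z(G) is not cyclic. Then G has a noninner automorphism of order p that fixes the Frattini subgroup Φ(G) elementwise. -/
/-- The homomorphism `ZMod p → A` (written multiplicatively) sending `1` to an element `u`
with `u ^ p = 1`. -/
def zmodPowHom {A : Type*} [CommGroup A] {p : ℕ} [NeZero p] (u : A) (hu : u ^ p = 1) :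
    Multiplicative (ZMod p) →* A where
  toFun n := u ^ n.toAdd.val
  map_one' := by simp
  map_mul' m n := by
    rw [← pow_add, toAdd_mul, ZMod.val_add, ← pow_eq_pow_mod _ hu]

theorem exists_zmod_hom_of_isCoatom {p : ℕ} (hp : p.Prime) {G : Type*} [Group G] [Finite G]
    [Group.IsNilpotent G] (hpG : IsPGroup p G) {M : Subgroup G} (hM : IsCoatom M) {x : G}
    (hx : x ∉ M) :
    ∃ f : G →* Multiplicative (ZMod p), f.ker = M ∧ f x = Multiplicative.ofAdd 1 := by
  have : Fact p.Prime := ⟨hp⟩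
  have hMn : M.Normal :=
    Subgroup.NormalizerCondition.normal_of_coatom M Group.normalizerCondition_of_isNilpotent hM
  have hx1 : (x : G ⧸ M) ≠ 1 := by simpa using hx
  have : Nontrivial (G ⧸ M) := ⟨⟨_, _, hx1⟩⟩
  have : IsSimpleGroup (G ⧸ M) := by
    refine ⟨fun N _ => ?_⟩
    have hle : M ≤ N.comap (QuotientGroup.mk' M) := by
      intro y hy
      have : (QuotientGroup.mk' M) y = 1 := by simpa using hy
      simp only [Subgroup.mem_comap, this, one_mem]
    have hsurj := QuotientGroup.mk'_surjective M
    rcases hM.le_iff.1 hle with h | h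
    · right
      exact Subgroup.comap_injective hsurj (by rw [h, Subgroup.comap_top])
    · left
      refine Subgroup.comap_injective hsurj ?_
      rw [h, MonoidHom.comap_bot, QuotientGroup.ker_mk']
  have hprime : (Nat.card (G ⧸ M)).Prime := IsSimpleGroup.prime_card
  have hcard : Nat.card (G ⧸ M) = p := by
    obtain ⟨n, hn⟩ := (IsPGroup.iff_card (p := p)).1 (hpG.to_quotient M)
    exact (Nat.prime_dvd_prime_iff_eq hprime hp).1 (hprime.dvd_of_dvd_pow hn.dvd)
  have hgen : ∀ y : G ⧸ M, y ∈ Subgroup.zpowers (x : G ⧸ M) :=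
    fun y => mem_zpowers_of_prime_card hcard hx1
  let e := zmodMulEquivOfGenerator hgen hcard
  refine ⟨e.symm.toMonoidHom.comp (QuotientGroup.mk' M), ?_, ?_⟩
  · ext y
    simp
  · exact zmodMulEquivOfGenerator_symm_apply_generator ..

theorem exists_isCoatom_mem_of_not_isCyclic {G : Type*} [Group G] [Finite G]
    (hG : ¬ IsCyclic G) (x : G) : ∃ M : Subgroup G, IsCoatom M ∧ x ∈ M := by
  have hne : Subgroup.zpowers x ≠ ⊤ := fun h =>
    hG ⟨x, (Subgroup.eq_top_iff' _).1 h⟩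
  obtain ⟨M, hM, hle⟩ := (eq_top_or_exists_le_coatom (Subgroup.zpowers x)).resolve_left hne
  exact ⟨M, hM, hle (Subgroup.mem_zpowers x)⟩

/-- A noncyclic finite `p`-group maps onto `(ZMod p)²`. -/
theorem exists_zmod_homs_of_not_isCyclic {p : ℕ} (hp : p.Prime) {G : Type*} [Group G] [Finite G]
    [Group.IsNilpotent G] (hpG : IsPGroup p G) (hG : ¬ IsCyclic G) :
    ∃ (f g : G →* Multiplicative (ZMod p)) (x y : G), IsCoatom f.ker ∧ IsCoatom g.ker ∧
      f x = Multiplicative.ofAdd 1 ∧ f y = 1 ∧ g x = 1 ∧ g y = Multiplicative.ofAdd 1 := by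
  obtain ⟨M, hM, -⟩ := exists_isCoatom_mem_of_not_isCyclic hG 1
  obtain ⟨x, hx⟩ : ∃ x, x ∉ M := by
    by_contra! h
    exact hM.1 (Subgroup.eq_top_iff' M |>.2 h)
  obtain ⟨N, hN, hxN⟩ := exists_isCoatom_mem_of_not_isCyclic hG x
  obtain ⟨y, hyM, hyN⟩ : ∃ y ∈ M, y ∉ N := by
    by_contra! h
    rcases hM.le_iff.1 (show M ≤ N from h) with h | h
    · exact hN.1 h
    · exact hx (h ▸ hxN)
  obtain ⟨f, hf, hfx⟩ := exists_zmod_hom_of_isCoatom hp hpG hM hx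
  obtain ⟨g, hg, hgy⟩ := exists_zmod_hom_of_isCoatom hp hpG hN hyN
  exact ⟨f, g, x, y, hf ▸ hM, hg ▸ hN, hfx, f.mem_ker.1 (hf ▸ hyM), g.mem_ker.1 (hg ▸ hxN), hgy⟩

theorem card_ker_powMonoidHom {A : Type*} [CommGroup A] [Finite A] (p : ℕ) :
    Nat.card (powMonoidHom p : A →* A).ker = (powMonoidHom p : A →* A).range.index :=
  Subgroup.index_range.symm

theorem sq_le_card_ker_powMonoidHom {p : ℕ} (hp : p.Prime) {A : Type*} [CommGroup A] [Finite A]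
    (hpA : IsPGroup p A) (hA : ¬ IsCyclic A) :
    p ^ 2 ≤ Nat.card (powMonoidHom p : A →* A).ker := by
  have : Fact p.Prime := ⟨hp⟩
  obtain ⟨f, g, x, y, -, -, hfx, hfy, hgx, hgy⟩ := exists_zmod_homs_of_not_isCyclic hp hpA hA
  have hsurj : Function.Surjective (f.prod g) := by
    rintro ⟨m, n⟩
    refine ⟨x ^ m.toAdd.val * y ^ n.toAdd.val, Prod.ext ?_ ?_⟩ <;>
    · apply Multiplicative.toAdd.injective
      simp [hfx, hfy, hgx, hgy]
  have hcard : (f.prod g).ker.index = p ^ 2 := by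
    rw [Subgroup.index_ker, MonoidHom.range_eq_top.2 hsurj, Subgroup.card_top, Nat.card_prod]
    simp [sq]
  have hle : (powMonoidHom p : A →* A).range ≤ (f.prod g).ker := by
    rintro _ ⟨z, rfl⟩
    rw [MonoidHom.mem_ker]
    ext <;> simp
  rw [card_ker_powMonoidHom, ← hcard]
  exact Nat.le_of_dvd (Nat.pos_of_ne_zero Subgroup.index_ne_zero_of_finite)
    (Subgroup.index_dvd_of_le hle)

theorem card_ker_powMonoidHom_le_of_three_generators {p : ℕ} (hp : p.Prime) {A : Type*}
    [CommGroup A] [Finite A] (u v w : A)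
    (h : ∀ x : A, ∃ i j k : ℤ, x = u ^ i * v ^ j * w ^ k) :
    Nat.card (powMonoidHom p : A →* A).ker ≤ p ^ 3 := by
  have : Fact p.Prime := ⟨hp⟩
  rw [card_ker_powMonoidHom]
  set R := (powMonoidHom p : A →* A).range
  have hR (z : A) (i : ℤ) : (z : A ⧸ R) ^ ((i : ZMod p).val) = (z : A ⧸ R) ^ i := by
    have hz : (z : A ⧸ R) ^ (p : ℤ) = 1 := by
      rw [zpow_natCast, ← QuotientGroup.mk_pow, QuotientGroup.eq_one_iff]
      exact ⟨z, rfl⟩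
    rw [← zpow_natCast, ZMod.val_intCast, ← zpow_eq_zpow_emod _ hz]
  have hsurj : Function.Surjective (fun t : ZMod p × ZMod p × ZMod p =>
      (u : A ⧸ R) ^ t.1.val * (v : A ⧸ R) ^ t.2.1.val * (w : A ⧸ R) ^ t.2.2.val) := by
    intro q
    obtain ⟨x, rfl⟩ := QuotientGroup.mk_surjective q
    obtain ⟨i, j, k, rfl⟩ := h x
    exact ⟨(i, j, k), by simp [hR]⟩
  calc R.index = Nat.card (A ⧸ R) := Subgroup.index_eq_card R
    _ ≤ Nat.card (ZMod p × ZMod p × ZMod p) := Nat.card_le_card_of_surjective _ hsurj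
    _ = p ^ 3 := by simp; ring

section TwoGenerated

open Subgroup

variable {H : Type*} [Group H] {a b c : H}

theorem conj_zpow_eq_of_mul_eq (hc : c ∈ center H) (h : a * b * a⁻¹ = c * b) (j : ℤ) :
    a * b ^ j * a⁻¹ = c ^ j * b ^ j := by
  rw [← conj_zpow, h]
  exact Commute.mul_zpow (mem_center_iff.1 hc b).symm j

theorem exists_eq_zpow_mul_of_closure_pair (hab : closure {a, b} = ⊤) (hc : c ∈ center H)
    (h : a * b * a⁻¹ = c * b) (x : H) : ∃ i j k : ℤ, x = c ^ k * b ^ j * a ^ i := by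
  have hcz (k : ℤ) (y : H) : y * c ^ k = c ^ k * y := mem_center_iff.1 (zpow_mem hc k) y
  have h' : a⁻¹ * b * a⁻¹⁻¹ = c⁻¹ * b := by
    have : b = c⁻¹ * (a * b * a⁻¹) := by rw [h]; group
    have hca : a⁻¹ * c⁻¹ = c⁻¹ * a⁻¹ := by simpa using hcz (-1) a⁻¹
    calc a⁻¹ * b * a⁻¹⁻¹ = a⁻¹ * (c⁻¹ * (a * b * a⁻¹)) * a⁻¹⁻¹ := by rw [← this]
      _ = (a⁻¹ * c⁻¹) * a * b := by group
      _ = c⁻¹ * b := by rw [hca]; group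
  have hx : x ∈ closure {a, b} := hab ▸ mem_top x
  induction hx using closure_induction_left with
  | one => exact ⟨0, 0, 0, by simp⟩
  | mul_left s hs y _ ih =>
    obtain ⟨i, j, k, rfl⟩ := ih
    rcases hs with rfl | rfl
    · refine ⟨i + 1, j, k + j, ?_⟩
      have := conj_zpow_eq_of_mul_eq hc h j
      calc s * (c ^ k * b ^ j * s ^ i) = (s * c ^ k) * b ^ j * s ^ i := by group
        _ = c ^ k * (s * b ^ j * s⁻¹) * s ^ (i + 1) := by rw [hcz]; group
        _ = _ := by rw [this, zpow_add c]; group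
    · refine ⟨i, j + 1, k, ?_⟩
      rw [mul_assoc, ← mul_assoc, hcz]; group
  | inv_mul_cancel s hs y _ ih =>
    obtain ⟨i, j, k, rfl⟩ := ih
    rcases hs with rfl | rfl
    · refine ⟨i - 1, j, k - j, ?_⟩
      have := conj_zpow_eq_of_mul_eq (inv_mem hc) h' j
      calc s⁻¹ * (c ^ k * b ^ j * s ^ i) = (s⁻¹ * c ^ k) * b ^ j * s ^ i := by group
        _ = c ^ k * (s⁻¹ * b ^ j * s⁻¹⁻¹) * s ^ (i - 1) := by rw [hcz]; group
        _ = _ := by rw [this, sub_eq_add_neg k, zpow_add c]; group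
    · refine ⟨i, j - 1, k, ?_⟩
      rw [mul_assoc, ← mul_assoc, hcz]; group

theorem mem_center_of_closure_pair (hab : closure {a, b} = ⊤) {x : H} (hxa : Commute a x)
    (hxb : Commute b x) : x ∈ center H := by
  have : closure {a, b} ≤ centralizer {x} := by
    rw [closure_le]
    rintro y (rfl | rfl) <;> rw [SetLike.mem_coe, mem_centralizer_singleton_iff]
    exacts [hxa, hxb]
  rw [hab] at this
  exact mem_center_iff.2 fun y => mem_centralizer_singleton_iff.1 (this (mem_top y))

/-- The center of a two-generated group of class at most two is generated by three elements. -/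
theorem exists_three_generators_center (hab : closure {a, b} = ⊤) (hc : c ∈ center H)
    (h : a * b * a⁻¹ = c * b) : ∃ u v w : center H, ∀ x : center H, ∃ i j k : ℤ,
      x = u ^ i * v ^ j * w ^ k := by
  have hcz (k : ℤ) (y : H) : y * c ^ k = c ^ k * y := mem_center_iff.1 (zpow_mem hc k) y
  have h' : b * a * b⁻¹ = c⁻¹ * a := by
    have hb : b * a = c⁻¹ * (a * b) := by
      rw [eq_inv_mul_iff_mul_eq, ← mul_assoc, ← h]; group
    rw [hb]; group
  have hconj (j : ℤ) := conj_zpow_eq_of_mul_eq hc h j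
  have hconj' (i : ℤ) := conj_zpow_eq_of_mul_eq (inv_mem hc) h' i
  set n := orderOf c with hn
  have hcn : c ^ (n : ℤ) = 1 := by rw [zpow_natCast]; exact pow_orderOf_eq_one c
  have ha : a ^ (n : ℤ) ∈ center H := by
    refine mem_center_of_closure_pair hab ((Commute.refl a).zpow_right _) ?_
    have := hconj' n
    rwa [inv_zpow, hcn, inv_one, one_mul, mul_inv_eq_iff_eq_mul] at this
  have hb : b ^ (n : ℤ) ∈ center H := by
    refine mem_center_of_closure_pair hab ?_ ((Commute.refl b).zpow_right _)
    have := hconj n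
    rwa [hcn, one_mul, mul_inv_eq_iff_eq_mul] at this
  refine ⟨⟨c, hc⟩, ⟨_, hb⟩, ⟨_, ha⟩, ?_⟩
  rintro ⟨x, hx⟩
  obtain ⟨i, j, k, rfl⟩ := exists_eq_zpow_mul_of_closure_pair hab hc h x
  have hj : c ^ j = 1 := by
    have h1 := mem_center_iff.1 hx a
    have h2 : a * b ^ j * a⁻¹ = b ^ j := by
      have h3 : c ^ k * (a * b ^ j) * a ^ i = c ^ k * (b ^ j * a) * a ^ i := by
        calc c ^ k * (a * b ^ j) * a ^ i = (c ^ k * a) * b ^ j * a ^ i := by group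
          _ = a * (c ^ k * b ^ j * a ^ i) := by rw [← hcz]; group
          _ = _ := by rw [h1]; group
      rw [mul_inv_eq_iff_eq_mul]
      exact mul_left_cancel (mul_right_cancel h3)
    rw [hconj] at h2
    exact mul_eq_right.1 h2
  have hi : c ^ i = 1 := by
    have h1 := mem_center_iff.1 hx b
    have h2 : b * a ^ i * b⁻¹ = a ^ i := by
      have h3 : (c ^ k * b ^ j) * (b * a ^ i) = (c ^ k * b ^ j) * (a ^ i * b) := by
        calc (c ^ k * b ^ j) * (b * a ^ i) = (c ^ k * b) * b ^ j * a ^ i := by group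
          _ = b * (c ^ k * b ^ j * a ^ i) := by rw [← hcz]; group
          _ = _ := by rw [h1]; group
      rw [mul_inv_eq_iff_eq_mul]
      exact mul_left_cancel h3
    rw [hconj'] at h2
    simpa using mul_eq_right.1 h2
  obtain ⟨j, rfl⟩ := orderOf_dvd_iff_zpow_eq_one.2 hj
  obtain ⟨i, rfl⟩ := orderOf_dvd_iff_zpow_eq_one.2 hi
  refine ⟨k, j, i, Subtype.ext ?_⟩
  simp only [coe_mul, coe_zpow, zpow_mul, hn]

end TwoGenerated

section CentralAutomorphism

open Subgroup

variable {G : Type*} [Group G]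

/-- The automorphism `x ↦ x * φ x` attached to a homomorphism `φ` into the center that is trivial
on its own values. -/
def centralAut (φ : G →* center G) (hφ : ∀ x, φ (φ x : G) = 1) : MulAut G where
  toFun x := x * φ x
  invFun x := x * (φ x : G)⁻¹
  left_inv x := by simp [hφ]
  right_inv x := by simp [hφ]
  map_mul' x y := by
    have := mem_center_iff.1 (φ x).2 y
    simp only [map_mul, coe_mul]
    rw [mul_assoc, ← mul_assoc y, this]
    group

variable {φ : G →* center G} (hφ : ∀ x, φ (φ x : G) = 1)

theorem centralAut_apply (x : G) : centralAut φ hφ x = x * φ x := rfl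

theorem centralAut_pow_apply (n : ℕ) (x : G) : (centralAut φ hφ ^ n) x = x * φ x ^ n := by
  induction n with
  | zero => simp
  | succ n ih =>
    rw [pow_succ', MulAut.mul_apply, ih, centralAut_apply]
    simp [hφ, pow_succ, mul_assoc]

theorem centralAut_pow_eq_one {p : ℕ} (h : ∀ x, φ x ^ p = 1) : centralAut φ hφ ^ p = 1 := by
  ext x
  rw [centralAut_pow_apply, ← coe_pow, h]
  simp

theorem orderOf_centralAut {p : ℕ} (hp : p.Prime) (h : ∀ x, φ x ^ p = 1) {x : G}
    (hx : φ x ≠ 1) : orderOf (centralAut φ hφ) = p := by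
  have : Fact p.Prime := ⟨hp⟩
  refine orderOf_eq_prime (centralAut_pow_eq_one hφ h) fun h1 => hx ?_
  have := centralAut_apply hφ x
  rw [h1, MulAut.one_apply, left_eq_mul] at this
  exact_mod_cast this

/-- If `centralAut φ` is conjugation by `h`, then `h` is central modulo the center, and
`h ^ p` is central when `φ` has values of exponent `p`. -/
theorem mk_mem_center_of_centralAut_eq_conj {p : ℕ} (hp : ∀ x, φ x ^ p = 1) {h : G}
    (hh : ∀ x, centralAut φ hφ x = h⁻¹ * x * h) :
    (h : G ⧸ center G) ∈ center (G ⧸ center G) ∧ (h : G ⧸ center G) ^ p = 1 := by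
  constructor
  · rw [mem_center_iff]
    intro q
    obtain ⟨x, rfl⟩ := QuotientGroup.mk_surjective q
    rw [← QuotientGroup.mk_mul, ← QuotientGroup.mk_mul, eq_comm, QuotientGroup.eq]
    have : (h * x)⁻¹ * (x * h) = φ x := by
      have := hh x
      rw [centralAut_apply] at this
      calc (h * x)⁻¹ * (x * h) = x⁻¹ * (h⁻¹ * x * h) := by group
        _ = _ := by rw [← this]; group
    rw [this]
    exact (φ x).2
  · have hconj : centralAut φ hφ = MulAut.conj h⁻¹ := by
      ext x
      simp [hh]
    have h1 := centralAut_pow_eq_one hφ hp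
    rw [hconj, ← map_pow] at h1
    rw [← QuotientGroup.mk_pow, QuotientGroup.eq_one_iff, ← inv_mem_iff, ← inv_pow,
      mem_center_iff]
    intro x
    have := DFunLike.congr_fun h1 x
    rw [MulAut.conj_apply, MulAut.one_apply, mul_inv_eq_iff_eq_mul] at this
    exact this.symm

end CentralAutomorphism

section Frattini

open Subgroup
open scoped IsMulCommutative

variable {p : ℕ} {G : Type*} [Group G] [Finite G] [Group.IsNilpotent G]

theorem exists_noninner_of_not_center_le_frattini (hp : p.Prime) (hpG : IsPGroup p G)
    (hZ : ¬ IsCyclic (center G)) (hle : ¬ center G ≤ frattini G) :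
    ∃ α : MulAut G, orderOf α = p ∧ (∀ x ∈ frattini G, α x = x) ∧
      ¬ ∃ h : G, ∀ x : G, α x = h⁻¹ * x * h := by
  have : Fact p.Prime := ⟨hp⟩
  obtain ⟨M, hM, z, hz, hzM⟩ : ∃ M : Subgroup G, IsCoatom M ∧ ∃ z ∈ center G, z ∉ M := by
    by_contra! h
    exact hle (le_iInf₂ fun M hM z hz => h M hM z hz)
  obtain ⟨f, hf, hfz⟩ := exists_zmod_hom_of_isCoatom hp hpG hM hzM
  obtain ⟨u, hup, hfu, hu1⟩ : ∃ u : center G, u ^ p = 1 ∧ f u = 1 ∧ u ≠ 1 := by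
    let g := (f.comp (center G).subtype).comp (powMonoidHom p : center G →* center G).ker.subtype
    have hg : ¬ Function.Injective g := fun hg => by
      have h1 := Nat.card_le_card_of_injective g hg
      have h2 := sq_le_card_ker_powMonoidHom hp (hpG.to_subgroup (center G)) hZ
      have h3 : Nat.card (Multiplicative (ZMod p)) = p := by simp
      nlinarith [hp.two_le]
    rw [injective_iff_map_eq_one] at hg
    push Not at hg
    obtain ⟨⟨u, hu⟩, hgu, hu1⟩ := hg
    exact ⟨u, hu, hgu, fun h => hu1 (Subtype.ext h)⟩
  let φ : G →* center G := (zmodPowHom u hup).comp f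
  have hφ_apply (x : G) : φ x = u ^ (f x).toAdd.val := rfl
  have hφ (x : G) : φ (φ x : G) = 1 := by simp [hφ_apply, hfu]
  have hφp (x : G) : φ x ^ p = 1 := by rw [hφ_apply, ← pow_mul, mul_comm, pow_mul, hup, one_pow]
  have hφz : φ z ≠ 1 := by simpa [hφ_apply, hfz, ZMod.val_one]
  refine ⟨centralAut φ hφ, orderOf_centralAut hφ hp hφp hφz, fun x hx => ?_, ?_⟩
  · have : f x = 1 := f.mem_ker.1 (hf ▸ frattini_le_coatom hM hx)
    simp [centralAut_apply, hφ_apply, this]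
  · rintro ⟨h, hh⟩
    have h1 := hh z
    rw [mul_assoc, ← mem_center_iff.1 hz h, inv_mul_cancel_left, centralAut_apply,
      mul_eq_left] at h1
    exact hφz (by exact_mod_cast h1)

theorem card_sq_le_of_forall_conj (hp : p.Prime) (hpG : IsPGroup p G) (hG : ¬ IsCyclic G)
    (hle : center G ≤ frattini G)
    (hinner : ∀ α : MulAut G, orderOf α = p → (∀ x ∈ frattini G, α x = x) →
      ∃ h : G, ∀ x : G, α x = h⁻¹ * x * h) :
    Nat.card (powMonoidHom p : center G →* center G).ker ^ 2 ≤
      Nat.card (powMonoidHom p : center (G ⧸ center G) →* center (G ⧸ center G)).ker := by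
  have : Fact p.Prime := ⟨hp⟩
  obtain ⟨f, g, x, y, hf, hg, hfx, hfy, hgx, hgy⟩ := exists_zmod_homs_of_not_isCyclic hp hpG hG
  let Ω := (powMonoidHom p : center G →* center G).ker
  let φ (t : Ω × Ω) : G →* center G :=
    (zmodPowHom (t.1 : center G) t.1.2).comp f * (zmodPowHom (t.2 : center G) t.2.2).comp g
  have hφ_apply (t : Ω × Ω) (x : G) :
      φ t x = (t.1 : center G) ^ (f x).toAdd.val * (t.2 : center G) ^ (g x).toAdd.val := rfl
  have hΩ (u : Ω) : (u : center G) ^ p = 1 := u.2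
  have hφx (t : Ω × Ω) : φ t x = t.1 := by simp [hφ_apply, hfx, hgx, ZMod.val_one]
  have hφy (t : Ω × Ω) : φ t y = t.2 := by simp [hφ_apply, hfy, hgy, ZMod.val_one]
  have hφp (t : Ω × Ω) (x : G) : φ t x ^ p = 1 := by
    rw [hφ_apply, mul_pow, pow_right_comm, hΩ, pow_right_comm, hΩ, one_pow, one_pow, one_mul]
  have hφfr (t : Ω × Ω) {x : G} (hx : x ∈ frattini G) : φ t x = 1 := by
    have h1 : f x = 1 := f.mem_ker.1 (frattini_le_coatom hf hx)
    have h2 : g x = 1 := g.mem_ker.1 (frattini_le_coatom hg hx)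
    simp [hφ_apply, h1, h2]
  have hφ (t : Ω × Ω) (x : G) : φ t (φ t x : G) = 1 := hφfr t (hle (φ t x).2)
  have hconj (t : Ω × Ω) : ∃ h : G, ∀ x : G, centralAut (φ t) (hφ t) x = h⁻¹ * x * h := by
    by_cases ht : ∀ x, φ t x = 1
    · exact ⟨1, fun x => by simp [centralAut_apply, ht]⟩
    · push Not at ht
      obtain ⟨x, hx⟩ := ht
      exact hinner _ (orderOf_centralAut _ hp (hφp t) hx)
        fun y hy => by simp [centralAut_apply, hφfr t hy]
  choose h hh using hconj
  have hmem (t : Ω × Ω) := mk_mem_center_of_centralAut_eq_conj (hφ t) (hφp t) (hh t)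
  let F (t : Ω × Ω) : (powMonoidHom p : center (G ⧸ center G) →* center (G ⧸ center G)).ker :=
    ⟨⟨(h t : G ⧸ center G), (hmem t).1⟩, Subtype.ext (hmem t).2⟩
  have hF : Function.Injective F := by
    intro s t hst
    have hmk : (h s : G ⧸ center G) = h t :=
      congrArg Subtype.val (congrArg Subtype.val hst)
    rw [QuotientGroup.eq] at hmk
    have hφst (x : G) : φ s x = φ t x := by
      have h1 : (h s)⁻¹ * x * h s = (h t)⁻¹ * x * h t := by
        have h2 := mem_center_iff.1 hmk ((h s)⁻¹ * x * h s)
        calc (h s)⁻¹ * x * h s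
            = ((h s)⁻¹ * h t)⁻¹ * (((h s)⁻¹ * h t) * ((h s)⁻¹ * x * h s)) := by group
          _ = (h t)⁻¹ * x * h t := by rw [← h2]; group
      rw [← hh, ← hh, centralAut_apply, centralAut_apply, mul_right_inj] at h1
      exact_mod_cast h1
    refine Prod.ext (Subtype.ext ?_) (Subtype.ext ?_)
    · rw [← hφx, ← hφx, hφst]
    · rw [← hφy, ← hφy, hφst]
  have := Nat.card_le_card_of_injective F hF
  rwa [Nat.card_prod, ← sq] at this

end Frattini

/-- Let `G` be a finite `p`-group of nilpotency class 3 such that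
`G/Z(G)` is 2-generated and `Z(G)` is not cyclic. Then `G` has a noninner
automorphism of order `p` fixing `Φ(G)` elementwise. -/
theorem stmt10 {p : ℕ} (hp : p.Prime) (G : Type*) [Group G] [Finite G]
    [Group.IsNilpotent G] (hpG : IsPGroup p G)
    (hclass : Group.nilpotencyClass G = 3)
    (hgen : ∃ a b : G ⧸ Subgroup.center G, Subgroup.closure {a, b} = ⊤)
    (hZ : ¬ IsCyclic (Subgroup.center G)) :
    ∃ α : MulAut G, orderOf α = p ∧ (∀ x ∈ frattini G, α x = x) ∧
      ¬ ∃ h : G, ∀ x : G, α x = h⁻¹ * x * h := by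
  open scoped IsMulCommutative in
  by_cases hle : Subgroup.center G ≤ frattini G
  · by_contra! hinner
    have hG : ¬ IsCyclic G := fun _ => hZ inferInstance
    have h1 := card_sq_le_of_forall_conj hp hpG hG hle hinner
    have h2 := sq_le_card_ker_powMonoidHom hp (hpG.to_subgroup (Subgroup.center G)) hZ
    obtain ⟨a, b, hab⟩ := hgen
    have hc : a * b * a⁻¹ * b⁻¹ ∈ Subgroup.center (G ⧸ Subgroup.center G) := by
      have hQ : Group.nilpotencyClass (G ⧸ Subgroup.center G) = 2 := by
        rw [Group.nilpotencyClass_quotient_center, hclass]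
      have h3 := Subgroup.upperCentralSeries_nilpotencyClass (G := G ⧸ Subgroup.center G)
      rw [hQ] at h3
      have h4 : a ∈ Subgroup.upperCentralSeries (G ⧸ Subgroup.center G) 2 :=
        h3 ▸ Subgroup.mem_top a
      rw [Subgroup.mem_upperCentralSeries_succ_iff] at h4
      simpa [commutatorElement_def] using h4 b
    obtain ⟨u, v, w, huvw⟩ := exists_three_generators_center hab hc (by group)
    have h5 := card_ker_powMonoidHom_le_of_three_generators hp u v w huvw
    have h6 : (p ^ 2) ^ 2 ≤ p ^ 3 := ((Nat.pow_le_pow_left h2 2).trans h1).trans h5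
    rw [← pow_mul] at h6
    exact absurd ((Nat.pow_le_pow_iff_right hp.one_lt).1 h6) (by norm_num)
  · exact exists_noninner_of_not_center_le_frattini hp hpG hZ hle
end

section
/- Let p be a prime with p > 3 and let G be a finite p-group such that G/Z(G) is p-central, i.e., every element of order p in G/Z(G) lies in the center of G/Z(G). Let A be a normal abelian subgroup of G, let a ∈ A, and let g ∈ G be such that g^p commutes with every element of A. Then the product ∏_{i=0}^{p−1} g^{−i} a g^{i} equals a^p. (Since all factors lie in the abelian group A, the product does not depend on the order of the factors.) -/
/-- A geometric sum with ratio `d + 1` in a ring, expanded in powers of `d` up to order three, when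
the number of terms is a prime `p > 3`. -/
theorem exists_geom_sum_add_one_eq {R : Type*} [Ring R] {p : ℕ} (hp : p.Prime) (hp3 : 3 < p)
    (d : R) : ∃ (c e : ℕ) (h : R),
      ∑ i ∈ Finset.range p, (d + 1) ^ i = p + (c * p : ℕ) * d + (e * p : ℕ) * d ^ 2 + h * d ^ 3 := by
  have key := congrArg (Polynomial.aeval d) (Polynomial.geom_sum_X_comp_X_add_one_eq_sum (R := ℤ) p)
  rw [Polynomial.aeval_comp] at key
  simp only [map_sum, map_mul, map_pow, map_add, map_one, Polynomial.aeval_X, map_natCast] at key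
  obtain ⟨c, hc⟩ := hp.dvd_choose_self (k := 2) (by norm_num) (by lia)
  obtain ⟨e, he⟩ := hp.dvd_choose_self (k := 3) (by norm_num) hp3
  refine ⟨c, e, ∑ i ∈ Finset.range (p - 3), (p.choose (i + 4) : R) * d ^ i, ?_⟩
  rw [key, mul_comm c, mul_comm e, ← hc, ← he]
  obtain ⟨k, hk⟩ : ∃ k, p = k + 3 := ⟨p - 3, by lia⟩
  rw [show Finset.range p = Finset.range (k + 3) by rw [hk], show p - 3 = k by lia,
    Finset.sum_range_succ', Finset.sum_range_succ', Finset.sum_range_succ', Finset.sum_mul]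
  simp only [mul_assoc, ← pow_add, zero_add, pow_zero, pow_one, mul_one, Nat.choose_one_right,
    Nat.reduceAdd, add_assoc]
  abel

/-- The norm of an automorphism `d + 1` with `(d + 1) ^ p = 1`, `p > 3`, of a `p`-primary abelian group is
multiplication by `p`, if `d` kills a subgroup `Z` and maps the elements of order `p` modulo `Z`
into `Z`. -/
theorem geom_sum_add_one_apply_eq_nsmul {M : Type*} [AddCommGroup M] {p : ℕ} (hp : p.Prime)
    (hp3 : 3 < p) (d : AddMonoid.End M) (Z : AddSubgroup M) (hZ : ∀ z ∈ Z, d z = 0)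
    (hpZ : ∀ x, p • x ∈ Z → d x ∈ Z) (hd : (d + 1) ^ p = 1)
    (htors : ∀ x : M, ∃ m : ℕ, p ^ m • x = 0) (a : M) : (∑ i ∈ Finset.range p, (d + 1) ^ i) a = p • a := by
  obtain ⟨c, e, h, hN⟩ := exists_geom_sum_add_one_eq hp hp3 d
  have hmul : (∑ i ∈ Finset.range p, (d + 1) ^ i) * d = 0 := by
    have := geom_sum_mul (d + 1) p
    rwa [hd, sub_self, add_sub_cancel_right] at this
  have hexp (x : M) : (∑ i ∈ Finset.range p, (d + 1) ^ i) x =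
      p • x + c • p • d x + e • p • d (d x) + h (d (d (d x))) := by
    rw [hN, pow_succ d 2, pow_two, ← mul_smul, ← mul_smul]
    rfl
  have hzero : p • d a + c • p • d (d a) + e • p • d (d (d a)) + h (d (d (d (d a)))) = 0 := by
    rw [← hexp]
    exact DFunLike.congr_fun hmul a
  have hstep (m : ℕ) (hm : p ^ (m + 2) • d a ∈ Z) : p ^ (m + 1) • d a ∈ Z := by
    have h1 : p ^ (m + 1) • d (d a) ∈ Z := by
      rw [← map_nsmul]
      exact hpZ _ (by rwa [← mul_smul, ← pow_succ'])
    have h2 : p ^ m • d (d (d a)) ∈ Z := by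
      rw [← map_nsmul]
      exact hpZ _ (by rwa [← mul_smul, ← pow_succ'])
    have h3 : p ^ m • d (d (d (d a))) = 0 := by
      rw [← map_nsmul]
      exact hZ _ h2
    have hsum : p ^ (m + 1) • d a + c • p ^ (m + 1) • d (d a) +
        (e * p) • p ^ m • d (d (d a)) = 0 := by
      have := congrArg (p ^ m • ·) hzero
      simp only [smul_add, smul_zero, ← map_nsmul h, h3, map_zero, add_zero] at this
      rw [← this]
      module
    rw [add_assoc] at hsum
    rw [eq_neg_of_add_eq_zero_left hsum]
    exact neg_mem (add_mem (nsmul_mem h1 _) (nsmul_mem h2 _))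
  have hbase : p • d a ∈ Z := by
    obtain ⟨m, hm⟩ := htors (d a)
    have hdesc (n : ℕ) : p ^ (n + 1) • d a ∈ Z → p • d a ∈ Z := by
      induction n with
      | zero => simp
      | succ n ih => exact fun hn => ih (hstep n hn)
    refine hdesc m ?_
    rw [pow_succ', mul_smul, hm, smul_zero]
    exact zero_mem Z
  have hd3 : d (d (d a)) = 0 := hZ _ (hpZ _ hbase)
  have hpd2 : p • d (d a) = 0 := by
    rw [← map_nsmul]
    exact hZ _ hbase
  have hpd : p • d a = 0 := by simpa [hd3, hpd2] using hzero
  simp [hexp, hd3, hpd2, hpd]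

/-- Let `p > 3` be prime and `G` a finite `p`-group with `G/Z(G)`
`p`-central. If `A` is a normal abelian subgroup of `G`, `a ∈ A` and `g ∈ G` with
`g ^ p ∈ C_G(A)`, then `∏_{i=0}^{p-1} g⁻ⁱ a gⁱ = a ^ p`. -/
theorem stmt11 {p : ℕ} (hp : p.Prime) (hp3 : 3 < p) (G : Type*) [Group G] [Finite G]
    (hpG : IsPGroup p G)
    (hcent : ∀ x : G ⧸ Subgroup.center G, x ^ p = 1 →
      x ∈ Subgroup.center (G ⧸ Subgroup.center G))
    (A : Subgroup G) (hA : A.Normal) (habel : ∀ x ∈ A, ∀ y ∈ A, x * y = y * x)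
    (a : G) (ha : a ∈ A) (g : G) (hg : ∀ x ∈ A, g ^ p * x = x * g ^ p) :
    ((List.range p).map fun i => (g ^ i)⁻¹ * a * g ^ i).prod = a ^ p := by
  let : CommGroup A :=
    { (inferInstance : Group A) with
      mul_comm := fun x y => Subtype.ext (habel x x.2 y y.2) }
  let t : AddMonoid.End (Additive A) :=
    MonoidHom.toAdditive (MulAut.conjNormal g⁻¹ : A ≃* A).toMonoidHom
  have ht (x : Additive A) : ((t x).toMul : G) = g⁻¹ * (x.toMul : G) * g := by
    change ((MulAut.conjNormal g⁻¹ x.toMul : A) : G) = _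
    simp
  have htpow (i : ℕ) (x : Additive A) :
      (((t ^ i) x).toMul : G) = (g ^ i)⁻¹ * (x.toMul : G) * g ^ i := by
    induction i with
    | zero => simp
    | succ i ih =>
      rw [pow_succ' t, show (t * t ^ i) x = t ((t ^ i) x) from rfl, ht, ih]
      simp only [pow_succ, mul_inv_rev, mul_assoc]
  have hsub (x : Additive A) :
      (((t - 1) x).toMul : G) = g⁻¹ * (x.toMul : G) * g * (x.toMul : G)⁻¹ := by
    have h1 : (t - 1) x = t x - x := rfl
    rw [h1, toMul_sub, Subgroup.coe_div, ht, div_eq_mul_inv]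
  have key := geom_sum_add_one_apply_eq_nsmul hp hp3 (t - 1)
    (((Subgroup.center G).subgroupOf A).toAddSubgroup) ?_ ?_ ?_ ?_ (Additive.ofMul ⟨a, ha⟩)
  · rw [sub_add_cancel] at key
    have hprod (n : ℕ) : (((∑ i ∈ Finset.range n, t ^ i) (Additive.ofMul ⟨a, ha⟩)).toMul : G) =
        ((List.range n).map fun i => (g ^ i)⁻¹ * a * g ^ i).prod := by
      induction n with
      | zero => rfl
      | succ n ih =>
        rw [Finset.sum_range_succ, List.range_succ, List.map_append, List.prod_append, ← ih,
          List.map_singleton, List.prod_singleton]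
        exact congrArg _ (htpow n (Additive.ofMul ⟨a, ha⟩))
    rw [← hprod, key]
    rfl
  · intro z hz
    have hz' : (z.toMul : G) ∈ Subgroup.center G := hz
    apply Additive.toMul.injective
    apply Subtype.ext
    rw [hsub, mul_assoc g⁻¹, ← Subgroup.mem_center_iff.mp hz' g]
    simp
  · intro x hx
    have hx' : (x.toMul : G) ^ p ∈ Subgroup.center G := hx
    have h1 := hcent (x.toMul : G) (by
      rw [← QuotientGroup.mk_pow]
      exact (QuotientGroup.eq_one_iff _).mpr hx')
    have h2 := Subgroup.mem_center_iff.mp h1 (g : G ⧸ Subgroup.center G)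
    change (((t - 1) x).toMul : G) ∈ Subgroup.center G
    rw [hsub, ← QuotientGroup.eq_one_iff]
    simp only [QuotientGroup.mk_mul, QuotientGroup.mk_inv]
    rw [mul_assoc (g : G ⧸ Subgroup.center G)⁻¹, ← h2]
    simp
  · rw [sub_add_cancel]
    ext x
    change (((t ^ p) x).toMul : G) = (x.toMul : G)
    rw [htpow, mul_assoc, ← hg _ x.toMul.2]
    simp
  · intro x
    obtain ⟨m, hm⟩ := hpG (x.toMul : G)
    exact ⟨m, Additive.toMul.injective (Subtype.ext hm)⟩
end

section
/- Let G be a finite 3-group such that G/Z(G) is 3-central, i.e., every element of order 3 in G/Z(G) lies in the center of G/Z(G). Let A be a normal abelian subgroup of G, let a ∈ A, and let g ∈ G be such that g³ commutes with every element of A. Then there exists a central element z ∈ Z(G) such that a · (g⁻¹ a g) · (g⁻² a g²) = a³ z. -/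
/-- If `D` maps elements killed by `3` modulo `Z` into `Z`, then it lowers the `3`-power exponent
modulo `Z`. -/
theorem pow_smul_map_mem_of_pow_succ_smul_mem {M : Type*} [AddCommGroup M] (D : M →+ M)
    (Z : AddSubgroup M) (hD : ∀ x, 3 • x ∈ Z → D x ∈ Z) {k : ℕ} {x : M}
    (hx : 3 ^ (k + 1) • x ∈ Z) : 3 ^ k • D x ∈ Z := by
  rw [← map_nsmul]
  apply hD
  rwa [← mul_nsmul', ← pow_succ']

theorem three_smul_mem_of_pow_smul_mem {M : Type*} [AddCommGroup M] (D : M →+ M)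
    (Z : AddSubgroup M) (hD : ∀ x, 3 • x ∈ Z → D x ∈ Z) {y : M}
    (hy : 3 • y + 3 • D y + D (D y) ∈ Z) (k : ℕ) (hk : 3 ^ (k + 1) • y ∈ Z) :
    3 • y ∈ Z := by
  induction k with
  | zero => simpa using hk
  | succ k ih =>
    apply ih
    have h1 := pow_smul_map_mem_of_pow_succ_smul_mem D Z hD hk
    have h2 := pow_smul_map_mem_of_pow_succ_smul_mem D Z hD h1
    have h3 := Z.sub_mem (Z.sub_mem (Z.nsmul_mem hy (3 ^ k)) h1) h2
    convert h3 using 1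
    rw [pow_succ]
    module

theorem map_map_add_map_sub_mem {M : Type*} [AddCommGroup M] (φ : M →+ M)
    (Z : AddSubgroup M) (hφ : ∀ x, φ (φ (φ x)) = x) (hZ : ∀ x, 3 • x ∈ Z → φ x - x ∈ Z)
    (htors : ∀ x : M, ∃ k : ℕ, 3 ^ k • x = 0) (a : M) :
    φ (φ a) + φ a - 2 • a ∈ Z := by
  let D : M →+ M := φ - AddMonoidHom.id M
  have hDx (x : M) : D x = φ x - x := rfl
  obtain ⟨k, hk⟩ := htors (D a)
  have hy : 3 • D a + 3 • D (D a) + D (D (D a)) ∈ Z := by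
    convert Z.zero_mem
    simp only [hDx, map_sub, hφ]
    module
  have h3 := three_smul_mem_of_pow_smul_mem D Z hZ hy k
    (by rw [pow_succ', mul_nsmul', hk, smul_zero]; exact Z.zero_mem)
  convert Z.add_mem h3 (hZ _ h3) using 1
  simp only [hDx, map_sub]
  module

/-- An element whose cube is central has central commutators when `G ⧸ Z(G)` is `3`-central. -/
theorem conj_mul_inv_mem_center {G : Type*} [Group G]
    (hcent : ∀ x : G ⧸ Subgroup.center G, x ^ 3 = 1 →
      x ∈ Subgroup.center (G ⧸ Subgroup.center G))
    {x : G} (hx : x ^ 3 ∈ Subgroup.center G) (g : G) :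
    g⁻¹ * x * g * x⁻¹ ∈ Subgroup.center G := by
  have h := hcent (x : G ⧸ Subgroup.center G) (by
    rw [← QuotientGroup.mk_pow]
    exact (QuotientGroup.eq_one_iff _).2 hx)
  rw [← QuotientGroup.eq_one_iff]
  have hg := Subgroup.mem_center_iff.1 h (g : G ⧸ Subgroup.center G)
  simp only [QuotientGroup.mk_mul, QuotientGroup.mk_inv]
  rw [mul_assoc (_⁻¹) _ _, ← hg]
  group


/-- Let `G` be a finite `3`-group with `G/Z(G)` `3`-central. If `A`
is a normal abelian subgroup of `G`, `a ∈ A` and `g ∈ G` with `g ^ 3 ∈ C_G(A)`,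
then `a * (g⁻¹ * a * g) * ((g ^ 2)⁻¹ * a * g ^ 2) = a ^ 3 * z` for some central
`z`. -/
theorem stmt12 (G : Type*) [Group G] [Finite G]
    (hpG : IsPGroup 3 G)
    (hcent : ∀ x : G ⧸ Subgroup.center G, x ^ 3 = 1 →
      x ∈ Subgroup.center (G ⧸ Subgroup.center G))
    (A : Subgroup G) (hA : A.Normal) (habel : ∀ x ∈ A, ∀ y ∈ A, x * y = y * x)
    (a : G) (ha : a ∈ A) (g : G) (hg : ∀ x ∈ A, g ^ 3 * x = x * g ^ 3) :
    ∃ z ∈ Subgroup.center G,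
      a * (g⁻¹ * a * g) * ((g ^ 2)⁻¹ * a * g ^ 2) = a ^ 3 * z := by
  let _ : CommGroup A := { (inferInstance : Group A) with
    mul_comm := fun x y => Subtype.ext (habel x x.2 y y.2) }
  let φ : Additive A →+ Additive A :=
    MonoidHom.toAdditive (MulAut.conjNormal (H := A) g⁻¹).toMonoidHom
  let Z : AddSubgroup (Additive A) :=
    Subgroup.toAddSubgroup ((Subgroup.center G).subgroupOf A)
  have hφ (x : A) : ((φ (Additive.ofMul x)).toMul : G) = g⁻¹ * x * g := by
    simp [φ]
  let b : Additive A := Additive.ofMul ⟨a, ha⟩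
  have key := map_map_add_map_sub_mem φ Z ?_ ?_ ?_ b
  · set z : A := (φ (φ b) + φ b - 2 • b).toMul with hz
    refine ⟨z, key, ?_⟩
    have hsum : b.toMul * (φ b).toMul * (φ (φ b)).toMul = b.toMul ^ 3 * z := by
      apply Additive.ofMul.injective
      simp only [hz, ofMul_mul, ofMul_pow, ofMul_toMul]
      module
    have hval := congrArg (Subtype.val : A → G) hsum
    have h2 := hφ (φ b).toMul
    have h1 : ((φ b).toMul : G) = g⁻¹ * a * g := hφ ⟨a, ha⟩
    have h0 : (b.toMul : G) = a := rfl
    simp only [ofMul_toMul] at h2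
    simp only [Subgroup.coe_mul, Subgroup.coe_pow, h2, h1, h0] at hval
    rw [← hval]
    simp only [pow_two, mul_inv_rev, mul_assoc]
  · intro x
    apply Additive.toMul.injective
    apply Subtype.ext
    have h1 := hφ x.toMul
    have h2 := hφ (φ x).toMul
    have h3 := hφ (φ (φ x)).toMul
    simp only [ofMul_toMul] at h1 h2 h3
    rw [h3, h2, h1]
    have hx := hg x.toMul x.toMul.2
    calc _ = (g ^ 3)⁻¹ * (x.toMul * g ^ 3) := by
          simp only [pow_succ, pow_zero, one_mul, mul_inv_rev, mul_assoc]
      _ = _ := by rw [← hx, inv_mul_cancel_left]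
  · intro x hx
    have h := conj_mul_inv_mem_center hcent (x := (x.toMul : G)) hx g
    rw [← hφ, ofMul_toMul, ← div_eq_mul_inv] at h
    exact h
  · intro x
    obtain ⟨k, hk⟩ := hpG (x.toMul : G)
    exact ⟨k, Additive.toMul.injective (Subtype.ext hk)⟩
end

section
/- Let p be a prime, let G be a finite p-group of nilpotency class at most 2, and let N be a nontrivial normal subgroup of G such that the quotient G/N is not cyclic. Then there exists a map f : G → G such that: (i) for every g ∈ G, f(g) lies in Z(N) = {n ∈ N : n commutes with every element of N}; (ii) f(xy) = (y⁻¹ f(x) y) · f(y) for all x, y ∈ G; (iii) f(n) = 1 for all n ∈ N; and (iv) there is no a ∈ Z(N) with f(g) = a⁻¹ · (g⁻¹ a g) for all g ∈ G. (This expresses that the first cohomology H¹(G/N, Z(N)) of the quotient G/N acting on Z(N) by conjugation is nonzero; it is the n = 1 instance of the paper's conclusion that the Tate cohomology Hⁿ(G/N, Z(N)) ≠ 0 for all n ≥ 0.) -/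
namespace IsPGroup

variable {p : ℕ} [Fact p.Prime] {Q : Type*} [Group Q] [Finite Q]

lemma index_eq_of_isCoatom (hQ : IsPGroup p Q) {M : Subgroup Q} (hM : IsCoatom M) :
    M.index = p := by
  obtain ⟨m, hm⟩ := iff_card.1 (hQ.to_subgroup M)
  obtain ⟨k, hk⟩ := hQ.index M
  have hcard := M.card_mul_index
  obtain _ | k := k
  · exact absurd (Subgroup.index_eq_one.1 (by simpa using hk)) hM.1
  have hdvd : p ^ (m + 1) ∣ Nat.card Q := by
    rw [← hcard, hm, hk, ← pow_add]
    exact pow_dvd_pow _ (by omega)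
  obtain ⟨K, hK, hMK⟩ := Sylow.exists_subgroup_card_pow_succ hdvd hm
  have hp := (Fact.out : p.Prime)
  have hKtop : K = ⊤ := hM.2 K <| lt_of_le_of_ne hMK fun h ↦ by
    rw [← h, hm] at hK
    exact absurd (Nat.pow_right_injective hp.two_le hK) (by omega)
  rw [hKtop, Subgroup.card_top, ← hcard, hm, pow_succ] at hK
  exact Nat.eq_of_mul_eq_mul_left (pow_pos hp.pos m) hK

lemma exists_hom_zmod_of_isCoatom (hQ : IsPGroup p Q) {M : Subgroup Q} (hM : IsCoatom M)
    {x : Q} (hx : x ∉ M) :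
    ∃ χ : Q →* Multiplicative (ZMod p),
      χ x = Multiplicative.ofAdd 1 ∧ ∀ g ∈ M, χ g = 1 := by
  have := hQ.isNilpotent
  have hnormal : M.Normal :=
    Subgroup.NormalizerCondition.normal_of_coatom M Group.normalizerCondition_of_isNilpotent hM
  have hcard : Nat.card (Q ⧸ M) = p := hQ.index_eq_of_isCoatom hM
  have hgen : ∀ y : Q ⧸ M, y ∈ Subgroup.zpowers (x : Q ⧸ M) := fun y ↦
    mem_zpowers_of_prime_card hcard (by simpa using hx)
  refine ⟨(zmodMulEquivOfGenerator hgen hcard).symm.toMonoidHom.comp (QuotientGroup.mk' M),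
    ?_, fun g hg ↦ ?_⟩
  · exact zmodMulEquivOfGenerator_symm_apply_generator hgen hcard
  · simp [(QuotientGroup.eq_one_iff g).2 hg]

lemma exists_isCoatom_ne_of_not_isCyclic (hQ : ¬ IsCyclic Q) :
    ∃ M₁ M₂ : Subgroup Q, IsCoatom M₁ ∧ IsCoatom M₂ ∧ M₁ ≠ M₂ := by
  by_contra! h
  have hbt : (⊥ : Subgroup Q) ≠ ⊤ := fun hbt ↦ hQ <|
    have := (Subgroup.subsingleton_iff.1 (subsingleton_of_bot_eq_top hbt))
    inferInstance
  obtain ⟨M, hM, -⟩ := (eq_top_or_exists_le_coatom (⊥ : Subgroup Q)).resolve_left hbt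
  obtain ⟨x, hx⟩ : ∃ x, x ∉ M := by
    by_contra! hx
    exact hM.1 (Subgroup.eq_top_iff' M |>.2 hx)
  refine hQ (isCyclic_iff_exists_zpowers_eq_top.2 ⟨x, ?_⟩)
  refine (eq_top_or_exists_le_coatom _).resolve_right ?_
  rintro ⟨M', hM', hle⟩
  rw [h M' M hM' hM] at hle
  exact hx (hle (Subgroup.mem_zpowers x))

lemma exists_dual_homs_of_not_isCyclic (hQ : IsPGroup p Q) (hc : ¬ IsCyclic Q) :
    ∃ (χ₁ χ₂ : Q →* Multiplicative (ZMod p)) (x y : Q),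
      χ₁ x = Multiplicative.ofAdd 1 ∧ χ₁ y = 1 ∧ χ₂ x = 1 ∧ χ₂ y = Multiplicative.ofAdd 1 := by
  obtain ⟨M₁, M₂, h₁, h₂, hne⟩ := exists_isCoatom_ne_of_not_isCyclic hc
  have hsub : ∀ {M M' : Subgroup Q}, IsCoatom M → IsCoatom M' → M ≠ M' →
      ∃ x ∈ M, x ∉ M' := fun {M M'} h h' hne ↦ by
    by_contra! hx
    exact hne ((h.le_iff_eq h'.1).1 hx).symm
  obtain ⟨x, hx₁, hx₂⟩ := hsub h₁ h₂ hne
  obtain ⟨y, hy₂, hy₁⟩ := hsub h₂ h₁ hne.symm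
  obtain ⟨χ₁, hχ₁x, hχ₁⟩ := hQ.exists_hom_zmod_of_isCoatom h₂ hx₂
  obtain ⟨χ₂, hχ₂y, hχ₂⟩ := hQ.exists_hom_zmod_of_isCoatom h₁ hy₁
  exact ⟨χ₁, χ₂, x, y, hχ₁x, hχ₁ y hy₂, hχ₂ x hx₁, hχ₂y⟩

end IsPGroup

section QuadraticCochain

variable {A : Type*} [AddCommGroup A]

/-- The value at `x ^ u * y ^ v` of a crossed homomorphism taking the values `c` at `x` and `d`
at `y`, where `a = (x - 1) c`, `b = (y - 1) c = (x - 1) d` and `e = (y - 1) d` are fixed. -/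
def quadraticCochain (c d a b e : A) (u v : ℕ) : A :=
  u • c + u.choose 2 • a + (u * v) • b + v • d + v.choose 2 • e

lemma Nat.add_choose_two_right (u v : ℕ) :
    (u + v).choose 2 = u.choose 2 + v.choose 2 + u * v := by
  induction v with
  | zero => simp
  | succ v ih =>
    rw [← add_assoc, Nat.choose_succ_succ' (u + v) 1, Nat.choose_succ_succ' v 1, ih]
    simp only [Nat.choose_one_right]
    ring

lemma quadraticCochain_add (c d a b e : A) (u v u' v' : ℕ) :
    quadraticCochain c d a b e (u + u') (v + v') =
      quadraticCochain c d a b e u v +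
        (u' • (u • a + v • b) + v' • (u • b + v • e)) +
        quadraticCochain c d a b e u' v' := by
  simp only [quadraticCochain, Nat.add_choose_two_right]
  module

lemma quadraticCochain_mod {p : ℕ} {c d a b e : A}
    (ha : p • a = 0) (hb : p • b = 0) (he : p • e = 0)
    (hc : p • c + p.choose 2 • a = 0) (hd : p • d + p.choose 2 • e = 0) (u v : ℕ) :
    quadraticCochain c d a b e (u % p) (v % p) = quadraticCochain c d a b e u v := by
  have hu : ∀ v, Function.Periodic (fun u ↦ quadraticCochain c d a b e u v) p := fun v u ↦ by
    have := quadraticCochain_add c d a b e u v p 0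
    simp only [add_zero] at this
    simp only [this, smul_add, smul_comm p _ a, smul_comm p _ b, ha, hb]
    simpa [quadraticCochain] using hc
  have hv : ∀ u, Function.Periodic (fun v ↦ quadraticCochain c d a b e u v) p := fun u v ↦ by
    have := quadraticCochain_add c d a b e u v 0 p
    simp only [add_zero] at this
    simp only [this, smul_add, smul_comm p _ e, smul_comm p _ b, he, hb]
    simpa [quadraticCochain] using hd
  rw [(hu _).map_mod_nat u, (hv u).map_mod_nat v]

end QuadraticCochain

section UnipotentAction

open Additive

variable {G : Type*} [Group G] {A : Type*} [AddCommGroup A]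

lemma AddSubgroup.card_prod {A' : Type*} [AddCommGroup A'] (S : AddSubgroup A)
    (T : AddSubgroup A') : Nat.card (S.prod T) = Nat.card S * Nat.card T := by
  rw [Nat.card_congr (S.prodEquiv T).toEquiv, Nat.card_prod]

/-- The elements killed by every `D g`. -/
def fixedByAll (D : Additive G →+ (A →+ A)) : AddSubgroup A := ⨅ g, (D g).ker

lemma mem_fixedByAll {D : Additive G →+ (A →+ A)} {a : A} :
    a ∈ fixedByAll D ↔ ∀ g, D (ofMul g) a = 0 := by
  simp only [fixedByAll, AddSubgroup.mem_iInf, AddMonoidHom.mem_ker]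
  exact ⟨fun h g ↦ h _, fun h g ↦ h g.toMul⟩

lemma exists_ne_zero_mem_fixedByAll [Nontrivial A] {p : ℕ} {D : Additive G →+ (A →+ A)}
    (hA : ∀ a : A, ∃ k : ℕ, p ^ k • a = 0)
    (hD : ∀ g h a, D g (D h a) = 0) :
    ∃ w ∈ fixedByAll D, p • w = 0 ∧ w ≠ 0 := by
  obtain ⟨a, ha, ha0⟩ : ∃ a ∈ fixedByAll D, a ≠ 0 := by
    obtain ⟨b, hb⟩ := exists_ne (0 : A)
    by_cases h : b ∈ fixedByAll D
    · exact ⟨b, h, hb⟩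
    · rw [mem_fixedByAll] at h
      push Not at h
      obtain ⟨g, hg⟩ := h
      exact ⟨_, mem_fixedByAll.2 fun h ↦ hD _ _ _, hg⟩
  have hex := hA a
  classical
  have hpos : Nat.find hex ≠ 0 := fun h ↦ ha0 <| by simpa [h] using Nat.find_spec hex
  refine ⟨p ^ (Nat.find hex - 1) • a, nsmul_mem ha _, ?_, Nat.find_min hex (by omega)⟩
  rw [← mul_nsmul', ← pow_succ', Nat.sub_add_cancel (by omega)]
  exact Nat.find_spec hex

variable {p : ℕ} [Fact p.Prime]

lemma toAdd_val_mul (χ : G →* Multiplicative (ZMod p)) (g h : G) :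
    (χ (g * h)).toAdd.val = ((χ g).toAdd.val + (χ h).toAdd.val) % p := by
  rw [map_mul, toAdd_mul, ZMod.val_add]

/-- The elements killed by `D g` for every `g` in the common kernel of `χ₁` and `χ₂`. -/
def fixedByKers (D : Additive G →+ (A →+ A)) (χ₁ χ₂ : G →* Multiplicative (ZMod p)) :
    AddSubgroup A where
  carrier := {a | ∀ g, χ₁ g = 1 → χ₂ g = 1 → D (ofMul g) a = 0}
  zero_mem' := by simp
  add_mem' := fun ha hb g h₁ h₂ ↦ by simp [ha g h₁ h₂, hb g h₁ h₂]
  neg_mem' := fun ha g h₁ h₂ ↦ by simp [ha g h₁ h₂]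

variable {D : Additive G →+ (A →+ A)} {χ₁ χ₂ : G →* Multiplicative (ZMod p)}

lemma nsmul_apply_eq_zero_of_mem_fixedByKers {a : A} (ha : a ∈ fixedByKers D χ₁ χ₂) (g : G) :
    p • D (ofMul g) a = 0 := by
  have hp : ∀ χ : G →* Multiplicative (ZMod p), χ (g ^ p) = 1 := fun χ ↦ by
    rw [map_pow, ← toAdd_eq_zero, toAdd_pow]
    simp
  simpa using ha (g ^ p) (hp _) (hp _)

lemma apply_eq_of_mem_fixedByKers {x y : G}
    (h₁x : χ₁ x = Multiplicative.ofAdd 1) (h₁y : χ₁ y = 1)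
    (h₂x : χ₂ x = 1) (h₂y : χ₂ y = Multiplicative.ofAdd 1)
    {a : A} (ha : a ∈ fixedByKers D χ₁ χ₂) (g : G) :
    D (ofMul g) a = (χ₁ g).toAdd.val • D (ofMul x) a + (χ₂ g).toAdd.val • D (ofMul y) a := by
  have h := ha ((x ^ (χ₁ g).toAdd.val * y ^ (χ₂ g).toAdd.val)⁻¹ * g)
    (by simp [h₁x, h₁y, ← ofAdd_nsmul])
    (by simp [h₂x, h₂y, ← ofAdd_nsmul])
  simp only [ofMul_mul, ofMul_inv, ofMul_pow, map_add, map_neg, map_nsmul,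
    AddMonoidHom.add_apply, AddMonoidHom.neg_apply, AddMonoidHom.nsmul_apply] at h
  rw [← sub_eq_zero, ← h]
  abel

lemma exists_crossedHom_of_mem_fixedByKers {x y : G}
    (h₁x : χ₁ x = Multiplicative.ofAdd 1) (h₁y : χ₁ y = 1)
    (h₂x : χ₂ x = 1) (h₂y : χ₂ y = Multiplicative.ofAdd 1)
    (hD : ∀ g h a, D g (D h a) = 0)
    {c d : A} (hc : c ∈ fixedByKers D χ₁ χ₂) (hd : d ∈ fixedByKers D χ₁ χ₂)
    (hc' : p • c + p.choose 2 • D (ofMul x) c = 0)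
    (hd' : p • d + p.choose 2 • D (ofMul y) d = 0)
    (hcd : D (ofMul x) d = D (ofMul y) c) :
    ∃ f : G → A, (∀ g h, f (g * h) = f g + D (ofMul h) (f g) + f h) ∧
      (∀ g, χ₁ g = 1 → χ₂ g = 1 → f g = 0) ∧ f x = c ∧ f y = d := by
  have : Fact (1 < p) := ⟨(Fact.out : p.Prime).one_lt⟩
  refine ⟨fun g ↦ quadraticCochain c d (D (ofMul x) c) (D (ofMul y) c) (D (ofMul y) d)
    (χ₁ g).toAdd.val (χ₂ g).toAdd.val, fun g h ↦ ?_, fun g h₁ h₂ ↦ ?_, ?_, ?_⟩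
  · dsimp only
    rw [toAdd_val_mul, toAdd_val_mul, quadraticCochain_mod
      (nsmul_apply_eq_zero_of_mem_fixedByKers hc x) (nsmul_apply_eq_zero_of_mem_fixedByKers hc y)
      (nsmul_apply_eq_zero_of_mem_fixedByKers hd y) hc' hd', quadraticCochain_add]
    congr 2
    simp only [quadraticCochain, map_add, map_nsmul, hD,
      apply_eq_of_mem_fixedByKers h₁x h₁y h₂x h₂y hc h,
      apply_eq_of_mem_fixedByKers h₁x h₁y h₂x h₂y hd h, hcd]
    module
  · simp [quadraticCochain, h₁, h₂]
  · simp [quadraticCochain, h₁x, h₂x, ZMod.val_one]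
  · simp [quadraticCochain, h₁y, h₂y, ZMod.val_one]

theorem exists_crossedHom_not_principal [Finite A] [Nontrivial A] {x y : G}
    (h₁x : χ₁ x = Multiplicative.ofAdd 1) (h₁y : χ₁ y = 1)
    (h₂x : χ₂ x = 1) (h₂y : χ₂ y = Multiplicative.ofAdd 1)
    (hA : ∀ a : A, ∃ k : ℕ, p ^ k • a = 0) (hD : ∀ g h a, D g (D h a) = 0) :
    ∃ f : G → A, (∀ g h, f (g * h) = f g + D (ofMul h) (f g) + f h) ∧
      (∀ g, χ₁ g = 1 → χ₂ g = 1 → f g = 0) ∧ ¬ ∃ a, ∀ g, f g = D (ofMul g) a := by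
  by_contra! H
  let B := fixedByKers D χ₁ χ₂
  let F := fixedByAll D
  let W := F ⊓ (nsmulAddMonoidHom p : A →+ A).ker
  have hW : ∀ {a}, a ∈ W ↔ (∀ g, D (ofMul g) a = 0) ∧ p • a = 0 := fun {a} ↦ by
    simp [W, F, mem_fixedByAll]
  have hDW : ∀ {a} g, a ∈ B → D (ofMul g) a ∈ W := fun g ha ↦
    hW.2 ⟨fun h ↦ hD _ _ _, nsmul_apply_eq_zero_of_mem_fixedByKers ha g⟩
  have hFB : F ≤ B := fun a ha g _ _ ↦ mem_fixedByAll.1 ha g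
  have key : ∀ {c d}, c ∈ B → d ∈ B → p • c + p.choose 2 • D (ofMul x) c = 0 →
      p • d + p.choose 2 • D (ofMul y) d = 0 → D (ofMul x) d = D (ofMul y) c →
      ∃ a ∈ B, D (ofMul x) a = c ∧ D (ofMul y) a = d := fun hc hd hc' hd' hcd ↦ by
    obtain ⟨f, hf, hf₁, rfl, rfl⟩ :=
      exists_crossedHom_of_mem_fixedByKers h₁x h₁y h₂x h₂y hD hc hd hc' hd' hcd
    obtain ⟨a, ha⟩ := H f hf hf₁
    exact ⟨a, fun g h₁ h₂ ↦ (ha g).symm.trans (hf₁ g h₁ h₂), (ha x).symm, (ha y).symm⟩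
  let θ : B →+ A × A := ((D (ofMul x)).prod (D (ofMul y))).comp B.subtype
  let π₁ : B × B →+ A := B.subtype.comp (AddMonoidHom.fst B B)
  let π₂ : B × B →+ A := B.subtype.comp (AddMonoidHom.snd B B)
  let ψ : B × B →+ A × A × A :=
    (p • π₁ + p.choose 2 • (D (ofMul x)).comp π₁).prod
      ((p • π₂ + p.choose 2 • (D (ofMul y)).comp π₂).prod
        ((D (ofMul x)).comp π₂ - (D (ofMul y)).comp π₁))
  have hθrange : Nat.card W * Nat.card W ≤ Nat.card θ.range := by
    rw [← AddSubgroup.card_prod]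
    refine AddSubgroup.card_le_of_le ?_
    rintro ⟨c, d⟩ ⟨hc, hd⟩
    obtain ⟨a, ha, hac, had⟩ := key (hFB hc.1) (hFB hd.1)
      (by simp [(hW.1 hc).1, (hW.1 hc).2]) (by simp [(hW.1 hd).1, (hW.1 hd).2])
      (by simp [(hW.1 hc).1, (hW.1 hd).1])
    exact ⟨⟨a, ha⟩, Prod.ext hac had⟩
  have hθker : Nat.card F ≤ Nat.card θ.ker :=
    Nat.card_le_card_of_injective
      (fun a : F ↦ (⟨⟨a, hFB a.2⟩,
        Prod.ext (mem_fixedByAll.1 a.2 x) (mem_fixedByAll.1 a.2 y)⟩ : θ.ker))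
      fun a b h ↦ Subtype.ext (congrArg (fun z : θ.ker ↦ (z.1 : A)) h)
  have hψker : Nat.card ψ.ker ≤ Nat.card W * Nat.card W := by
    have hmem : ∀ z : ψ.ker, (z.1.1 : A) ∈ W ∧ (z.1.2 : A) ∈ W := by
      rintro ⟨⟨⟨c, hc⟩, ⟨d, hd⟩⟩, h⟩
      obtain ⟨h₁, h₂, h₃⟩ : p • c + p.choose 2 • D (ofMul x) c = 0 ∧
          p • d + p.choose 2 • D (ofMul y) d = 0 ∧ D (ofMul x) d - D (ofMul y) c = 0 := by
        simpa [ψ, π₁, π₂, Prod.ext_iff] using h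
      obtain ⟨a, ha, rfl, rfl⟩ := key hc hd h₁ h₂ (sub_eq_zero.1 h₃)
      exact ⟨hDW x ha, hDW y ha⟩
    rw [← Nat.card_prod]
    refine Nat.card_le_card_of_injective
      (fun z : ψ.ker ↦ ((⟨_, (hmem z).1⟩, ⟨_, (hmem z).2⟩) : W × W)) fun z z' h ↦ ?_
    exact Subtype.ext (Prod.ext (Subtype.ext (congrArg (fun z : W × W ↦ (z.1 : A)) h))
      (Subtype.ext (congrArg (fun z : W × W ↦ (z.2 : A)) h)))
  have hψrange : Nat.card ψ.range ≤ Nat.card F * (Nat.card F * Nat.card W) := by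
    rw [← AddSubgroup.card_prod, ← AddSubgroup.card_prod]
    refine AddSubgroup.card_le_of_le ?_
    have hnorm : ∀ {a} g, a ∈ B → p • a + p.choose 2 • D (ofMul g) a ∈ F := fun g ha ↦
      mem_fixedByAll.2 fun h ↦ by
        simp [hD, nsmul_apply_eq_zero_of_mem_fixedByKers ha h]
    rintro _ ⟨⟨⟨c, hc⟩, ⟨d, hd⟩⟩, rfl⟩
    exact ⟨hnorm x hc, hnorm y hd, W.sub_mem (hDW x hd) (hDW y hc)⟩
  have hB := θ.ker.card_mul_index
  have hBB := ψ.ker.card_mul_index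
  rw [AddSubgroup.index_ker] at hB hBB
  rw [Nat.card_prod] at hBB
  obtain ⟨w, hwF, hpw, hw0⟩ := exists_ne_zero_mem_fixedByAll hA hD
  have hWcard : 1 < Nat.card W :=
    Finite.one_lt_card_iff_nontrivial.2 ⟨⟨w, hwF, hpw⟩, 0, by simpa [Subtype.ext_iff] using hw0⟩
  have hFcard : 0 < Nat.card F := Nat.card_pos
  have hle : Nat.card F * (Nat.card W * Nat.card W) ≤ Nat.card B :=
    hB ▸ Nat.mul_le_mul hθker hθrange
  have hle' : Nat.card B * Nat.card B ≤
      Nat.card W * Nat.card W * (Nat.card F * (Nat.card F * Nat.card W)) :=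
    hBB ▸ Nat.mul_le_mul hψker hψrange
  have hcontr : Nat.card F ^ 2 * Nat.card W ^ 3 * Nat.card W ≤
      Nat.card F ^ 2 * Nat.card W ^ 3 * 1 := by
    calc _ = Nat.card F * (Nat.card W * Nat.card W) *
          (Nat.card F * (Nat.card W * Nat.card W)) := by ring
      _ ≤ _ := Nat.mul_le_mul hle hle
      _ ≤ _ := hle'
      _ = _ := by ring
  exact absurd (Nat.le_of_mul_le_mul_left hcontr (by positivity)) (by omega)

end UnipotentAction

section ClassTwo

open scoped commutatorElement

variable {G : Type*} [Group G]

lemma inv_mul_conj_mem_center (hclass : commutator G ≤ Subgroup.center G) (a g : G) :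
    a⁻¹ * (g⁻¹ * a * g) ∈ Subgroup.center G := by
  have h : ⁅a⁻¹, g⁻¹⁆ ∈ commutator G :=
    Subgroup.commutator_mem_commutator (Subgroup.mem_top _) (Subgroup.mem_top _)
  simpa [commutatorElement_def, mul_assoc] using hclass h

lemma inv_mul_conj_mul_left (hclass : commutator G ≤ Subgroup.center G) (a b g : G) :
    (a * b)⁻¹ * (g⁻¹ * (a * b) * g) = a⁻¹ * (g⁻¹ * a * g) * (b⁻¹ * (g⁻¹ * b * g)) := by
  have h := Subgroup.mem_center_iff.1 (inv_mul_conj_mem_center hclass a g) b⁻¹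
  rw [← mul_assoc _ b⁻¹, ← h]
  group

lemma inv_mul_conj_mul_right (hclass : commutator G ≤ Subgroup.center G) (a g h : G) :
    a⁻¹ * ((g * h)⁻¹ * a * (g * h)) = a⁻¹ * (g⁻¹ * a * g) * (a⁻¹ * (h⁻¹ * a * h)) := by
  have hc := Subgroup.mem_center_iff.1 (inv_mul_conj_mem_center hclass a g) (a⁻¹ * (h⁻¹ * a))
  rw [← mul_assoc a⁻¹ (h⁻¹ * a), ← mul_assoc (a⁻¹ * (g⁻¹ * a * g)), ← hc]
  group

/-- The center of the subgroup `N`, as a subgroup of `G`. -/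
abbrev Subgroup.innerCenter (N : Subgroup G) : Subgroup G := N ⊓ Subgroup.centralizer N

lemma Subgroup.mem_innerCenter {N : Subgroup G} {a : G} :
    a ∈ N.innerCenter ↔ a ∈ N ∧ ∀ m ∈ N, a * m = m * a := by
  rw [Subgroup.mem_inf, Subgroup.mem_centralizer_iff]
  exact and_congr_right fun _ ↦ forall₂_congr fun _ _ ↦ eq_comm

instance (N : Subgroup G) : CommGroup N.innerCenter where
  mul_comm a b := Subtype.ext ((Subgroup.mem_innerCenter.1 a.2).2 b b.2.1)

/-- In a group of class at most two, the homomorphism sending `g` to the endomorphism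
`a ↦ a⁻¹ * (g⁻¹ * a * g)` of the center of a normal subgroup. -/
def commutatorEnd (hclass : commutator G ≤ Subgroup.center G) (N : Subgroup G) [N.Normal] :
    Additive G →+ (Additive N.innerCenter →+ Additive N.innerCenter) :=
  AddMonoidHom.mk' (fun g ↦ AddMonoidHom.mk'
    (fun a ↦ Additive.ofMul ⟨(a.toMul : G)⁻¹ * (g.toMul⁻¹ * a.toMul * g.toMul),
      Subgroup.mul_mem _ (Subgroup.inv_mem _ a.toMul.2) <| by
        simpa using (inferInstance : N.innerCenter.Normal).conj_mem _ a.toMul.2 g.toMul⁻¹⟩)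
    fun a b ↦ Subtype.ext (inv_mul_conj_mul_left hclass a.toMul.1 b.toMul.1 g.toMul))
    fun g h ↦ AddMonoidHom.ext fun a ↦
      Subtype.ext (inv_mul_conj_mul_right hclass a.toMul.1 g.toMul h.toMul)

lemma coe_commutatorEnd (hclass : commutator G ≤ Subgroup.center G) (N : Subgroup G) [N.Normal]
    (g : Additive G) (a : Additive N.innerCenter) :
    ((commutatorEnd hclass N g a).toMul : G) =
      (a.toMul : G)⁻¹ * (g.toMul⁻¹ * a.toMul * g.toMul) := rfl

lemma commutatorEnd_commutatorEnd (hclass : commutator G ≤ Subgroup.center G) (N : Subgroup G)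
    [N.Normal] (g h : Additive G) (a : Additive N.innerCenter) :
    commutatorEnd hclass N g (commutatorEnd hclass N h a) = 0 := by
  refine Subtype.ext ?_
  change ((commutatorEnd hclass N g (commutatorEnd hclass N h a)).toMul : G) = 1
  have hc := Subgroup.mem_center_iff.1
    (inv_mul_conj_mem_center hclass (a.toMul : G) h.toMul) g.toMul⁻¹
  rw [coe_commutatorEnd, coe_commutatorEnd, hc]
  group

lemma Subgroup.innerCenter_nontrivial {p : ℕ} [Fact p.Prime] [Finite G] (hpG : IsPGroup p G)
    {N : Subgroup G} (hN : N ≠ ⊥) : Nontrivial N.innerCenter := by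
  have : Nontrivial N := N.nontrivial_iff_ne_bot.2 hN
  have := (hpG.to_subgroup N).center_nontrivial
  obtain ⟨z, hz⟩ := exists_ne (1 : Subgroup.center N)
  refine ⟨⟨⟨(z : N), Subgroup.mem_innerCenter.2 ⟨z.1.2, fun m hm ↦ ?_⟩⟩, 1, fun h ↦ hz ?_⟩⟩
  · exact congrArg Subtype.val (Subgroup.mem_center_iff.1 z.2 ⟨m, hm⟩).symm
  · exact Subtype.ext (Subtype.ext (congrArg (fun w : N.innerCenter ↦ (w : G)) h))

end ClassTwo

/-- Let `G` be a finite `p`-group of nilpotency class at most 2 and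
`N` a nontrivial normal subgroup with `G/N` non-cyclic. Then there is a
non-principal crossed homomorphism of `G/N` with values in `Z(N)`; i.e.
`H¹(G/N, Z(N)) ≠ 0`. -/
theorem stmt16 {p : ℕ} (hp : p.Prime) (G : Type*) [Group G] [Finite G]
    (hpG : IsPGroup p G) (hclass : commutator G ≤ Subgroup.center G)
    (N : Subgroup G) (hN : N.Normal) (hnt : N ≠ ⊥)
    (hnc : ¬ IsCyclic (G ⧸ N)) :
    ∃ f : G → G,
      (∀ g : G, f g ∈ N ∧ ∀ m ∈ N, f g * m = m * f g) ∧
      (∀ x y : G, f (x * y) = y⁻¹ * f x * y * f y) ∧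
      (∀ n ∈ N, f n = 1) ∧
      ¬ ∃ a : G, (a ∈ N ∧ ∀ m ∈ N, a * m = m * a) ∧
        ∀ g : G, f g = a⁻¹ * (g⁻¹ * a * g) := by
  have : Fact p.Prime := ⟨hp⟩
  have := Subgroup.innerCenter_nontrivial hpG hnt
  obtain ⟨χ₁, χ₂, x, y, h₁x, h₁y, h₂x, h₂y⟩ :=
    (hpG.to_quotient N).exists_dual_homs_of_not_isCyclic hnc
  obtain ⟨x, rfl⟩ := QuotientGroup.mk_surjective x
  obtain ⟨y, rfl⟩ := QuotientGroup.mk_surjective y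
  let π := QuotientGroup.mk' N
  obtain ⟨f, hf, hfN, hprin⟩ := exists_crossedHom_not_principal
    (A := Additive N.innerCenter) (D := commutatorEnd hclass N)
    (χ₁ := χ₁.comp π) (χ₂ := χ₂.comp π) h₁x h₁y h₂x h₂y
    (fun a ↦ (hpG.to_subgroup N.innerCenter a.toMul).imp fun k hk ↦ hk)
    (commutatorEnd_commutatorEnd hclass N)
  refine ⟨fun g ↦ (f g).toMul, fun g ↦ Subgroup.mem_innerCenter.1 (f g).toMul.2,
    fun g h ↦ ?_, fun n hn ↦ ?_, ?_⟩
  · simp only [hf, toMul_add, Subgroup.coe_mul, coe_commutatorEnd, toMul_ofMul]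
    group
  · have hπ : π n = 1 := (QuotientGroup.eq_one_iff n).2 hn
    simp [hfN n (by simp [hπ]) (by simp [hπ])]
  · rintro ⟨a, ha, hfa⟩
    exact hprin ⟨Additive.ofMul ⟨a, Subgroup.mem_innerCenter.2 ha⟩, fun g ↦ Subtype.ext (hfa g)⟩
end
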